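/- arXiv:2008.00935 — 5 statements merged into one kernel-verified Lean document; each statement's English description precedes it below -/
import Mathlib

section
/- Let n ≥ 2, let S = {σ(t) : t ∈ D} be a rationally parameterisable hypersurface in ℝⁿ, and let O be a nonempty open subset of D ∖ σ₁⁻¹(0) in ℝ^{n−1} that satisfies the hyperplane condition and the inner point condition. Let d ∈ ℤ, let v₁,…,v_m be distinct points of ℝⁿ, and for each k ∈ {1,…,m} let P_k = A_k/B_k be a rational function in n variables with complex coefficients (B_k not the zero polynomial) that is homogeneous of degree d, i.e. P_k(λx) = λ^d P_k(x) for all λ ∈ ℝ ∖ {0} and all x with B_k(x) ≠ 0 and B_k(λx) ≠ 0. If the E-function F(x) = ∑_{k=1}^m P_k(x) · exp(−i v_k·x) vanishes at every x ∈ σ(O) at which all B_k are nonzero, and all B_k are nonzero on σ(O), then every numerator A_k is the zero polynomial, i.e. F vanishes at every point of ℝⁿ at which it is defined. -/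
open scoped RealInnerProductSpace
open Polynomial in
theorem efx_alg (p r N Q : ℂ[X]) (hQ : Q ≠ 0) (hp : p ≠ 0) (hr : r ≠ 0)
    (hc : IsCoprime N Q)
    (h : Q ^ 2 * (p * derivative r - r * derivative p)
      + (derivative N * Q - N * derivative Q) * (p * r) = 0) :
    ∃ c, N = C c * Q := by
  have hroot : ∀ α, Q.eval α ≠ 0 := by
    intro α hα
    have hNα : N.eval α ≠ 0 := by
      intro h0
      obtain ⟨a, b, hab⟩ := hc
      have := congrArg (eval α) hab
      simp [h0, hα] at this
    obtain ⟨Q1, hQ1, hQ1'⟩ := Polynomial.exists_eq_pow_rootMultiplicity_mul_and_not_dvd Q hQ α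
    obtain ⟨p1, hp1, hp1'⟩ := Polynomial.exists_eq_pow_rootMultiplicity_mul_and_not_dvd p hp α
    obtain ⟨r1, hr1, hr1'⟩ := Polynomial.exists_eq_pow_rootMultiplicity_mul_and_not_dvd r hr α
    have hm : 0 < rootMultiplicity α Q := (Polynomial.rootMultiplicity_pos hQ).2 hα
    obtain ⟨M, hM⟩ : ∃ M, rootMultiplicity α Q = M + 1 := ⟨_, (Nat.succ_pred_eq_of_pos hm).symm⟩
    rw [hM] at hQ1
    generalize rootMultiplicity α p = a at hp1
    generalize rootMultiplicity α r = b at hr1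
    rw [dvd_iff_isRoot, IsRoot] at hQ1' hp1' hr1'
    set Z : ℂ[X] := X - C α with hZ
    have hZ0 : Z ≠ 0 := X_sub_C_ne_zero α
    have hd : derivative Z = 1 := by simp [hZ]
    have key : ∀ (n : ℕ) (f : ℂ[X]), Z * derivative (Z ^ n * f)
        = Z ^ n * ((n : ℂ[X]) * f + Z * derivative f) := by
      intro n f
      cases n with
      | zero => simp
      | succ n =>
        rw [derivative_mul, derivative_pow, hd]
        simp
        ring
    have kQ := key (M+1) Q1
    have kp := key a p1
    have kr := key b r1
    rw [← hQ1] at kQ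
    rw [← hp1] at kp
    rw [← hr1] at kr
    have e1 : Z ^ (M + 1 + a + b) * (Z ^ (M+1) * Q1 ^ 2 *
        (p1 * ((b : ℂ[X]) * r1 + Z * derivative r1) - r1 * ((a : ℂ[X]) * p1 + Z * derivative p1))
        + (Z * derivative N * Q1 - N * (((M+1 : ℕ) : ℂ[X]) * Q1 + Z * derivative Q1)) * (p1 * r1)) = 0 := by
      have h2 : Q ^ 2 * (p * (Z * derivative r) - r * (Z * derivative p))
        + (Z * derivative N * Q - N * (Z * derivative Q)) * (p * r) = 0 := by
        linear_combination Z * h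
      rw [kQ, kp, kr] at h2
      rw [hQ1, hp1, hr1] at h2
      rw [← h2]
      ring
    have e2 := (mul_eq_zero.1 e1).resolve_left (pow_ne_zero _ hZ0)
    have e3 := congrArg (eval α) e2
    have hZα : eval α Z = 0 := by simp [hZ]
    simp only [eval_add, eval_mul, eval_pow, eval_sub, hZα, eval_natCast, eval_zero] at e3
    have hM1 : ((M + 1 : ℕ) : ℂ) ≠ 0 := by exact_mod_cast Nat.succ_ne_zero M
    have : ((M+1 : ℕ) : ℂ) * eval α N * eval α Q1 * eval α p1 * eval α r1 = 0 := by
      simp at e3 ⊢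
      tauto
    simp only [mul_eq_zero] at this
    tauto
  have hdeg : Q.degree = 0 := by
    by_contra hne
    obtain ⟨α, hα⟩ := IsAlgClosed.exists_root Q hne
    exact hroot α hα
  obtain ⟨c, hcc⟩ : ∃ c, Q = C c := ⟨_, eq_C_of_degree_eq_zero hdeg⟩
  have hc0 : c ≠ 0 := by rintro rfl; simp [hcc] at hQ
  have hN : derivative N = 0 := by
    by_contra hN
    rw [hcc] at h
    simp only [derivative_C, mul_zero, sub_zero] at h
    have h3 : C c * derivative N * (p * r) = C (c^2) * (r * derivative p - p * derivative r) := by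
      rw [C_pow]; linear_combination h
    have hprd : (r * derivative p - p * derivative r).degree < (p * r).degree := by
      refine (degree_sub_le _ _).trans_lt (max_lt ?_ ?_)
      · rw [mul_comm p r, degree_mul, degree_mul]
        exact WithBot.add_lt_add_left (by simpa using hr) (degree_derivative_lt hp)
      · rw [degree_mul, degree_mul]
        exact WithBot.add_lt_add_left (by simpa using hp) (degree_derivative_lt hr)
    have h4 := congrArg degree h3
    rw [degree_mul, degree_mul, degree_C hc0, degree_mul (p := C (c ^ 2)), degree_C (pow_ne_zero 2 hc0), zero_add,
      zero_add] at h4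
    rw [← h4] at hprd
    have : (p * r).degree ≤ (derivative N).degree + (p * r).degree := by
      have := zero_le_degree_iff.2 hN
      exact le_add_of_nonneg_left this
    exact absurd hprd (not_lt.2 this)
  have hNC := derivative_eq_zero.1 hN
  rw [natDegree_eq_zero] at hNC
  obtain ⟨e, he⟩ := hNC
  exact ⟨e / c, by rw [hcc, ← he, ← C_mul, div_mul_cancel₀ _ hc0]⟩

open Polynomial in
theorem efx_alg2 (p r N Q : ℂ[X]) (hQ : Q ≠ 0) (hp : p ≠ 0) (hr : r ≠ 0)
    (h : Q ^ 2 * (p * derivative r - r * derivative p)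
      + (derivative N * Q - N * derivative Q) * (p * r) = 0) :
    ∃ c, N = C c * Q := by
  classical
  obtain ⟨N1, Q1, hco, hN1, hQ1⟩ : ∃ N1 Q1 : ℂ[X], IsCoprime N1 Q1 ∧
      N = EuclideanDomain.gcd N Q * N1 ∧ Q = EuclideanDomain.gcd N Q * Q1 := by
    obtain ⟨N1, hN1⟩ := EuclideanDomain.gcd_dvd_left N Q
    obtain ⟨Q1, hQ1⟩ := EuclideanDomain.gcd_dvd_right N Q
    have hab := EuclideanDomain.gcd_eq_gcd_ab N Q
    have hg0 : EuclideanDomain.gcd N Q ≠ 0 := fun h => hQ (EuclideanDomain.gcd_eq_zero_iff.1 h).2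
    refine ⟨N1, Q1, ?_, hN1, hQ1⟩
    generalize EuclideanDomain.gcdA N Q = a at hab
    generalize EuclideanDomain.gcdB N Q = b at hab
    generalize EuclideanDomain.gcd N Q = g at *
    refine ⟨a, b, mul_left_cancel₀ hg0 ?_⟩
    rw [hN1, hQ1] at hab
    linear_combination -hab
  generalize EuclideanDomain.gcd N Q = g at hN1 hQ1
  have hg : g ≠ 0 := by rintro rfl; simp at hQ1; exact hQ hQ1
  have hQ1n : Q1 ≠ 0 := by rintro rfl; simp at hQ1; exact hQ hQ1
  have h1 : g ^ 2 * (Q1 ^ 2 * (p * derivative r - r * derivative p)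
      + (derivative N1 * Q1 - N1 * derivative Q1) * (p * r)) = 0 := by
    rw [hN1, hQ1] at h
    simp only [derivative_mul] at h
    linear_combination h
  obtain ⟨c, hc⟩ := efx_alg p r N1 Q1 hQ1n hp hr hco
    ((mul_eq_zero.1 h1).resolve_left (pow_ne_zero _ hg))
  exact ⟨c, by rw [hN1, hQ1, hc]; ring⟩

open Polynomial in
theorem efx_poly_zero (p : ℂ[X]) (U : Set ℝ) (hU : IsOpen U) (hne : U.Nonempty)
    (h : ∀ s ∈ U, p.eval (s : ℂ) = 0) : p = 0 := by
  refine Polynomial.eq_zero_of_infinite_isRoot p ?_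
  have : (((↑) : ℝ → ℂ) '' U).Infinite := by
    refine Set.Infinite.image Complex.ofReal_injective.injOn ?_
    obtain ⟨x, hx⟩ := hne
    exact infinite_of_mem_nhds x (hU.mem_nhds hx)
  refine this.mono ?_
  rintro _ ⟨s, hs, rfl⟩
  exact h s hs

open Polynomial in
theorem efx_one {ι : Type*} [DecidableEq ι] (N : ι → ℂ[X]) (Q : ℂ[X]) (U : Set ℝ) (hU : IsOpen U)
    (hne : U.Nonempty) (hQ : ∀ s ∈ U, Q.eval (s : ℂ) ≠ 0) (K : Finset ι)
    (hN : ∀ k l, k ≠ l → ¬ ∃ c, N k - N l = C c * Q) :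
    ∀ p : ι → ℂ[X], (∀ s ∈ U, ∑ k ∈ K, (p k).eval (s : ℂ) *
      Complex.exp ((N k).eval (s : ℂ) / Q.eval (s : ℂ)) = 0) → ∀ k ∈ K, p k = 0 := by
  have hQ0 : Q ≠ 0 := by
    rintro rfl
    obtain ⟨x, hx⟩ := hne
    exact hQ x hx (by simp)
  induction K using Finset.induction_on with
  | empty => simp
  | insert j K hj ih =>
    intro p hp
    by_cases hpj : p j = 0
    · have := ih p (by
        intro s hs
        have := hp s hs
        rw [Finset.sum_insert hj, hpj] at this
        simpa using this)
      intro k hk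
      rcases Finset.mem_insert.1 hk with rfl | hk
      · exact hpj
      · exact this k hk
    exfalso
    set G : ι → ℂ[X] := fun k => derivative (N k) * Q - N k * derivative Q with hG
    set E : ι → ℝ → ℂ := fun k s => Complex.exp ((N k).eval (s : ℂ) / Q.eval (s : ℂ)) with hE
    have hder : ∀ s ∈ U, ∑ k ∈ insert j K,
        (Q ^ 2 * derivative (p k) + G k * p k).eval (s : ℂ) * E k s = 0 := by
      intro s hs
      have hd : ∀ k, HasDerivAt (fun s : ℝ => (p k).eval (s : ℂ) * E k s)
          ((derivative (p k)).eval (s : ℂ) * E k s + (p k).eval (s : ℂ) *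
            (E k s * (((derivative (N k)).eval (s:ℂ) * Q.eval (s : ℂ) -
              (N k).eval (s : ℂ) * (derivative Q).eval (s : ℂ)) / Q.eval (s : ℂ) ^ 2))) s := by
        intro k
        have h1 := ((p k).hasDerivAt (s : ℂ)).comp_ofReal
        have h2 := ((N k).hasDerivAt (s : ℂ)).comp_ofReal
        have h3 := (Q.hasDerivAt (s : ℂ)).comp_ofReal
        exact h1.mul (h2.div h3 (hQ s hs)).cexp
      have hs1 := HasDerivAt.fun_sum (u := insert j K) (fun k _ => hd k)
      have hs2 : HasDerivAt (fun s : ℝ => ∑ k ∈ insert j K, (p k).eval (s : ℂ) * E k s) 0 s := by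
        refine (hasDerivAt_const s (0 : ℂ)).congr_of_eventuallyEq ?_
        filter_upwards [hU.mem_nhds hs] with x hx
        exact hp x hx
      have h0 := hs1.unique hs2
      have h1 := congrArg (fun z => Q.eval (s : ℂ) ^ 2 * z) h0
      simp only [mul_zero] at h1
      rw [Finset.mul_sum] at h1
      rw [← h1]
      refine Finset.sum_congr rfl fun k _ => ?_
      have := hQ s hs
      simp only [hG, eval_add, eval_mul, eval_pow, eval_sub]
      field_simp
    have hzero : ∀ k ∈ K, p k = 0 := by
      have := ih (fun k => p j * (Q ^ 2 * derivative (p k) + G k * p k)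
          - p k * (Q ^ 2 * derivative (p j) + G j * p j)) (by
        intro s hs
        have h1 := hder s hs
        have h2 := hp s hs
        rw [Finset.sum_insert hj] at h1 h2
        have h3 : ∀ k ∈ K, (p j * (Q ^ 2 * derivative (p k) + G k * p k)
          - p k * (Q ^ 2 * derivative (p j) + G j * p j)).eval (s : ℂ) * E k s
          = (p j).eval (s:ℂ) * ((Q ^ 2 * derivative (p k) + G k * p k).eval (s : ℂ) * E k s)
          - (Q ^ 2 * derivative (p j) + G j * p j).eval (s : ℂ) * ((p k).eval (s:ℂ) * E k s) := by
          intro k _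
          rw [eval_sub, eval_mul, eval_mul]
          ring
        rw [Finset.sum_congr rfl h3, Finset.sum_sub_distrib, ← Finset.mul_sum, ← Finset.mul_sum]
        linear_combination (p j).eval (s:ℂ) * h1 -
          (Q ^ 2 * derivative (p j) + G j * p j).eval (s : ℂ) * h2)
      intro k hk
      by_contra hpk
      have hkj : k ≠ j := by rintro rfl; exact hj hk
      refine hN k j hkj (efx_alg2 (p j) (p k) _ Q hQ0 hpj hpk ?_)
      have h4 := this k hk
      simp only [hG] at h4
      rw [derivative_sub]
      linear_combination h4
    apply hpj
    refine efx_poly_zero _ U hU hne fun s hs => ?_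
    have h2 := hp s hs
    rw [Finset.sum_insert hj, Finset.sum_eq_zero (fun k hk => by simp [hzero k hk])] at h2
    simpa [Complex.exp_ne_zero] using h2

theorem efx_mv_zero {ι : Type*} [Finite ι] (p : MvPolynomial ι ℂ) (U : Set (ι → ℝ)) (hU : IsOpen U)
    (hne : U.Nonempty) (h : ∀ x ∈ U, MvPolynomial.eval (fun i => (x i : ℂ)) p = 0) : p = 0 := by
  have := Fintype.ofFinite ι
  obtain ⟨x, hx⟩ := hne
  obtain ⟨ε, hε, hb⟩ := Metric.isOpen_iff.1 hU x hx
  refine MvPolynomial.funext_set (fun i => ((↑) : ℝ → ℂ) '' Metric.ball (x i) ε) ?_ ?_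
  · intro i
    refine Set.Infinite.image Complex.ofReal_injective.injOn ?_
    exact infinite_of_mem_nhds (x i) (Metric.ball_mem_nhds _ hε)
  · intro z hz
    choose y hy hyz using fun i => hz i (Set.mem_univ i)
    have : z = fun i => (y i : ℂ) := funext fun i => (hyz i).symm
    rw [this, map_zero]
    apply h y
    apply hb
    rw [ball_pi _ hε]
    exact fun i _ => hy i

def EfxRat {q : ℕ} (O : Set (Fin q → ℝ)) (f : (Fin q → ℝ) → ℂ) : Prop :=
  ∃ a b : MvPolynomial (Fin q) ℂ, ∀ t ∈ O, MvPolynomial.eval (fun i => (t i : ℂ)) b ≠ 0 ∧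
    f t = MvPolynomial.eval (fun i => (t i : ℂ)) a / MvPolynomial.eval (fun i => (t i : ℂ)) b

theorem EfxRat.const {q : ℕ} (O : Set (Fin q → ℝ)) (c : ℂ) : EfxRat O (fun _ => c) :=
  ⟨MvPolynomial.C c, 1, fun t _ => by simp⟩

theorem EfxRat.add {q : ℕ} {O : Set (Fin q → ℝ)} {f g : (Fin q → ℝ) → ℂ} (hf : EfxRat O f)
    (hg : EfxRat O g) : EfxRat O (fun t => f t + g t) := by
  obtain ⟨a, b, h⟩ := hf
  obtain ⟨a', b', h'⟩ := hg
  refine ⟨a * b' + b * a', b * b', fun t ht => ?_⟩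
  obtain ⟨h1, h2⟩ := h t ht
  obtain ⟨h3, h4⟩ := h' t ht
  simp only [map_mul, map_add]
  exact ⟨mul_ne_zero h1 h3, by rw [h2, h4, div_add_div _ _ h1 h3]⟩

theorem EfxRat.mul {q : ℕ} {O : Set (Fin q → ℝ)} {f g : (Fin q → ℝ) → ℂ} (hf : EfxRat O f)
    (hg : EfxRat O g) : EfxRat O (fun t => f t * g t) := by
  obtain ⟨a, b, h⟩ := hf
  obtain ⟨a', b', h'⟩ := hg
  refine ⟨a * a', b * b', fun t ht => ?_⟩
  obtain ⟨h1, h2⟩ := h t ht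
  obtain ⟨h3, h4⟩ := h' t ht
  simp only [map_mul]
  exact ⟨mul_ne_zero h1 h3, by rw [h2, h4, div_mul_div_comm]⟩

theorem EfxRat.div {q : ℕ} {O : Set (Fin q → ℝ)} {f g : (Fin q → ℝ) → ℂ} (hf : EfxRat O f)
    (hg : EfxRat O g) (hg0 : ∀ t ∈ O, g t ≠ 0) : EfxRat O (fun t => f t / g t) := by
  obtain ⟨a, b, h⟩ := hf
  obtain ⟨a', b', h'⟩ := hg
  refine ⟨a * b', b * a', fun t ht => ?_⟩
  obtain ⟨h1, h2⟩ := h t ht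
  obtain ⟨h3, h4⟩ := h' t ht
  have h5 := hg0 t ht
  simp only [map_mul]
  refine ⟨mul_ne_zero h1 ?_, by rw [h2, h4, div_div_div_eq]⟩
  intro h6
  rw [h4, h6] at h5
  simp at h5

theorem EfxRat.sum {q : ℕ} {O : Set (Fin q → ℝ)} {ι : Type*} (s : Finset ι)
    {f : ι → (Fin q → ℝ) → ℂ} (hf : ∀ i, EfxRat O (f i)) :
    EfxRat O (fun t => ∑ i ∈ s, f i t) := by
  classical
  induction s using Finset.induction_on with
  | empty => simpa using EfxRat.const O 0
  | insert j s hj ih =>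
    simp only [Finset.sum_insert hj]
    exact (hf j).add ih

theorem EfxRat.eval {q : ℕ} {O : Set (Fin q → ℝ)} {ι : Type*}
    {f : ι → (Fin q → ℝ) → ℂ} (hf : ∀ i, EfxRat O (f i)) (P : MvPolynomial ι ℂ) :
    EfxRat O (fun t => MvPolynomial.eval (fun i => f i t) P) := by
  induction P using MvPolynomial.induction_on with
  | C c => simpa using EfxRat.const O c
  | add p r hp hr => simpa using hp.add hr
  | mul_X p i hp => simpa using hp.mul (hf i)

theorem EfxRat.exists_ne {q : ℕ} {O : Set (Fin q → ℝ)} (hO : IsOpen O) (hne : O.Nonempty)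
    {ι : Type*} (s : Finset ι)
    {f : ι → (Fin q → ℝ) → ℂ} (hf : ∀ i, EfxRat O (f i)) (h : ∀ i ∈ s, ∃ t ∈ O, f i t ≠ 0) :
    ∃ t ∈ O, ∀ i ∈ s, f i t ≠ 0 := by
  choose a b hab using hf
  by_contra hcon
  push Not at hcon
  have h0 : ∏ i ∈ s, a i = 0 := by
    refine efx_mv_zero _ O hO hne fun t ht => ?_
    obtain ⟨i, hi, hz⟩ := hcon t ht
    rw [map_prod]
    refine Finset.prod_eq_zero hi ?_
    obtain ⟨h1, h2⟩ := hab i t ht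
    rw [hz] at h2
    rcases div_eq_zero_iff.1 h2.symm with h3 | h3
    · exact h3
    · exact absurd h3 h1
  obtain ⟨i, hi, hz⟩ := Finset.prod_eq_zero_iff.1 h0
  obtain ⟨t, ht, h1⟩ := h i hi
  rw [(hab i t ht).2, hz] at h1
  simp at h1

theorem EfxRat.common {q : ℕ} {O : Set (Fin q → ℝ)} {ι : Type*} [Fintype ι]
    {f : ι → (Fin q → ℝ) → ℂ} (hf : ∀ i, EfxRat O (f i)) :
    ∃ (a : ι → MvPolynomial (Fin q) ℂ) (b : MvPolynomial (Fin q) ℂ), ∀ t ∈ O,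
      MvPolynomial.eval (fun i => (t i : ℂ)) b ≠ 0 ∧ ∀ i, f i t =
      MvPolynomial.eval (fun i => (t i : ℂ)) (a i) / MvPolynomial.eval (fun i => (t i : ℂ)) b := by
  classical
  choose a b hab using hf
  refine ⟨fun i => a i * ∏ j ∈ Finset.univ.erase i, b j, ∏ j, b j, fun t ht => ⟨?_, fun i => ?_⟩⟩
  · rw [map_prod]
    exact Finset.prod_ne_zero_iff.2 fun j _ => (hab j t ht).1
  · rw [← Finset.mul_prod_erase Finset.univ b (Finset.mem_univ i), map_mul, map_mul,
      mul_div_mul_right, (hab i t ht).2]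
    rw [map_prod]
    exact Finset.prod_ne_zero_iff.2 fun j _ => (hab j t ht).1

theorem efx_line {q : ℕ} (t u : Fin q → ℝ) (p : MvPolynomial (Fin q) ℂ) (s : ℝ) :
    Polynomial.eval (s : ℂ) (MvPolynomial.aeval (fun i => Polynomial.C (t i : ℂ) +
      Polynomial.X * Polynomial.C (u i : ℂ)) p) =
    MvPolynomial.eval (fun i => (((t + s • u) i : ℝ) : ℂ)) p := by
  induction p using MvPolynomial.induction_on with
  | C c => simp
  | add p r hp hr => rw [map_add, map_add, Polynomial.eval_add, hp, hr]
  | mul_X p i hp =>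
    rw [map_mul, map_mul, Polynomial.eval_mul, hp]
    simp
    left
    ring

theorem efx_multi {q : ℕ} {O : Set (Fin q → ℝ)} (hO : IsOpen O) (hne : O.Nonempty)
    {ι : Type*} [Fintype ι] [DecidableEq ι] (R φ : ι → (Fin q → ℝ) → ℂ)
    (hR : ∀ i, EfxRat O (R i)) (hφ : ∀ i, EfxRat O (φ i))
    (hnc : ∀ k l, k ≠ l → ∀ c, ∃ t ∈ O, φ k t - φ l t ≠ c)
    (h0 : ∀ t ∈ O, ∑ k, R k t * Complex.exp (φ k t) = 0) : ∀ k, ∀ t ∈ O, R k t = 0 := by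
  intro k₀ t₀ ht₀
  obtain ⟨t₁, ht₁, hne₁⟩ : ∃ t ∈ O, ∀ i ∈ (Finset.univ : Finset (ι × ι)).filter (fun i : ι × ι => i.1 ≠ i.2),
      (φ i.1 t + (-1) * φ i.2 t) + -(φ i.1 t₀ - φ i.2 t₀) ≠ 0 := by
    refine EfxRat.exists_ne hO hne _ (f := fun (i : ι × ι) t =>
      (φ i.1 t + (-1) * φ i.2 t) + -(φ i.1 t₀ - φ i.2 t₀)) (fun i => ?_) (fun i hi => ?_)
    · exact ((hφ _).add ((EfxRat.const O (-1)).mul (hφ _))).add (EfxRat.const O _)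
    · obtain ⟨t, ht, h⟩ := hnc i.1 i.2 (by simpa using hi) (φ i.1 t₀ - φ i.2 t₀)
      refine ⟨t, ht, fun h' => h ?_⟩
      linear_combination h'
  obtain ⟨a, b, hab⟩ := EfxRat.common hR
  obtain ⟨N, Q, hNQ⟩ := EfxRat.common hφ
  set u := t₁ - t₀ with hu
  set L : MvPolynomial (Fin q) ℂ → Polynomial ℂ := fun p =>
    MvPolynomial.aeval (fun i => Polynomial.C (t₀ i : ℂ) + Polynomial.X * Polynomial.C (u i : ℂ)) p
    with hL
  have hLe : ∀ p (s : ℝ), (L p).eval (s : ℂ) = MvPolynomial.eval (fun i => (((t₀ + s • u) i : ℝ) : ℂ)) p :=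
    fun p s => efx_line t₀ u p s
  set U : Set ℝ := (fun s : ℝ => t₀ + s • u) ⁻¹' O with hU
  have hUo : IsOpen U := hO.preimage (by fun_prop)
  have hz : (0 : ℝ) ∈ U := by simpa [hU] using ht₀
  have ho : (1 : ℝ) ∈ U := by simpa [hU, hu] using ht₁
  have key := efx_one (fun k => L (N k)) (L Q) U hUo ⟨0, hz⟩
    (fun s hs => by rw [hLe]; exact (hNQ _ hs).1) Finset.univ (by
      rintro k l hkl ⟨c, hc⟩
      have hval : ∀ s ∈ U, φ k (t₀ + s • u) - φ l (t₀ + s • u) = c := by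
        intro s hs
        have h1 := congrArg (Polynomial.eval (s : ℂ)) hc
        simp only [Polynomial.eval_sub, Polynomial.eval_mul, Polynomial.eval_C, hLe] at h1
        obtain ⟨h2, h3⟩ := hNQ _ hs
        rw [h3 k, h3 l, ← sub_div, h1, mul_div_cancel_right₀ _ h2]
      have e0 := hval 0 hz
      have e1 := hval 1 ho
      simp only [zero_smul, add_zero] at e0
      simp only [one_smul, hu, add_sub_cancel] at e1
      refine hne₁ (k, l) (by simpa using hkl) ?_
      simp only
      linear_combination e1 - e0) (fun k => L (a k)) (by
      intro s hs
      have h1 := h0 _ hs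
      obtain ⟨h2, h3⟩ := hab _ hs
      obtain ⟨h4, h5⟩ := hNQ _ hs
      simp only [h3, h5, div_mul_eq_mul_div] at h1
      rw [← Finset.sum_div, div_eq_zero_iff] at h1
      simp only [hLe]
      exact h1.resolve_right h2) k₀ (Finset.mem_univ _)
  have h1 := hLe (a k₀) 0
  rw [key] at h1
  simp only [zero_smul, add_zero, Polynomial.eval_zero] at h1
  rw [(hab _ ht₀).2 k₀, ← h1, zero_div]

/-- with `n = q + 1 ≥ 2`. If an E-function
`F(x) = ∑ k, P_k(x) exp(-i v_k · x)` of degree `d` (distinct `v_k`, each `P_k = A_k/B_k`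
homogeneous of degree `d`) vanishes on `σ(O)`, where `σ` is a rationally parameterisable
hypersurface and `O ⊆ D ∖ σ₁⁻¹(0)` is a nonempty open set satisfying the hyperplane and the
inner point conditions, and all `B_k` are nonzero on `σ(O)`, then all numerators `A_k` are
the zero polynomial. -/
theorem e_function_vanishing_on_rp_hypersurface
    (q : ℕ) (hq : 1 ≤ q)
    (D : Set (Fin q → ℝ))
    (σ : (Fin q → ℝ) → EuclideanSpace ℝ (Fin (q + 1)))
    -- each component of σ is a rational function whose denominator does not vanish on D
    (hrat : ∀ j : Fin (q + 1), ∃ A B : MvPolynomial (Fin q) ℝ,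
      ∀ t ∈ D, MvPolynomial.eval t B ≠ 0 ∧
        σ t j = MvPolynomial.eval t A / MvPolynomial.eval t B)
    (O : Set (Fin q → ℝ)) (hOopen : IsOpen O) (hOne : O.Nonempty)
    -- O ⊆ D ∖ σ₁⁻¹(0)
    (hOD : ∀ t ∈ O, t ∈ D ∧ σ t 0 ≠ 0)
    -- hyperplane condition
    (hhyp : ¬ ∃ (a : EuclideanSpace ℝ (Fin (q + 1))) (c : ℝ), a ≠ 0 ∧
      ∀ t ∈ O, ⟪a, σ t⟫ = c)
    -- inner point condition
    (hinner : ∃ t ∈ O, (fun i : Fin q => σ t i.succ / σ t 0) ∈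
      interior ((fun t' : Fin q → ℝ => fun i : Fin q => σ t' i.succ / σ t' 0) '' O))
    (d : ℤ) (m : ℕ) (hm : 1 ≤ m)
    -- distinct points v₁, …, v_m of ℝⁿ
    (v : Fin m → EuclideanSpace ℝ (Fin (q + 1))) (hv : Function.Injective v)
    -- rational functions P_k = A_k/B_k with complex coefficients
    (A B : Fin m → MvPolynomial (Fin (q + 1)) ℂ) (hBne : ∀ k, B k ≠ 0)
    -- each P_k is homogeneous of degree d
    (hhom : ∀ k : Fin m, ∀ l : ℝ, l ≠ 0 → ∀ x : Fin (q + 1) → ℝ,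
      MvPolynomial.eval (fun i => (x i : ℂ)) (B k) ≠ 0 →
      MvPolynomial.eval (fun i => ((l * x i : ℝ) : ℂ)) (B k) ≠ 0 →
      MvPolynomial.eval (fun i => ((l * x i : ℝ) : ℂ)) (A k) /
          MvPolynomial.eval (fun i => ((l * x i : ℝ) : ℂ)) (B k) =
        (l : ℂ) ^ d *
          (MvPolynomial.eval (fun i => (x i : ℂ)) (A k) /
            MvPolynomial.eval (fun i => (x i : ℂ)) (B k)))
    -- all B_k are nonzero on σ(O)
    (hB : ∀ k, ∀ t ∈ O, MvPolynomial.eval (fun j => ((σ t j : ℝ) : ℂ)) (B k) ≠ 0)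
    -- F vanishes on σ(O)
    (hzero : ∀ t ∈ O,
      ∑ k : Fin m,
        (MvPolynomial.eval (fun j => ((σ t j : ℝ) : ℂ)) (A k) /
          MvPolynomial.eval (fun j => ((σ t j : ℝ) : ℂ)) (B k)) *
        Complex.exp (-Complex.I * ((⟪v k, σ t⟫ : ℝ) : ℂ)) = 0) :
    ∀ k : Fin m, A k = 0 := by
  classical
  have hσ : ∀ j, EfxRat O (fun t => ((σ t j : ℝ) : ℂ)) := by
    intro j
    obtain ⟨a, b, hab⟩ := hrat j
    have hev : ∀ (p : MvPolynomial (Fin q) ℝ) (t : Fin q → ℝ),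
        MvPolynomial.eval (fun i => (t i : ℂ)) (MvPolynomial.map Complex.ofRealHom p)
        = ((MvPolynomial.eval t p : ℝ) : ℂ) := by
      intro p t
      rw [MvPolynomial.eval_map]
      exact (MvPolynomial.eval₂_comp_left Complex.ofRealHom (RingHom.id ℝ) t p).symm
    refine ⟨MvPolynomial.map Complex.ofRealHom a, MvPolynomial.map Complex.ofRealHom b,
      fun t ht => ?_⟩
    obtain ⟨h1, h2⟩ := hab t (hOD t ht).1
    rw [hev, hev]
    exact ⟨by exact_mod_cast h1, by simp only [h2]; push_cast; rfl⟩
  have hR := efx_multi hOopen hOne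
    (fun k t => MvPolynomial.eval (fun j => ((σ t j : ℝ) : ℂ)) (A k) /
          MvPolynomial.eval (fun j => ((σ t j : ℝ) : ℂ)) (B k))
    (fun k t => -Complex.I * ((⟪v k, σ t⟫ : ℝ) : ℂ))
    (fun k => (EfxRat.eval hσ (A k)).div (EfxRat.eval hσ (B k)) (hB k))
    (fun k => by
      refine (EfxRat.const O (-Complex.I)).mul ?_
      have : (fun t => ((⟪v k, σ t⟫ : ℝ) : ℂ)) =
          fun t => ∑ j, ((v k j : ℝ) : ℂ) * ((σ t j : ℝ) : ℂ) := by
        funext t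
        rw [PiLp.inner_apply]
        push_cast
        refine Finset.sum_congr rfl fun j _ => ?_
        simp [mul_comm]
      rw [this]
      exact EfxRat.sum _ fun j => (EfxRat.const O _).mul (hσ j))
    (fun k l hkl c => by
      by_contra hcon
      push Not at hcon
      apply hhyp
      obtain ⟨t₀, ht₀⟩ := hOne
      refine ⟨v k - v l, ⟪v k - v l, σ t₀⟫, sub_ne_zero.2 (hv.ne hkl), fun t ht => ?_⟩
      have h1 := (hcon t ht).trans (hcon t₀ ht₀).symm
      rw [← mul_sub, ← mul_sub] at h1
      have h2 := mul_left_cancel₀ (neg_ne_zero.2 Complex.I_ne_zero) h1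
      rw [inner_sub_left, inner_sub_left]
      exact_mod_cast h2)
    hzero
  intro k
  have hAσ : ∀ t ∈ O, MvPolynomial.eval (fun j => ((σ t j : ℝ) : ℂ)) (A k) = 0 := fun t ht =>
    (div_eq_zero_iff.1 (hR k t ht)).resolve_right (hB k t ht)
  -- scaling
  have hscale : ∀ t ∈ O, ∀ l : ℝ, l ≠ 0 →
      MvPolynomial.eval (fun j => ((l * σ t j : ℝ) : ℂ)) (A k) = 0 := by
    intro t ht l hl
    set S : MvPolynomial (Fin (q+1)) ℂ → MvPolynomial (Fin (q+1)) ℂ := fun p =>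
      MvPolynomial.aeval (fun i => MvPolynomial.C (l : ℂ) * MvPolynomial.X i) p with hS
    have hSe : ∀ p (x : Fin (q+1) → ℂ), MvPolynomial.eval x (S p) =
        MvPolynomial.eval (fun i => (l : ℂ) * x i) p := by
      intro p x
      simp only [hS]
      induction p using MvPolynomial.induction_on with
      | C c => simp
      | add p r hp hr => rw [map_add, map_add, map_add, hp, hr]
      | mul_X p i hp => rw [map_mul, map_mul, hp]; simp
    have hlC : (l : ℂ) ≠ 0 := by exact_mod_cast hl
    have hSB : S (B k) ≠ 0 := by
      intro h
      apply hBne k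
      refine MvPolynomial.funext fun x => ?_
      have h1 := hSe (B k) (fun i => (l : ℂ)⁻¹ * x i)
      rw [h] at h1
      simp only [mul_inv_cancel_left₀ hlC] at h1
      rw [← h1]
      simp
    have hE : S (B k) * B k * (S (A k) * B k - MvPolynomial.C ((l : ℂ) ^ d) * A k * S (B k)) = 0 := by
      refine efx_mv_zero _ Set.univ isOpen_univ Set.univ_nonempty fun x _ => ?_
      simp only [map_mul, map_sub, hSe, MvPolynomial.eval_C]
      by_cases h1 : MvPolynomial.eval (fun i => (x i : ℂ)) (B k) = 0
      · simp [h1]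
      by_cases h2 : MvPolynomial.eval (fun i => (l : ℂ) * (x i : ℂ)) (B k) = 0
      · simp [h2]
      have h3 := hhom k l hl x h1 (by simpa using h2)
      simp only [Complex.ofReal_mul] at h3
      field_simp at h3
      rw [mul_eq_zero]
      right
      linear_combination h3
    have hE' := (mul_eq_zero.1 hE).resolve_left (mul_ne_zero hSB (hBne k))
    have h1 := congrArg (MvPolynomial.eval (fun j => ((σ t j : ℝ) : ℂ))) hE'
    simp only [map_mul, map_sub, hSe, MvPolynomial.eval_C, hAσ t ht, mul_zero, zero_mul, sub_zero,
      map_zero] at h1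
    have h2 := (mul_eq_zero.1 h1).resolve_right (hB k t ht)
    simpa using h2
  obtain ⟨t₀, ht₀, hint⟩ := hinner
  set V := interior ((fun t' : Fin q → ℝ => fun i : Fin q => σ t' i.succ / σ t' 0) '' O) with hV
  let y₀ : Fin q → ℝ := fun i : Fin q => σ t₀ i.succ / σ t₀ 0
  have hWo : IsOpen ({z : Fin (q+1) → ℝ | z 0 ≠ 0} ∩
      (fun z : Fin (q+1) → ℝ => fun i : Fin q => z i.succ / z 0) ⁻¹' V) := by
    refine ContinuousOn.isOpen_inter_preimage ?_ ?_ isOpen_interior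
    · refine continuousOn_pi.2 fun i => ContinuousOn.div ?_ ?_ fun z hz => hz
      · fun_prop
      · fun_prop
    · exact isOpen_ne_fun (continuous_apply 0) continuous_const
  refine efx_mv_zero _ _ hWo ⟨Fin.cons 1 y₀, by simp, ?_⟩ ?_
  · simpa [y₀] using hint
  · rintro z ⟨hz0, hzV⟩
    obtain ⟨t, ht, hte⟩ := interior_subset hzV
    have hs0 := (hOD t ht).2
    have h1 := hscale t ht (z 0 / σ t 0) (div_ne_zero hz0 hs0)
    have h2 : ∀ j, z 0 / σ t 0 * σ t j = z j := by
      intro j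
      refine Fin.cases ?_ (fun i => ?_) j
      · field_simp
      · have h3 := congrFun hte i
        simp only at h3
        have hz0' : z 0 ≠ 0 := hz0
        field_simp at h3 ⊢
        linear_combination h3
    simpa only [h2] using h1
end

section
/- Let n ≥ 1, let A be a symmetric real n×n matrix that is not the zero matrix, let b ∈ ℝⁿ and c ∈ ℝ, and let S = {s ∈ ℝⁿ : (1/2) sᵀAs + bᵀs + c = 0}. If S contains at least two points and S contains no affine line, then the n×(n+1) matrix (A | b), obtained by appending the column b to A, has rank n. -/
open scoped Matrix

/-- If the quadric `S = {s : (1/2) sᵀAs + bᵀs + c = 0}` (with `A` symmetric,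
`A ≠ 0`) contains at least two points but no affine line, then the `n × (n+1)` matrix
`(A | b)` has rank `n`. -/
theorem quadric_no_line_rank
    (n : ℕ) (hn : 1 ≤ n)
    (A : Matrix (Fin n) (Fin n) ℝ) (hA : A.IsSymm) (hA0 : A ≠ 0)
    (b : Fin n → ℝ) (c : ℝ)
    (S : Set (Fin n → ℝ))
    (hS : S = {s : Fin n → ℝ | (1 / 2) * (s ⬝ᵥ A.mulVec s) + b ⬝ᵥ s + c = 0})
    -- S contains at least two points
    (htwo : ∃ s₁ ∈ S, ∃ s₂ ∈ S, s₁ ≠ s₂)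
    -- S contains no affine line
    (hline : ¬ ∃ (x₀ r : Fin n → ℝ), r ≠ 0 ∧ ∀ l : ℝ, x₀ + l • r ∈ S) :
    (Matrix.of fun (i : Fin n) (j : Fin (n + 1)) =>
      Fin.lastCases (motive := fun _ => ℝ) (b i) (fun j' : Fin n => A i j') j).rank = n := by
  obtain ⟨s, hs, -⟩ := htwo
  have key : ∀ r : Fin n → ℝ, A.mulVec r = 0 → b ⬝ᵥ r = 0 → r = 0 := by
    intro r h1 h2
    by_contra hr
    refine hline ⟨s, r, hr, fun l => ?_⟩
    have h3 : r ⬝ᵥ A.mulVec s = 0 := by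
      rw [Matrix.dotProduct_mulVec, ← Matrix.mulVec_transpose, hA.eq, h1, zero_dotProduct]
    rw [hS] at hs ⊢
    simp only [Set.mem_setOf_eq] at hs ⊢
    rw [Matrix.mulVec_add, Matrix.mulVec_smul, h1, dotProduct_add b, dotProduct_smul, h2,
      smul_zero, smul_zero, add_zero, add_zero, add_dotProduct, smul_dotProduct, h3, smul_zero,
      add_zero]
    exact hs
  have hli : LinearIndependent ℝ (Matrix.of fun (i : Fin n) (j : Fin (n + 1)) =>
      Fin.lastCases (motive := fun _ => ℝ) (b i) (fun j' : Fin n => A i j') j).row := by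
    rw [Fintype.linearIndependent_iff]
    intro r h
    have h0 : r = 0 := by
      apply key
      · ext j
        have := congrFun h j.castSucc
        simp [Finset.sum_apply, Matrix.row] at this
        simp only [Matrix.mulVec, dotProduct, Pi.zero_apply]
        rw [← this]
        refine Finset.sum_congr rfl fun i _ => ?_
        rw [mul_comm, hA.apply]
      · have := congrFun h (Fin.last n)
        simp [Finset.sum_apply, Matrix.row] at this
        rw [dotProduct, ← this]
        exact Finset.sum_congr rfl fun i _ => mul_comm _ _
    intro i
    simp [h0]
  simpa using hli.rank_matrix
end

section
/- Let n ≥ 2, let c ∈ ℝ ∖ {0}, let ε₂,…,ε_{n−1} ∈ {−1, 1}, and let U be a nonempty open subset of ℝ^{n−1} such that t₁ ≠ 0 for every t = (t₁,…,t_{n−1}) ∈ U. Then the set {(t₁,…,t_{n−1}, (c − ∑_{j=2}^{n−1} ε_j t_j²)/t₁) : t ∈ U} ⊆ ℝⁿ is not contained in any affine hyperplane of ℝⁿ. -/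
/-- with `n = k + 2 ≥ 2`. The graph over a nonempty open set
`U ⊆ ℝ^{n-1}` (with `t₁ ≠ 0` on `U`) of `t ↦ (c - ∑_{j=2}^{n-1} ε_j t_j²)/t₁`, `c ≠ 0`,
`ε_j = ±1`, is not contained in any affine hyperplane `{x : a·x = c'}` of `ℝⁿ`.
Indices here are zero-based: `t₁` is `t 0` and the sum runs over `j ≠ 0`. -/
theorem hyperboloid_graph_not_in_hyperplane
    (k : ℕ) (c : ℝ) (hc : c ≠ 0)
    (ε : Fin (k + 1) → ℝ) (hε : ∀ j : Fin (k + 1), j ≠ 0 → ε j = 1 ∨ ε j = -1)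
    (U : Set (Fin (k + 1) → ℝ)) (hUopen : IsOpen U) (hUne : U.Nonempty)
    (hU0 : ∀ t ∈ U, t 0 ≠ 0) :
    ¬ ∃ (a : Fin (k + 2) → ℝ) (c' : ℝ), a ≠ 0 ∧
      ∀ t ∈ U, ∑ i : Fin (k + 2),
        a i * (Fin.snoc t ((c - ∑ j ∈ Finset.univ.erase (0 : Fin (k + 1)), ε j * t j ^ 2) / t 0) :
          Fin (k + 2) → ℝ) i = c' := by
  rintro ⟨a, c', ha, H⟩
  obtain ⟨t, ht⟩ := hUne
  obtain ⟨h, hpos, hh⟩ : ∃ h : ℝ, 0 < h ∧ ∀ i s, |s| ≤ h → t + Pi.single i s ∈ U := by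
    obtain ⟨r, hr, hb⟩ := Metric.isOpen_iff.1 hUopen t ht
    refine ⟨r / 2, by positivity, fun i s hs => hb ?_⟩
    rw [Metric.mem_ball, dist_eq_norm, add_sub_cancel_left, Pi.norm_single, Real.norm_eq_abs]
    linarith
  set b := a (Fin.last (k + 1)) with hb
  have H1 : ∀ t ∈ U, (∑ i : Fin (k + 1), a i.castSucc * t i - c') * t 0
      + b * (c - ∑ j ∈ Finset.univ.erase (0 : Fin (k + 1)), ε j * t j ^ 2) = 0 := by
    intro t ht
    have h0 := hU0 t ht
    have := H t ht
    rw [Fin.sum_univ_castSucc] at this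
    simp only [Fin.snoc_castSucc, Fin.snoc_last] at this
    rw [← this, ← hb]
    field_simp
    ring
  have hlin : ∀ (i : Fin (k + 1)) (s : ℝ), ∑ l : Fin (k + 1), a l.castSucc * (t + Pi.single i s : Fin (k + 1) → ℝ) l
      = ∑ l : Fin (k + 1), a l.castSucc * t l + a i.castSucc * s := by
    intro i s
    simp [mul_add, Finset.sum_add_distrib, Pi.single_apply]
  have e0 := H1 t ht
  have t0 := hU0 t ht
  have hp : |h| ≤ h := (abs_of_pos hpos).le
  have hm : |-h| ≤ h := by rw [abs_neg]; exact hp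
  have hb0 : b = 0 := by
    rcases k with _ | k
    · have e1 := H1 _ (hh 0 h hp)
      have e2 := H1 _ (hh 0 (-h) hm)
      have hE : (Finset.univ.erase (0 : Fin (0 + 1))) = ∅ := by decide
      rw [hlin] at e1 e2
      rw [hE] at e0 e1 e2
      simp at e0 e1 e2
      have q : a 0 * h ^ 2 = 0 := by linear_combination (e1 + e2 - 2 * e0) / 2
      have a0 : a 0 = 0 := by simpa [hpos.ne'] using q
      rw [a0] at e0 e1
      have q2 : c' * h = 0 := by linear_combination e0 - e1
      have c0 : c' = 0 := by simpa [hpos.ne'] using q2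
      rw [c0] at e0
      simpa [hc] using e0
    · have h10 : (1 : Fin (k + 1 + 1)) ≠ 0 := by simp
      have hq : ∀ s : ℝ, ∑ j ∈ Finset.univ.erase (0 : Fin (k + 1 + 1)),
          ε j * (t + Pi.single 1 s : Fin (k + 1 + 1) → ℝ) j ^ 2
          = ∑ j ∈ Finset.univ.erase (0 : Fin (k + 1 + 1)), ε j * t j ^ 2
            + ε 1 * (2 * t 1 * s + s ^ 2) := by
        intro s
        rw [← sub_eq_iff_eq_add', ← Finset.sum_sub_distrib, Finset.sum_eq_single 1]
        · simp; ring
        · intro j _ hj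
          simp [hj]
        · simp
      have e1 := H1 _ (hh 1 h hp)
      have e2 := H1 _ (hh 1 (-h) hm)
      rw [hlin, hq] at e1 e2
      have z : ∀ s : ℝ, (t + Pi.single 1 s : Fin (k + 1 + 1) → ℝ) 0 = t 0 := by
        intro s; simp
      rw [z] at e1 e2
      have q : b * ε 1 * h ^ 2 = 0 := by linear_combination -(e1 + e2 - 2 * e0) / 2
      have hε1 : ε 1 ≠ 0 := by rcases hε 1 h10 with h | h <;> rw [h] <;> norm_num
      simpa [hpos.ne', hε1] using q
  apply ha
  funext i
  refine Fin.lastCases ?_ (fun i => ?_) i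
  · exact hb0
  · have e1 := H1 _ (hh i h hp)
    have n1 := hU0 _ (hh i h hp)
    rw [hlin] at e1
    rw [hb0, zero_mul, add_zero] at e0 e1
    have f0 := (mul_eq_zero.1 e0).resolve_right t0
    have f1 := (mul_eq_zero.1 e1).resolve_right n1
    have q : a i.castSucc * h = 0 := by linear_combination f1 - f0
    simpa [hpos.ne'] using q
end

section
/- Let n ≥ 2, let 𝒫₁ and 𝒫₂ be generalized n-dimensional polytopes in ℝⁿ, let s₀ ∈ ℝⁿ and r > 0. If F_{𝒫₁}(s) = F_{𝒫₂}(s) for every s ∈ ℝⁿ with ‖s − s₀‖ = r, then 𝒫₁ = 𝒫₂. -/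
open scoped RealInnerProductSpace

/-- The Fourier transform of (the characteristic function of) a set `P ⊆ ℝⁿ`. -/
noncomputable def fourierTransformSet {n : ℕ} (P : Set (EuclideanSpace ℝ (Fin n)))
    (s : EuclideanSpace ℝ (Fin n)) : ℂ :=
  ∫ x in P, Complex.exp (-Complex.I * ((⟪s, x⟫ : ℝ) : ℂ))

/-- A convex `n`-dimensional polytope in `ℝⁿ`. -/
def IsConvexPolytope {n : ℕ} (P : Set (EuclideanSpace ℝ (Fin n))) : Prop :=
  ∃ V : Finset (EuclideanSpace ℝ (Fin n)),
    P = convexHull ℝ (V : Set (EuclideanSpace ℝ (Fin n))) ∧ (interior P).Nonempty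

/-- A generalized `n`-dimensional polytope in `ℝⁿ`. -/
def IsGenPolytope {n : ℕ} (P : Set (EuclideanSpace ℝ (Fin n))) : Prop :=
  ∃ (m : ℕ) (Q : Fin (m + 1) → Set (EuclideanSpace ℝ (Fin n))),
    (∀ i, IsConvexPolytope (Q i)) ∧ P = ⋃ i, Q i


open MeasureTheory Filter Topology

lemma conic_hull {n : ℕ} (V : Finset (EuclideanSpace ℝ (Fin n))) (v : EuclideanSpace ℝ (Fin n)) :
    ∃ δ > 0, ∀ y : EuclideanSpace ℝ (Fin n), ‖y‖ < δ → ∀ t : ℝ, 0 < t → t ≤ 1 →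
      (v + y ∈ convexHull ℝ (V : Set (EuclideanSpace ℝ (Fin n))) ↔
        v + t • y ∈ convexHull ℝ (V : Set (EuclideanSpace ℝ (Fin n)))) := by
  have h1 : ∀ᶠ x in 𝓝 v, ∀ S ∈ V.powerset,
      v ∉ convexHull ℝ (S : Set (EuclideanSpace ℝ (Fin n))) →
      x ∉ convexHull ℝ (S : Set (EuclideanSpace ℝ (Fin n))) := by
    rw [Filter.eventually_all_finset]
    intro S _
    by_cases hv : v ∈ convexHull ℝ (S : Set (EuclideanSpace ℝ (Fin n)))
    · exact Eventually.of_forall fun x h => absurd hv h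
    · have hc : IsClosed (convexHull ℝ (S : Set (EuclideanSpace ℝ (Fin n)))) :=
        (S.finite_toSet.isCompact_convexHull (𝕜 := ℝ)).isClosed
      filter_upwards [hc.isOpen_compl.mem_nhds hv] with x hx _
      exact hx
  obtain ⟨δ, hδ, hball⟩ := Metric.eventually_nhds_iff.1 h1
  refine ⟨δ, hδ, fun y hy t ht ht1 => ?_⟩
  have hin : ∀ τ : ℝ, 0 < τ → τ ≤ 1 → dist (v + τ • y) v < δ := by
    intro τ h0 h1
    rw [dist_eq_norm, add_sub_cancel_left, norm_smul, Real.norm_of_nonneg h0.le]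
    nlinarith [norm_nonneg y]
  by_cases hv : v ∈ convexHull ℝ (V : Set (EuclideanSpace ℝ (Fin n)))
  swap
  · have ha := hball (hin t ht ht1) V (Finset.mem_powerset_self V) hv
    have hb := hball (hin 1 one_pos le_rfl) V (Finset.mem_powerset_self V) hv
    rw [one_smul] at hb
    exact ⟨fun h => absurd h hb, fun h => absurd h ha⟩
  have hconv : Convex ℝ (convexHull ℝ (V : Set (EuclideanSpace ℝ (Fin n)))) := convex_convexHull ℝ _
  constructor
  · intro h
    have := hconv.add_smul_mem hv h ⟨ht.le, ht1⟩
    exact this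
  · intro h
    have hcl : IsClosed (convexHull ℝ (V : Set (EuclideanSpace ℝ (Fin n)))) :=
      (V.finite_toSet.isCompact_convexHull (𝕜 := ℝ)).isClosed
    have hT : IsCompact (Set.Icc t 1 ∩
        (fun τ : ℝ => v + τ • y) ⁻¹' convexHull ℝ (V : Set (EuclideanSpace ℝ (Fin n)))) :=
      isCompact_Icc.inter_right (hcl.preimage (by fun_prop))
    obtain ⟨τ, ⟨⟨hτ1, hτ2⟩, hτm⟩, hmax⟩ := hT.exists_isMaxOn ⟨t, ⟨le_rfl, ht1⟩, h⟩ continuousOn_id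
    rcases hτ2.eq_or_lt with rfl | hlt
    · simpa using hτm
    exfalso
    have hτ0 : 0 < τ := ht.trans_le hτ1
    obtain ⟨w, hw0, hw1, hwx⟩ := Finset.mem_convexHull'.1 hτm
    set S := V.filter (fun i => w i ≠ 0) with hS
    have hSV : S ⊆ V := Finset.filter_subset _ _
    have hsum : ∑ i ∈ S, w i = 1 := by rw [← hw1, hS, Finset.sum_filter_ne_zero]
    have hsumx : ∑ i ∈ S, w i • i = v + τ • y := by
      refine Eq.trans ?_ hwx
      rw [hS]
      apply Finset.sum_filter_of_ne
      intro i _ hi h0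
      exact hi (by rw [h0, zero_smul])
    have hxS : v + τ • y ∈ convexHull ℝ (S : Set (EuclideanSpace ℝ (Fin n))) :=
      Finset.mem_convexHull'.2 ⟨w, fun i hi => hw0 i (hSV hi), hsum, hsumx⟩
    have hvS : v ∈ convexHull ℝ (S : Set (EuclideanSpace ℝ (Fin n))) := by
      by_contra hcon
      exact hball (hin τ hτ0 hτ2) S (Finset.mem_powerset.2 hSV) hcon hxS
    obtain ⟨u, hu0, hu1, hux⟩ := Finset.mem_convexHull'.1 hvS
    have hev1 : ∀ᶠ η in 𝓝[>] (0 : ℝ), ∀ i ∈ S, 0 < (1 + η) * w i - η * u i := by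
      rw [Filter.eventually_all_finset]
      intro i hi
      have hwi : 0 < w i := lt_of_le_of_ne (hw0 i (hSV hi)) (Finset.mem_filter.1 hi).2.symm
      have : ContinuousAt (fun η : ℝ => (1 + η) * w i - η * u i) 0 := by fun_prop
      exact (this.eventually (lt_mem_nhds (by simpa using hwi))).filter_mono nhdsWithin_le_nhds
    have hev2 : ∀ᶠ η in 𝓝[>] (0 : ℝ), (1 + η) * τ < 1 := by
      have : ContinuousAt (fun η : ℝ => (1 + η) * τ) 0 := by fun_prop
      exact (this.eventually (gt_mem_nhds (by simpa using hlt))).filter_mono nhdsWithin_le_nhds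
    obtain ⟨η, ⟨h1, h2⟩, h3⟩ := ((hev1.and hev2).and self_mem_nhdsWithin).exists
    have h3 : 0 < η := h3
    have hmem : v + ((1 + η) * τ) • y ∈ convexHull ℝ (S : Set (EuclideanSpace ℝ (Fin n))) := by
      refine Finset.mem_convexHull'.2 ⟨fun i => (1 + η) * w i - η * u i, fun i hi => (h1 i hi).le, ?_, ?_⟩
      · rw [Finset.sum_sub_distrib, ← Finset.mul_sum, ← Finset.mul_sum, hsum, hu1]; ring
      · simp only [sub_smul, mul_smul]
        rw [Finset.sum_sub_distrib, ← Finset.smul_sum, ← Finset.smul_sum, hsumx, hux]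
        module
    have hmem' := convexHull_mono (Finset.coe_subset.2 hSV) hmem
    have hgt : τ < (1 + η) * τ := by nlinarith
    have := hmax (show (1 + η) * τ ∈ _ from ⟨⟨hτ1.trans hgt.le, h2.le⟩, hmem'⟩)
    exact absurd this (not_le.2 hgt)

lemma conic_gen {n : ℕ} {P : Set (EuclideanSpace ℝ (Fin n))} (hP : IsGenPolytope P)
    (v : EuclideanSpace ℝ (Fin n)) :
    ∃ δ > 0, ∀ y : EuclideanSpace ℝ (Fin n), ‖y‖ < δ → ∀ t : ℝ, 0 < t → t ≤ 1 →
      (v + y ∈ P ↔ v + t • y ∈ P) := by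
  obtain ⟨m, Q, hQ, rfl⟩ := hP
  choose V hV hint using hQ
  choose δ hδ h using fun i => conic_hull (V i) v
  obtain ⟨i0, -, hi0⟩ := Finset.exists_min_image Finset.univ δ ⟨0, Finset.mem_univ _⟩
  refine ⟨δ i0, hδ i0, fun y hy t ht ht1 => ?_⟩
  simp only [Set.mem_iUnion]
  refine exists_congr fun i => ?_
  rw [hV i]
  exact h i y (hy.trans_le (hi0 i (Finset.mem_univ _))) t ht ht1

lemma compact_gen {n : ℕ} {P : Set (EuclideanSpace ℝ (Fin n))} (hP : IsGenPolytope P) :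
    IsCompact P := by
  obtain ⟨m, Q, hQ, rfl⟩ := hP
  refine isCompact_iUnion fun i => ?_
  obtain ⟨V, hV, -⟩ := hQ i
  rw [hV]
  exact V.finite_toSet.isCompact_convexHull (𝕜 := ℝ)

lemma closint_gen {n : ℕ} {P : Set (EuclideanSpace ℝ (Fin n))} (hP : IsGenPolytope P) :
    P ⊆ closure (interior P) := by
  obtain ⟨m, Q, hQ, rfl⟩ := hP
  refine Set.iUnion_subset fun i => ?_
  obtain ⟨V, hV, hne⟩ := hQ i
  have hc : Convex ℝ (Q i) := by rw [hV]; exact convex_convexHull ℝ _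
  calc Q i ⊆ closure (Q i) := subset_closure
    _ = closure (interior (Q i)) := (hc.closure_interior_eq_closure_of_nonempty_interior hne).symm
    _ ⊆ _ := closure_mono (interior_mono (Set.subset_iUnion Q i))

lemma key_one_dim (k : ℂ → ℂ) (hk : AnalyticAt ℂ k 1) (p q R A c : ℝ) (N : ℕ) (hR : 0 < R)
    (hc : 0 < c)
    (hb : ∀ᶠ ζ in 𝓝 (1 : ℂ), ∀ l : ℝ, 1 ≤ l →
      ((l : ℂ) * ζ - p) ^ 2 + (Complex.I * l - q) ^ 2 = (R : ℂ) ^ 2 →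
      ‖k ζ‖ ≤ A * l ^ N * Real.exp (-c * l)) :
    ∀ᶠ ζ in 𝓝 (1 : ℂ), k ζ = 0 := by
  by_contra hcon
  obtain ⟨m, g, hg, hg1, hkg⟩ := hk.exists_eventuallyEq_pow_smul_nonzero_iff.2 hcon
  have hlow : ∀ᶠ ζ in 𝓝 (1 : ℂ), ‖g 1‖ / 2 < ‖g ζ‖ := by
    have h1 : ContinuousAt (fun ζ => ‖g ζ‖) 1 := hg.continuousAt.norm
    exact h1.eventually (lt_mem_nhds (half_lt_self (norm_pos_iff.2 hg1)))
  set W : ℝ → ℂ := fun l => 1 + 2 * Complex.I * q * ((l⁻¹ : ℝ) : ℂ) + (R ^ 2 - q ^ 2) * ((l⁻¹ : ℝ) : ℂ) ^ 2 with hW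
  set Z : ℝ → ℂ := fun l => p * ((l⁻¹ : ℝ) : ℂ) + (W l) ^ (((2 : ℕ) : ℂ)⁻¹) with hZ
  have hinv : Tendsto (fun l : ℝ => ((l⁻¹ : ℝ) : ℂ)) atTop (𝓝 0) := by
    have := (Complex.continuous_ofReal.tendsto 0).comp tendsto_inv_atTop_zero
    simpa [Function.comp_def] using this
  have hWt : Tendsto W atTop (𝓝 1) := by
    have h1 : ContinuousAt (fun d : ℂ => 1 + 2 * Complex.I * q * d + (R ^ 2 - q ^ 2) * d ^ 2) 0 := by
      fun_prop
    have := h1.tendsto.comp hinv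
    simpa [Function.comp_def, hW] using this
  have hZt : Tendsto Z atTop (𝓝 1) := by
    have h1 : ContinuousAt (fun w : ℂ => w ^ (((2 : ℕ) : ℂ)⁻¹)) 1 :=
      continuousAt_cpow_const (by simp)
    have h2 := h1.tendsto.comp hWt
    have h3 := (hinv.const_mul (p : ℂ)).add h2
    simpa [hZ] using h3
  have hZeq : ∀ l : ℝ, 1 ≤ l → ((l : ℂ) * Z l - p) ^ 2 + (Complex.I * l - q) ^ 2 = (R : ℂ) ^ 2 := by
    intro l hl
    have hl0 : (l : ℂ) ≠ 0 := by
      have : l ≠ 0 := by linarith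
      exact_mod_cast this
    have hs : ((W l) ^ (((2 : ℕ) : ℂ)⁻¹)) ^ 2 = W l := Complex.cpow_nat_inv_pow _ two_ne_zero
    have h1 : (l : ℂ) * Z l - p = l * (W l) ^ (((2 : ℕ) : ℂ)⁻¹) := by
      simp only [hZ]; push_cast; field_simp; ring
    rw [h1, mul_pow, hs]
    simp only [hW]; push_cast; field_simp
    ring_nf
    simp only [Complex.I_sq]; ring
  -- lower bound
  have hlb : ∃ c1 > 0, ∀ᶠ l : ℝ in atTop, c1 ≤ ‖2 * ((p : ℂ) + Complex.I * q) * l + (R ^ 2 - p ^ 2 - q ^ 2)‖ := by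
    by_cases hpq : (p : ℂ) + Complex.I * q = 0
    · have hp : p = 0 := by simpa using congrArg Complex.re hpq
      have hq : q = 0 := by simpa using congrArg Complex.im hpq
      refine ⟨R ^ 2, by positivity, Eventually.of_forall fun l => ?_⟩
      simp [hp, hq]
    · refine ⟨1, one_pos, ?_⟩
      have hd : 0 < ‖2 * ((p : ℂ) + Complex.I * q)‖ := norm_pos_iff.2 (mul_ne_zero two_ne_zero hpq)
      set d := ‖2 * ((p : ℂ) + Complex.I * q)‖
      set M := ‖(R ^ 2 - p ^ 2 - q ^ 2 : ℂ)‖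
      filter_upwards [eventually_ge_atTop ((1 + M) / d), eventually_ge_atTop 0] with l hl hl0
      have h1 : ‖2 * ((p : ℂ) + Complex.I * q) * l‖ = d * l := by
        rw [norm_mul, Complex.norm_real, Real.norm_of_nonneg hl0]
      have h2 := norm_sub_le (2 * ((p : ℂ) + Complex.I * q) * l + (R ^ 2 - p ^ 2 - q ^ 2)) (R ^ 2 - p ^ 2 - q ^ 2 : ℂ)
      rw [add_sub_cancel_right, h1] at h2
      rw [div_le_iff₀ hd] at hl
      change _ ≤ _ + M at h2
      linarith
  obtain ⟨c1, hc1, hlb⟩ := hlb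
  have h3 : ∀ᶠ l : ℝ in atTop, ‖Z l + 1 - 2 * p * ((l⁻¹ : ℝ) : ℂ)‖ < 3 := by
    have : Tendsto (fun l : ℝ => ‖Z l + 1 - 2 * p * ((l⁻¹ : ℝ) : ℂ)‖) atTop (𝓝 ‖(1 : ℂ) + 1 - 2 * p * 0‖) :=
      ((hZt.add_const 1).sub (hinv.const_mul _)).norm
    refine this.eventually (gt_mem_nhds ?_)
    norm_num
  have hZlb : ∀ᶠ l : ℝ in atTop, c1 / (3 * l ^ 2) ≤ ‖Z l - 1‖ := by
    filter_upwards [hlb, h3, eventually_ge_atTop 1] with l h1 h2 hl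
    have hl0 : (l : ℂ) ≠ 0 := by
      have : l ≠ 0 := by linarith
      exact_mod_cast this
    have he : (Z l - 1) * (Z l + 1 - 2 * p * ((l⁻¹ : ℝ) : ℂ)) * l ^ 2
        = 2 * ((p : ℂ) + Complex.I * q) * l + (R ^ 2 - p ^ 2 - q ^ 2) := by
      have := hZeq l hl
      push_cast; field_simp
      linear_combination this + (- l ^ 2 : ℂ) * Complex.I_sq
    rw [← he, norm_mul, norm_mul, norm_pow, Complex.norm_real, Real.norm_of_nonneg (by linarith)] at h1
    rw [div_le_iff₀ (by positivity)]
    have : ‖Z l - 1‖ * ‖Z l + 1 - 2 * p * ((l⁻¹ : ℝ) : ℂ)‖ * l ^ 2 ≤ ‖Z l - 1‖ * 3 * l ^ 2 := by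
      gcongr
    linarith
  have hmain : ∀ᶠ l : ℝ in atTop, (c1 / 3) ^ m * (‖g 1‖ / 2) ≤ A * (l ^ (N + 2 * m) * Real.exp (-c * l)) := by
    filter_upwards [hZlb, hZt.eventually hb, hZt.eventually hkg, hZt.eventually hlow, eventually_ge_atTop 1]
      with l h1 h2 h3 h4 hl
    have h5 := h2 l hl (hZeq l hl)
    rw [h3, norm_smul, norm_pow] at h5
    have h6 : (c1 / (3 * l ^ 2)) ^ m * (‖g 1‖ / 2) ≤ A * l ^ N * Real.exp (-c * l) := by
      refine le_trans ?_ h5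
      gcongr
    have h7 : (c1 / 3) ^ m * (‖g 1‖ / 2) = (c1 / (3 * l ^ 2)) ^ m * (‖g 1‖ / 2) * l ^ (2 * m) := by
      have hl0 : l ≠ 0 := by linarith
      rw [pow_mul, ← mul_right_comm, ← mul_pow]
      congr 2
      field_simp
    rw [h7]
    calc _ ≤ A * l ^ N * Real.exp (-c * l) * l ^ (2 * m) := by gcongr
      _ = _ := by ring
  have hlim : Tendsto (fun l : ℝ => A * (l ^ (N + 2 * m) * Real.exp (-c * l))) atTop (𝓝 (A * 0)) := by
    refine Tendsto.const_mul A ?_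
    have := tendsto_rpow_mul_exp_neg_mul_atTop_nhds_zero ((N + 2 * m : ℕ) : ℝ) c hc
    simpa only [Real.rpow_natCast] using this
  have := ge_of_tendsto hlim hmain
  have hpos : 0 < (c1 / 3) ^ m * (‖g 1‖ / 2) := by
    have := norm_pos_iff.2 hg1
    positivity
  linarith

lemma diff_param {n : ℕ} {K : Set (EuclideanSpace ℝ (Fin n))} (hK : IsCompact K)
    (φ φ' : ℂ → EuclideanSpace ℝ (Fin n) → ℂ) (hφ : Continuous (Function.uncurry φ))
    (hφ' : Continuous (Function.uncurry φ'))
    (h : ∀ θ y, HasDerivAt (fun θ => φ θ y) (φ' θ y) θ) :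
    Differentiable ℂ (fun θ => ∫ y in K, φ θ y) := by
  intro θ₀
  obtain ⟨B, hB⟩ := ((isCompact_closedBall θ₀ 1).prod hK).exists_bound_of_continuousOn hφ'.continuousOn
  have hcφ : ∀ θ, Continuous (φ θ) := fun θ => hφ.comp (Continuous.prodMk_right θ)
  have hcφ' : ∀ θ, Continuous (φ' θ) := fun θ => hφ'.comp (Continuous.prodMk_right θ)
  have : IsFiniteMeasure (volume.restrict K) := ⟨by simpa using hK.measure_lt_top⟩
  refine (hasDerivAt_integral_of_dominated_loc_of_deriv_le (μ := volume.restrict K)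
    (F := φ) (F' := φ') (bound := fun _ => B) (Metric.closedBall_mem_nhds θ₀ one_pos)
    ?_ ?_ ?_ ?_ ?_ ?_).2.differentiableAt
  · exact Eventually.of_forall fun θ => (hcφ θ).aestronglyMeasurable
  · exact (hcφ θ₀).continuousOn.integrableOn_compact hK
  · exact (hcφ' θ₀).aestronglyMeasurable
  · refine (ae_restrict_iff' hK.measurableSet).2 (Eventually.of_forall fun y hy θ hθ => ?_)
    exact hB (θ, y) ⟨hθ, hy⟩
  · exact integrable_const B
  · exact Eventually.of_forall fun y θ _ => h θ y

lemma complex_circle {n : ℕ} {P₁ P₂ : Set (EuclideanSpace ℝ (Fin n))}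
    (hP₁ : IsCompact P₁) (hP₂ : IsCompact P₂)
    (s₀ : EuclideanSpace ℝ (Fin n)) (r : ℝ) (hr : 0 < r)
    (heq : ∀ s : EuclideanSpace ℝ (Fin n), ‖s - s₀‖ = r →
      fourierTransformSet P₁ s = fourierTransformSet P₂ s)
    (a b : EuclideanSpace ℝ (Fin n)) (hab : ⟪a, b⟫ = 0) (hnorm : ‖a‖ = ‖b‖) (hb : b ≠ 0)
    (p q : ℝ) (hs₀ : s₀ = p • a + q • b) (X Y : ℂ)
    (hXY : (X - p) ^ 2 + (Y - q) ^ 2 = ((r / ‖b‖ : ℝ) : ℂ) ^ 2) :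
    ∫ y in P₁, Complex.exp (-Complex.I * (X * (⟪a, y⟫ : ℝ) + Y * (⟪b, y⟫ : ℝ))) =
    ∫ y in P₂, Complex.exp (-Complex.I * (X * (⟪a, y⟫ : ℝ) + Y * (⟪b, y⟫ : ℝ))) := by
  have hb0 : 0 < ‖b‖ := norm_pos_iff.2 hb
  set R : ℝ := r / ‖b‖ with hR
  have hR0 : 0 < R := by positivity
  set φ : ℂ → EuclideanSpace ℝ (Fin n) → ℂ := fun θ y =>
    Complex.exp (-Complex.I * ((p + R * Complex.cos θ) * (⟪a, y⟫ : ℝ) + (q + R * Complex.sin θ) * (⟪b, y⟫ : ℝ))) with hφ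
  set φ' : ℂ → EuclideanSpace ℝ (Fin n) → ℂ := fun θ y =>
    φ θ y * (-Complex.I * ((R * -Complex.sin θ) * (⟪a, y⟫ : ℝ) + (R * Complex.cos θ) * (⟪b, y⟫ : ℝ))) with hφ'
  have hc : Continuous (Function.uncurry φ) := by
    simp only [hφ, Function.uncurry_def]; fun_prop
  have hc' : Continuous (Function.uncurry φ') := by
    have : Function.uncurry φ' = fun x => Function.uncurry φ x * (-Complex.I * ((R * -Complex.sin x.1) * (⟪a, x.2⟫ : ℝ) + (R * Complex.cos x.1) * (⟪b, x.2⟫ : ℝ))) := by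
      ext x; rfl
    rw [this]; fun_prop
  have hd : ∀ θ y, HasDerivAt (fun θ => φ θ y) (φ' θ y) θ := by
    intro θ y
    simp only [hφ', hφ]
    refine HasDerivAt.cexp ?_
    refine HasDerivAt.const_mul _ (HasDerivAt.add ?_ ?_)
    · exact (((Complex.hasDerivAt_cos θ).const_mul (R : ℂ)).const_add (p : ℂ)).mul_const _
    · exact (((Complex.hasDerivAt_sin θ).const_mul (R : ℂ)).const_add (q : ℂ)).mul_const _
  have hdiff : Differentiable ℂ (fun θ => (∫ y in P₁, φ θ y) - ∫ y in P₂, φ θ y) :=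
    (diff_param hP₁ φ φ' hc hc' hd).sub (diff_param hP₂ φ φ' hc hc' hd)
  have hreal : ∀ t : ℝ, (∫ y in P₁, φ t y) - ∫ y in P₂, φ t y = 0 := by
    intro t
    rw [sub_eq_zero]
    have hn : ‖(s₀ + (R * Real.cos t) • a + (R * Real.sin t) • b) - s₀‖ = r := by
      rw [add_assoc, add_sub_cancel_left]
      have h2 : ‖(R * Real.cos t) • a + (R * Real.sin t) • b‖ ^ 2 = r ^ 2 := by
        rw [norm_add_sq_real, norm_smul, norm_smul, inner_smul_left, inner_smul_right, hab, hnorm,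
          mul_pow, mul_pow, Real.norm_eq_abs, Real.norm_eq_abs, sq_abs, sq_abs]
        have : R * ‖b‖ = r := by rw [hR]; field_simp
        rw [← this]
        linear_combination (R ^ 2 * ‖b‖ ^ 2) * Real.cos_sq_add_sin_sq t
      exact (pow_left_inj₀ (norm_nonneg _) hr.le two_ne_zero).1 h2
    have := heq _ hn
    unfold fourierTransformSet at this
    have hφe : ∀ y, φ t y = Complex.exp (-Complex.I *
        ((⟪s₀ + (R * Real.cos t) • a + (R * Real.sin t) • b, y⟫ : ℝ) : ℂ)) := by
      intro y
      simp only [hφ]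
      congr 2
      rw [hs₀]
      simp only [inner_add_left, inner_smul_left, conj_trivial]
      push_cast
      ring
    simp only [hφe]
    exact this
  have hzero : ∀ θ, (∫ y in P₁, φ θ y) - ∫ y in P₂, φ θ y = 0 := by
    have han : AnalyticOnNhd ℂ (fun θ => (∫ y in P₁, φ θ y) - ∫ y in P₂, φ θ y) Set.univ :=
      hdiff.differentiableOn.analyticOnNhd isOpen_univ
    intro θ
    refine han.eqOn_zero_of_preconnected_of_frequently_eq_zero isPreconnected_univ (Set.mem_univ (0 : ℂ)) ?_ (Set.mem_univ θ)
    have hfr : ∃ᶠ x : ℝ in 𝓝[≠] 0, (fun θ : ℂ => (∫ y in P₁, φ θ y) - ∫ y in P₂, φ θ y) x = 0 :=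
      Frequently.of_forall hreal
    have ht : Tendsto (fun x : ℝ => (x : ℂ)) (𝓝[≠] 0) (𝓝[≠] 0) := by
      refine tendsto_nhdsWithin_iff.2 ⟨?_, ?_⟩
      · have := (Complex.continuous_ofReal.tendsto 0).mono_left (nhdsWithin_le_nhds (s := {0}ᶜ))
        simpa using this
      · filter_upwards [self_mem_nhdsWithin] with x hx
        simpa using hx
    exact ht.frequently hfr
  -- choose θ
  have hRc : (R : ℂ) ≠ 0 := by exact_mod_cast hR0.ne'
  obtain ⟨θ, hθ⟩ : ∃ θ, X - p = R * Complex.cos θ ∧ Y - q = R * Complex.sin θ := by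
    obtain ⟨θ, hθ⟩ := Complex.cos_surjective ((X - p) / R)
    have h1 : X - p = R * Complex.cos θ := by rw [hθ]; field_simp
    have h2 : (Y - q) ^ 2 = (R * Complex.sin θ) ^ 2 := by
      rw [h1] at hXY
      linear_combination hXY - (R : ℂ) ^ 2 * Complex.sin_sq_add_cos_sq θ
    rcases sq_eq_sq_iff_eq_or_eq_neg.1 h2 with h | h
    · exact ⟨θ, h1, h⟩
    · exact ⟨-θ, by rw [Complex.cos_neg, h1], by rw [Complex.sin_neg, h]; ring⟩
  have := sub_eq_zero.1 (hzero θ)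
  simp only [hφ, ← hθ.1, ← hθ.2] at this
  simpa using this

lemma integrable_exp_neg_norm' {n : ℕ} {c : ℝ} (hc : 0 < c) :
    Integrable (fun y : EuclideanSpace ℝ (Fin n) => Real.exp (-c * ‖y‖)) := by
  have h0 : Integrable (fun y : EuclideanSpace ℝ (Fin n) => (1 + ‖y‖) ^ (-((n + 1 : ℕ) : ℝ))) :=
    integrable_one_add_norm (by simp)
  have h1 := h0.const_mul (Real.exp c * (n + 1).factorial / c ^ (n + 1))
  refine h1.mono' (by fun_prop) (Eventually.of_forall fun y => ?_)
  have hy : 0 < 1 + ‖y‖ := by positivity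
  rw [Real.norm_of_nonneg (Real.exp_pos _).le, Real.rpow_neg hy.le, Real.rpow_natCast]
  have h2 := Real.pow_div_factorial_le_exp (c * (1 + ‖y‖)) (by positivity) (n + 1)
  have h3 : Real.exp (-c * ‖y‖) = Real.exp c / Real.exp (c * (1 + ‖y‖)) := by
    rw [← Real.exp_sub]; congr 1; ring
  rw [h3, div_le_iff₀ (Real.exp_pos _)]
  have h4 : Real.exp c * (n + 1).factorial / c ^ (n + 1) * ((1 + ‖y‖) ^ (n + 1))⁻¹ *
      ((c * (1 + ‖y‖)) ^ (n + 1) / (n + 1).factorial) = Real.exp c := by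
    rw [mul_pow]; field_simp
  calc Real.exp c = _ := h4.symm
    _ ≤ _ := by gcongr

lemma cone_integrable {n : ℕ} {F : Type*} [NormedAddCommGroup F]
    {C : Set (EuclideanSpace ℝ (Fin n))} (hC : MeasurableSet C) {c : ℝ}
    (hc : 0 < c) (g : EuclideanSpace ℝ (Fin n) → F) (hg : Continuous g)
    (hb : ∀ y ∈ C, ‖g y‖ ≤ Real.exp (-c * ‖y‖)) : IntegrableOn g C :=
  (integrable_exp_neg_norm' hc).integrableOn.mono' hg.aestronglyMeasurable
    ((ae_restrict_iff' hC).2 (Eventually.of_forall hb))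

noncomputable def nuM {n : ℕ} (C : Set (EuclideanSpace ℝ (Fin n))) (b : EuclideanSpace ℝ (Fin n)) :
    Measure (EuclideanSpace ℝ (Fin n)) :=
  (volume.restrict C).withDensity (fun y => ENNReal.ofReal (Real.exp ⟪b, y⟫))

lemma nuM_integral {n : ℕ} (C : Set (EuclideanSpace ℝ (Fin n))) (b : EuclideanSpace ℝ (Fin n))
    (f : EuclideanSpace ℝ (Fin n) → ℂ) :
    ∫ y, f y ∂(nuM C b) = ∫ y in C, Complex.exp ((⟪b, y⟫ : ℝ) : ℂ) * f y := by
  unfold nuM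
  rw [integral_withDensity_eq_integral_toReal_smul (by fun_prop)
    (Eventually.of_forall fun y => ENNReal.ofReal_lt_top)]
  congr 1
  ext y
  rw [ENNReal.toReal_ofReal (Real.exp_pos _).le, Complex.real_smul, Complex.ofReal_exp]

lemma nuM_integrable {n : ℕ} {C : Set (EuclideanSpace ℝ (Fin n))} (hC : MeasurableSet C)
    {b a : EuclideanSpace ℝ (Fin n)} {c : ℝ} (hb : ∀ y ∈ C, ⟪b, y⟫ ≤ -c * ‖y‖)
    {t : ℝ} (ht : |t| * ‖a‖ < c) :
    Integrable (fun y => Real.exp (t * ⟪a, y⟫)) (nuM C b) := by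
  unfold nuM
  rw [integrable_withDensity_iff (by fun_prop) (Eventually.of_forall fun y => ENNReal.ofReal_lt_top)]
  refine cone_integrable hC (c := c - |t| * ‖a‖) (by linarith) _ ?_ ?_
  · simp only [ENNReal.toReal_ofReal (Real.exp_pos _).le]
    fun_prop
  · intro y hy
    rw [ENNReal.toReal_ofReal (Real.exp_pos _).le, ← Real.exp_add, Real.norm_of_nonneg (Real.exp_pos _).le]
    apply Real.exp_le_exp.2
    have h1 : t * ⟪a, y⟫ ≤ |t| * (‖a‖ * ‖y‖) := by
      refine (le_abs_self _).trans ?_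
      rw [abs_mul]
      gcongr
      exact abs_real_inner_le_norm a y
    have := hb y hy
    nlinarith

lemma nuM_finite {n : ℕ} {C : Set (EuclideanSpace ℝ (Fin n))} (hC : MeasurableSet C)
    {b : EuclideanSpace ℝ (Fin n)} {c : ℝ} (hc : 0 < c) (hb : ∀ y ∈ C, ⟪b, y⟫ ≤ -c * ‖y‖) :
    IsFiniteMeasure (nuM C b) := by
  have h := nuM_integrable hC (a := 0) hb (t := 0) (by simpa using hc)
  simp only [zero_mul, Real.exp_zero] at h
  exact (integrable_const_iff_isFiniteMeasure one_ne_zero).1 h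

lemma isOpen_strip (w c : ℝ) : IsOpen {z : ℂ | |z.re| * w < c} :=
  isOpen_lt (by fun_prop) continuous_const

lemma convex_strip (w c : ℝ) (hw : 0 ≤ w) : Convex ℝ {z : ℂ | |z.re| * w < c} := by
  have : ConvexOn ℝ Set.univ (fun z : ℂ => |z.re| * w) := by
    refine ⟨convex_univ, fun x _ y _ s t hs ht _ => ?_⟩
    have h1 : |(s • x + t • y).re| ≤ s * |x.re| + t * |y.re| := by
      simp only [Complex.add_re, Complex.real_smul, Complex.mul_re, Complex.ofReal_re, Complex.ofReal_im, zero_mul, sub_zero]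
      refine (abs_add_le _ _).trans ?_
      rw [abs_mul, abs_mul, abs_of_nonneg hs, abs_of_nonneg ht]
    simp only [smul_eq_mul]
    nlinarith
  simpa using this.convex_lt c

lemma nuM_analytic {n : ℕ} {C : Set (EuclideanSpace ℝ (Fin n))} (hC : MeasurableSet C)
    {b : EuclideanSpace ℝ (Fin n)} (a : EuclideanSpace ℝ (Fin n)) {c : ℝ}
    (hb : ∀ y ∈ C, ⟪b, y⟫ ≤ -c * ‖y‖) :
    AnalyticOnNhd ℂ (ProbabilityTheory.complexMGF (fun y => ⟪a, y⟫) (nuM C b))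
      {z : ℂ | |z.re| * ‖a‖ < c} := by
  intro z hz
  apply ProbabilityTheory.analyticAt_complexMGF
  have hop : IsOpen {t : ℝ | |t| * ‖a‖ < c} := isOpen_lt (by fun_prop) continuous_const
  refine interior_maximal ?_ hop hz
  intro t ht
  exact nuM_integrable hC hb ht

lemma laplace_unique {n : ℕ} {C₁ C₂ : Set (EuclideanSpace ℝ (Fin n))} (hC₁ : MeasurableSet C₁)
    (hC₂ : MeasurableSet C₂) (hdisj : Disjoint C₁ C₂)
    {b₀ : EuclideanSpace ℝ (Fin n)} {c ε : ℝ} (hc : 0 < c) (hε : 0 < ε)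
    (hb₁ : ∀ y ∈ C₁, ⟪b₀, y⟫ ≤ -c * ‖y‖) (hb₂ : ∀ y ∈ C₂, ⟪b₀, y⟫ ≤ -c * ‖y‖)
    (h : ∀ b, ‖b - b₀‖ < ε → ∫ y in C₁, Complex.exp ((⟪b, y⟫ : ℝ) : ℂ) =
      ∫ y in C₂, Complex.exp ((⟪b, y⟫ : ℝ) : ℂ)) :
    volume C₁ = 0 ∧ volume C₂ = 0 := by
  have hf1 : IsFiniteMeasure (nuM C₁ b₀) := nuM_finite hC₁ hc hb₁
  have hf2 : IsFiniteMeasure (nuM C₂ b₀) := nuM_finite hC₂ hc hb₂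
  have hν : nuM C₁ b₀ = nuM C₂ b₀ := by
    apply Measure.ext_of_charFun
    ext a
    have heq : Set.EqOn (ProbabilityTheory.complexMGF (fun y => ⟪a, y⟫) (nuM C₁ b₀))
        (ProbabilityTheory.complexMGF (fun y => ⟪a, y⟫) (nuM C₂ b₀)) {z : ℂ | |z.re| * ‖a‖ < c} := by
      refine (nuM_analytic hC₁ a hb₁).eqOn_of_preconnected_of_frequently_eq (nuM_analytic hC₂ a hb₂)
        (convex_strip _ _ (norm_nonneg a)).isPreconnected (z₀ := 0) (by simpa using hc) ?_
      have hev : ∀ᶠ t : ℝ in 𝓝[≠] 0, ProbabilityTheory.complexMGF (fun y => ⟪a, y⟫) (nuM C₁ b₀) t =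
          ProbabilityTheory.complexMGF (fun y => ⟪a, y⟫) (nuM C₂ b₀) t := by
        have h1 : ∀ᶠ t : ℝ in 𝓝 0, ‖t • a‖ < ε := by
          have : ContinuousAt (fun t : ℝ => ‖t • a‖) 0 := by fun_prop
          exact this.eventually (gt_mem_nhds (by simpa using hε))
        filter_upwards [h1.filter_mono nhdsWithin_le_nhds] with t ht
        have h2 := h (b₀ + t • a) (by simpa using ht)
        simp only [ProbabilityTheory.complexMGF, nuM_integral, ← Complex.exp_add]
        simpa [inner_add_left, inner_smul_left] using h2
      have ht : Tendsto (fun x : ℝ => (x : ℂ)) (𝓝[≠] 0) (𝓝[≠] 0) := by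
        refine tendsto_nhdsWithin_iff.2 ⟨?_, ?_⟩
        · have := (Complex.continuous_ofReal.tendsto 0).mono_left (nhdsWithin_le_nhds (s := {0}ᶜ))
          simpa using this
        · filter_upwards [self_mem_nhdsWithin] with x hx
          simpa using hx
      exact ht.frequently hev.frequently
    have := heq (show Complex.I ∈ _ by simpa using hc)
    simp only [ProbabilityTheory.complexMGF] at this
    simp only [charFun_apply]
    simpa only [real_inner_comm, mul_comm] using this
  have key : ∀ {A B : Set (EuclideanSpace ℝ (Fin n))}, MeasurableSet A → Disjoint A B →
      nuM A b₀ = nuM B b₀ → volume A = 0 := by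
    intro A B hA hd he
    have h1 : nuM B b₀ A = 0 := by
      unfold nuM
      refine withDensity_absolutelyContinuous _ _ ?_
      rw [Measure.restrict_apply hA, hd.inter_eq, measure_empty]
    rw [← he] at h1
    have h2 : volume.restrict A A = 0 := by
      refine withDensity_absolutelyContinuous' (f := fun y => ENNReal.ofReal (Real.exp ⟪b₀, y⟫)) ?_ ?_ h1
      · fun_prop
      · exact Eventually.of_forall fun y => by simp [Real.exp_pos]
    simpa using h2
  exact ⟨key hC₁ hdisj hν, key hC₂ hdisj.symm hν.symm⟩

noncomputable def ee {n : ℕ} (a b : EuclideanSpace ℝ (Fin n)) (X Y : ℂ)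
    (y : EuclideanSpace ℝ (Fin n)) : ℂ :=
  Complex.exp (-Complex.I * (X * (⟪a, y⟫ : ℝ) + Y * (⟪b, y⟫ : ℝ)))

lemma ee_cont {n : ℕ} (a b : EuclideanSpace ℝ (Fin n)) (X Y : ℂ) : Continuous (ee a b X Y) := by
  unfold ee; fun_prop

lemma ee_norm {n : ℕ} (a b : EuclideanSpace ℝ (Fin n)) (l : ℝ) (ζ : ℂ)
    (y : EuclideanSpace ℝ (Fin n)) :
    ‖ee a b (l * ζ) (Complex.I * l) y‖ = Real.exp (l * (ζ.im * ⟪a, y⟫ + ⟪b, y⟫)) := by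
  unfold ee
  rw [Complex.norm_exp]
  congr 1
  simp
  ring

lemma ee_bound {n : ℕ} {a b : EuclideanSpace ℝ (Fin n)} {l c : ℝ} {ζ : ℂ} (hl : 0 ≤ l)
    (hζ : |ζ.im| * ‖a‖ ≤ c) {y : EuclideanSpace ℝ (Fin n)} (hy : ⟪b, y⟫ ≤ -(2 * c) * ‖y‖) :
    ‖ee a b (l * ζ) (Complex.I * l) y‖ ≤ Real.exp (-(l * c) * ‖y‖) := by
  rw [ee_norm]
  apply Real.exp_le_exp.2
  have h1 : ζ.im * ⟪a, y⟫ ≤ |ζ.im| * (‖a‖ * ‖y‖) := by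
    refine (le_abs_self _).trans ?_
    rw [abs_mul]
    gcongr
    exact abs_real_inner_le_norm a y
  have h2 : |ζ.im| * (‖a‖ * ‖y‖) ≤ c * ‖y‖ := by
    rw [← mul_assoc]; gcongr
  have h3 : ζ.im * ⟪a, y⟫ + ⟪b, y⟫ ≤ -c * ‖y‖ := by linarith
  calc l * (ζ.im * ⟪a, y⟫ + ⟪b, y⟫) ≤ l * (-c * ‖y‖) := by gcongr
    _ = _ := by ring

lemma tail_bound {n : ℕ} {C : Set (EuclideanSpace ℝ (Fin n))} (hC : MeasurableSet C)
    {c δ l : ℝ} (hc : 0 < c) (hl : 1 ≤ l)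
    (g : EuclideanSpace ℝ (Fin n) → ℂ)
    (hb : ∀ y ∈ C, ‖g y‖ ≤ Real.exp (-(l * c) * ‖y‖)) :
    ‖∫ y in C \ Metric.ball 0 δ, g y‖ ≤ Real.exp (c * δ) *
      (∫ y : EuclideanSpace ℝ (Fin n), Real.exp (-c * ‖y‖)) * Real.exp (-(c * δ) * l) := by
  have hint := integrable_exp_neg_norm' (n := n) hc
  have h1 : ‖∫ y in C \ Metric.ball 0 δ, g y‖ ≤
      ∫ y in C \ Metric.ball 0 δ, Real.exp (-(c * (l - 1) * δ)) * Real.exp (-c * ‖y‖) := by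
    refine norm_integral_le_of_norm_le ((hint.const_mul _).integrableOn) ?_
    refine (ae_restrict_iff' (hC.diff measurableSet_ball)).2 (Eventually.of_forall fun y hy => ?_)
    refine (hb y hy.1).trans ?_
    rw [← Real.exp_add]
    apply Real.exp_le_exp.2
    have hy2 : δ ≤ ‖y‖ := by simpa using hy.2
    have : c * (l - 1) * δ ≤ c * (l - 1) * ‖y‖ := by
      have : 0 ≤ c * (l - 1) := mul_nonneg hc.le (by linarith)
      gcongr
    nlinarith
  refine h1.trans ?_
  rw [integral_const_mul]
  have h2 : ∫ y in C \ Metric.ball 0 δ, Real.exp (-c * ‖y‖) ≤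
      ∫ y : EuclideanSpace ℝ (Fin n), Real.exp (-c * ‖y‖) :=
    setIntegral_le_integral hint (Eventually.of_forall fun y => (Real.exp_pos _).le)
  have h3 : Real.exp (-(c * (l - 1) * δ)) = Real.exp (c * δ) * Real.exp (-(c * δ) * l) := by
    rw [← Real.exp_add]; congr 1; ring
  rw [h3]
  calc _ ≤ Real.exp (c * δ) * Real.exp (-(c * δ) * l) *
      (∫ y : EuclideanSpace ℝ (Fin n), Real.exp (-c * ‖y‖)) := by gcongr
    _ = _ := by ring

lemma diff_bound {n : ℕ} {C T : Set (EuclideanSpace ℝ (Fin n))} (hC : MeasurableSet C)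
    (hT : MeasurableSet T) {c δ l : ℝ} (hc : 0 < c) (hl : 1 ≤ l)
    (hCT : ∀ y, ‖y‖ < δ → (y ∈ C ↔ y ∈ T))
    (g : EuclideanSpace ℝ (Fin n) → ℂ) (hg : Continuous g)
    (hb : ∀ y ∈ C, ‖g y‖ ≤ Real.exp (-(l * c) * ‖y‖))
    (hb' : ∀ y ∈ T, ‖g y‖ ≤ Real.exp (-(l * c) * ‖y‖)) :
    ‖(∫ y in C, g y) - ∫ y in T, g y‖ ≤ 2 * (Real.exp (c * δ) *
      (∫ y : EuclideanSpace ℝ (Fin n), Real.exp (-c * ‖y‖))) * Real.exp (-(c * δ) * l) := by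
  have hlc : 0 < l * c := by positivity
  have h1 := integral_inter_add_diff (s := C) (t := Metric.ball 0 δ) (μ := volume) (f := g)
    measurableSet_ball (cone_integrable hC hlc g hg hb)
  have h2 := integral_inter_add_diff (s := T) (t := Metric.ball 0 δ) (μ := volume) (f := g)
    measurableSet_ball (cone_integrable hT hlc g hg hb')
  have h3 : C ∩ Metric.ball 0 δ = T ∩ Metric.ball 0 δ := by
    ext y
    simp only [Set.mem_inter_iff, Metric.mem_ball, dist_zero_right]
    exact and_congr_left fun h => hCT y h
  rw [← h1, ← h2, h3, add_sub_add_left_eq_sub]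
  refine (norm_sub_le _ _).trans ?_
  have h4 := tail_bound (δ := δ) hC hc hl g hb
  have h5 := tail_bound (δ := δ) hT hc hl g hb'
  linarith

open scoped Pointwise in
lemma ee_homog {n : ℕ} {C : Set (EuclideanSpace ℝ (Fin n))} {l : ℝ} (hl : 0 < l)
    (hC : ∀ y, l • y ∈ C ↔ y ∈ C) (a b : EuclideanSpace ℝ (Fin n)) (ζ : ℂ) :
    ∫ y in C, ee a b ζ Complex.I y = (l : ℂ) ^ n * ∫ y in C, ee a b (l * ζ) (Complex.I * l) y := by
  have h1 := Measure.setIntegral_comp_smul_of_pos volume (ee a b ζ Complex.I) C hl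
  have h2 : l • C = C := by
    ext y
    rw [Set.mem_smul_set_iff_inv_smul_mem₀ hl.ne', ← hC, smul_inv_smul₀ hl.ne']
  have h3 : ∀ y, ee a b ζ Complex.I (l • y) = ee a b (l * ζ) (Complex.I * l) y := by
    intro y
    unfold ee
    congr 1
    simp only [inner_smul_right]
    push_cast
    ring
  simp only [h3, h2] at h1
  rw [h1, finrank_euclideanSpace_fin, Complex.real_smul]
  push_cast
  have : (l : ℂ) ^ n ≠ 0 := pow_ne_zero _ (by exact_mod_cast hl.ne')
  field_simp

lemma ee_translate {n : ℕ} (D : Set (EuclideanSpace ℝ (Fin n))) (v a b : EuclideanSpace ℝ (Fin n))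
    (X Y : ℂ) :
    ∫ x in D, ee a b X Y x = ee a b X Y v * ∫ y in (fun y => v + y) ⁻¹' D, ee a b X Y y := by
  rw [← (measurePreserving_add_left volume v).setIntegral_preimage_emb
    (measurableEmbedding_addLeft v), ← integral_const_mul]
  congr 1
  ext y
  unfold ee
  rw [← Complex.exp_add]
  congr 1
  simp only [inner_add_right]
  push_cast
  ring

lemma ee_nuM {n : ℕ} (C : Set (EuclideanSpace ℝ (Fin n))) (a b : EuclideanSpace ℝ (Fin n)) (ζ : ℂ) :
    ∫ y in C, ee a b ζ Complex.I y =
      ProbabilityTheory.complexMGF (fun y => ⟪a, y⟫) (nuM C b) (-Complex.I * ζ) := by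
  rw [ProbabilityTheory.complexMGF, nuM_integral]
  congr 1
  ext y
  unfold ee
  rw [← Complex.exp_add]
  congr 1
  linear_combination (-(⟪b, y⟫ : ℝ) : ℂ) * Complex.I_sq

lemma core {n : ℕ} {P₁ P₂ C₁ C₂ : Set (EuclideanSpace ℝ (Fin n))}
    (hP₁ : IsCompact P₁) (hP₂ : IsCompact P₂)
    (s₀ : EuclideanSpace ℝ (Fin n)) (r : ℝ) (hr : 0 < r)
    (heq : ∀ s : EuclideanSpace ℝ (Fin n), ‖s - s₀‖ = r →
      fourierTransformSet P₁ s = fourierTransformSet P₂ s)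
    (hC₁ : MeasurableSet C₁) (hC₂ : MeasurableSet C₂)
    (hs₁ : ∀ l : ℝ, 0 < l → ∀ y, l • y ∈ C₁ ↔ y ∈ C₁)
    (hs₂ : ∀ l : ℝ, 0 < l → ∀ y, l • y ∈ C₂ ↔ y ∈ C₂)
    (v : EuclideanSpace ℝ (Fin n)) (δ : ℝ) (hδ : 0 < δ)
    (hl₁ : ∀ y, ‖y‖ < δ → (y ∈ C₁ ↔ v + y ∈ P₁ \ P₂))
    (hl₂ : ∀ y, ‖y‖ < δ → (y ∈ C₂ ↔ v + y ∈ P₂ \ P₁))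
    (a b : EuclideanSpace ℝ (Fin n)) (c : ℝ) (hc : 0 < c)
    (hc₁ : ∀ y ∈ C₁, ⟪b, y⟫ ≤ -(2 * c) * ‖y‖)
    (hc₂ : ∀ y ∈ C₂, ⟪b, y⟫ ≤ -(2 * c) * ‖y‖)
    (hd₁ : ∀ y, v + y ∈ P₁ \ P₂ → ⟪b, y⟫ ≤ -(2 * c) * ‖y‖)
    (hd₂ : ∀ y, v + y ∈ P₂ \ P₁ → ⟪b, y⟫ ≤ -(2 * c) * ‖y‖)
    (hab : ⟪a, b⟫ = 0) (hnorm : ‖a‖ = ‖b‖) (hb : b ≠ 0)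
    (p q : ℝ) (hs₀ : s₀ = p • a + q • b) :
    ∫ y in C₁, Complex.exp ((⟪b, y⟫ : ℝ) : ℂ) = ∫ y in C₂, Complex.exp ((⟪b, y⟫ : ℝ) : ℂ) := by
  have hm₁ : MeasurableSet P₁ := hP₁.measurableSet
  have hm₂ : MeasurableSet P₂ := hP₂.measurableSet
  set T₁ := (fun y => v + y) ⁻¹' (P₁ \ P₂) with hT₁
  set T₂ := (fun y => v + y) ⁻¹' (P₂ \ P₁) with hT₂
  have hmT₁ : MeasurableSet T₁ := (hm₁.diff hm₂).preimage (by fun_prop)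
  have hmT₂ : MeasurableSet T₂ := (hm₂.diff hm₁).preimage (by fun_prop)
  set k : ℂ → ℂ := fun ζ => (∫ y in C₁, ee a b ζ Complex.I y) - ∫ y in C₂, ee a b ζ Complex.I y with hk
  have hTeq : ∀ X Y : ℂ, (X - p) ^ 2 + (Y - q) ^ 2 = ((r / ‖b‖ : ℝ) : ℂ) ^ 2 →
      ∫ y in T₁, ee a b X Y y = ∫ y in T₂, ee a b X Y y := by
    intro X Y hXY
    have h1 := complex_circle hP₁ hP₂ s₀ r hr heq a b hab hnorm hb p q hs₀ X Y hXY
    change ∫ y in P₁, ee a b X Y y = ∫ y in P₂, ee a b X Y y at h1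
    rw [← integral_inter_add_diff hm₂ ((ee_cont a b X Y).continuousOn.integrableOn_compact hP₁),
      ← integral_inter_add_diff hm₁ ((ee_cont a b X Y).continuousOn.integrableOn_compact hP₂),
      Set.inter_comm, add_right_inj, ee_translate (P₁ \ P₂) v, ee_translate (P₂ \ P₁) v] at h1
    exact mul_left_cancel₀ (Complex.exp_ne_zero _) h1
  have hU : AnalyticOnNhd ℂ k {ζ | |(-Complex.I * ζ).re| * ‖a‖ < 2 * c} := by
    have h1 : k = fun ζ => ProbabilityTheory.complexMGF (fun y => ⟪a, y⟫) (nuM C₁ b) (-Complex.I * ζ)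
        - ProbabilityTheory.complexMGF (fun y => ⟪a, y⟫) (nuM C₂ b) (-Complex.I * ζ) := by
      ext ζ; simp only [hk, ee_nuM]
    rw [h1]
    intro ζ hζ
    have hlin : AnalyticAt ℂ (fun ζ : ℂ => -Complex.I * ζ) ζ := by fun_prop
    exact ((nuM_analytic hC₁ a hc₁ _ hζ).comp' hlin).sub ((nuM_analytic hC₂ a hc₂ _ hζ).comp' hlin)
  have hconv : Convex ℝ {ζ : ℂ | |(-Complex.I * ζ).re| * ‖a‖ < 2 * c} :=
    (convex_strip ‖a‖ (2 * c) (norm_nonneg a)).linear_preimage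
      (LinearMap.mulLeft ℝ (-Complex.I))
  have h1mem : (1 : ℂ) ∈ {ζ : ℂ | |(-Complex.I * ζ).re| * ‖a‖ < 2 * c} := by simpa using hc
  have h0mem : (0 : ℂ) ∈ {ζ : ℂ | |(-Complex.I * ζ).re| * ‖a‖ < 2 * c} := by simpa using hc
  set I0 := ∫ y : EuclideanSpace ℝ (Fin n), Real.exp (-c * ‖y‖) with hI0
  have hev : ∀ᶠ ζ in 𝓝 (1 : ℂ), k ζ = 0 := by
    refine key_one_dim k (hU 1 h1mem) p q (r / ‖b‖) (2 * (2 * (Real.exp (c * δ) * I0))) (c * δ) n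
      (by have := norm_pos_iff.2 hb; positivity) (by positivity) ?_
    have h1 : ∀ᶠ ζ in 𝓝 (1 : ℂ), |ζ.im| * ‖a‖ < c := by
      have : ContinuousAt (fun ζ : ℂ => |ζ.im| * ‖a‖) 1 := by fun_prop
      exact this.eventually (gt_mem_nhds (by simpa using hc))
    filter_upwards [h1] with ζ hζ l hl hcirc
    have hl0 : 0 < l := by linarith
    have hT := hTeq _ _ hcirc
    simp only [hk]
    rw [ee_homog hl0 (hs₁ l hl0), ee_homog hl0 (hs₂ l hl0), ← mul_sub, norm_mul, norm_pow,
      Complex.norm_real, Real.norm_of_nonneg hl0.le]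
    have hA := diff_bound (δ := δ) hC₁ hmT₁ hc hl hl₁ (ee a b (l * ζ) (Complex.I * l)) (ee_cont _ _ _ _)
      (fun y hy => ee_bound hl0.le hζ.le (hc₁ y hy)) (fun y hy => ee_bound hl0.le hζ.le (hd₁ y hy))
    have hB := diff_bound (δ := δ) hC₂ hmT₂ hc hl hl₂ (ee a b (l * ζ) (Complex.I * l)) (ee_cont _ _ _ _)
      (fun y hy => ee_bound hl0.le hζ.le (hc₂ y hy)) (fun y hy => ee_bound hl0.le hζ.le (hd₂ y hy))
    rw [hT] at hA
    have hAB := norm_sub_le_norm_sub_add_norm_sub (∫ y in C₁, ee a b (l * ζ) (Complex.I * l) y)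
      (∫ y in T₂, ee a b (l * ζ) (Complex.I * l) y) (∫ y in C₂, ee a b (l * ζ) (Complex.I * l) y)
    rw [norm_sub_rev (∫ y in T₂, ee a b (l * ζ) (Complex.I * l) y)] at hAB
    calc _ ≤ l ^ n * (2 * (2 * (Real.exp (c * δ) * I0) * Real.exp (-(c * δ) * l))) := by
          gcongr
          linarith
      _ = _ := by ring
  have h0 := hU.eqOn_zero_of_preconnected_of_eventuallyEq_zero hconv.isPreconnected h1mem hev h0mem
  simp only [hk, Pi.zero_apply] at h0
  have h2 : ∀ y, ee a b 0 Complex.I y = Complex.exp ((⟪b, y⟫ : ℝ) : ℂ) := by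
    intro y
    unfold ee
    congr 1
    linear_combination (-(⟪b, y⟫ : ℝ) : ℂ) * Complex.I_sq
  simp only [h2] at h0
  exact sub_eq_zero.1 h0

lemma exists_frame {n : ℕ} (hn : 2 ≤ n) (b s₀ : EuclideanSpace ℝ (Fin n)) (hb : b ≠ 0) :
    ∃ (a : EuclideanSpace ℝ (Fin n)) (p q : ℝ), ⟪a, b⟫ = 0 ∧ ‖a‖ = ‖b‖ ∧ s₀ = p • a + q • b := by
  have hb0 : 0 < ‖b‖ := norm_pos_iff.2 hb
  have main : ∀ u : EuclideanSpace ℝ (Fin n), u ≠ 0 → ⟪u, b⟫ = 0 → ∀ t q : ℝ, s₀ = t • u + q • b →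
      ∃ (a : EuclideanSpace ℝ (Fin n)) (p q : ℝ), ⟪a, b⟫ = 0 ∧ ‖a‖ = ‖b‖ ∧ s₀ = p • a + q • b := by
    intro u hu hub t q hs
    have hu0 : 0 < ‖u‖ := norm_pos_iff.2 hu
    refine ⟨(‖b‖ / ‖u‖) • u, t * (‖u‖ / ‖b‖), q, ?_, ?_, ?_⟩
    · rw [inner_smul_left, hub, mul_zero]
    · rw [norm_smul, Real.norm_of_nonneg (by positivity)]; field_simp
    · rw [smul_smul, hs]; congr 2; field_simp
  set q := ⟪s₀, b⟫ / ‖b‖ ^ 2 with hq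
  by_cases hu : s₀ - q • b = 0
  · have hne : (ℝ ∙ b)ᗮ ≠ ⊥ := by
      intro h
      rw [Submodule.orthogonal_eq_bot_iff] at h
      have h1 := finrank_span_singleton (K := ℝ) hb
      rw [h, finrank_top, finrank_euclideanSpace_fin] at h1
      omega
    obtain ⟨u, hu1, hu2⟩ := Submodule.exists_mem_ne_zero_of_ne_bot hne
    refine main u hu2 ?_ 0 q ?_
    · exact Submodule.mem_orthogonal_singleton_iff_inner_left.1 hu1
    · rw [zero_smul, zero_add]; exact sub_eq_zero.1 hu
  · refine main _ hu ?_ 1 q (by module)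
    rw [inner_sub_left, inner_smul_left, real_inner_self_eq_norm_sq, hq]
    simp
    field_simp
    simp

lemma cone_exists {n : ℕ} {D : Set (EuclideanSpace ℝ (Fin n))} (hD : MeasurableSet D)
    (v : EuclideanSpace ℝ (Fin n)) {δ : ℝ} (hδ : 0 < δ)
    (h : ∀ y : EuclideanSpace ℝ (Fin n), ‖y‖ < δ → ∀ t : ℝ, 0 < t → t ≤ 1 →
      (v + y ∈ D ↔ v + t • y ∈ D)) :
    ∃ C : Set (EuclideanSpace ℝ (Fin n)), MeasurableSet C ∧
      ∀ y, ∀ l : ℝ, 0 < l → ‖l • y‖ < δ → (y ∈ C ↔ v + l • y ∈ D) := by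
  have h2 : ∀ y : EuclideanSpace ℝ (Fin n), ∀ l m : ℝ, 0 < l → l ≤ m → ‖m • y‖ < δ →
      (v + m • y ∈ D ↔ v + l • y ∈ D) := by
    intro y l m hl hlm hm
    have hm0 : 0 < m := hl.trans_le hlm
    rw [h (m • y) hm (l / m) (by positivity) ((div_le_one hm0).2 hlm), smul_smul,
      div_mul_cancel₀ _ hm0.ne']
  refine ⟨(fun y => v + (δ / (1 + ‖y‖)) • y) ⁻¹' D, hD.preimage ?_, fun y l hl hly => ?_⟩
  · fun_prop
  · have hpos : 0 < δ / (1 + ‖y‖) := by positivity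
    have hlt : ‖(δ / (1 + ‖y‖)) • y‖ < δ := by
      rw [norm_smul, Real.norm_of_nonneg hpos.le, div_mul_eq_mul_div, div_lt_iff₀ (by positivity)]
      nlinarith
    rw [Set.mem_preimage]
    rcases le_total l (δ / (1 + ‖y‖)) with hle | hle
    · exact h2 y _ _ hl hle hlt
    · exact (h2 y _ _ hpos hle hly).symm

lemma vol_pos {n : ℕ} {P₁ P₂ : Set (EuclideanSpace ℝ (Fin n))} (h₁ : P₁ ⊆ closure (interior P₁))
    (h₂ : IsClosed P₂) {x : EuclideanSpace ℝ (Fin n)} (hx : x ∈ P₁ \ P₂)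
    {U : Set (EuclideanSpace ℝ (Fin n))} (hU : IsOpen U) (hxU : x ∈ U) :
    volume ((P₁ \ P₂) ∩ U) ≠ 0 := by
  obtain ⟨z, ⟨hz1, hz2⟩, hz3⟩ := mem_closure_iff.1 (h₁ hx.1) _ (h₂.isOpen_compl.inter hU) ⟨hx.2, hxU⟩
  have ho : IsOpen ((P₂ᶜ ∩ U) ∩ interior P₁) := (h₂.isOpen_compl.inter hU).inter isOpen_interior
  have := ho.measure_pos volume ⟨z, ⟨hz1, hz2⟩, hz3⟩
  refine (this.trans_le (measure_mono ?_)).ne'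
  rintro w ⟨⟨h1, h2⟩, h3⟩
  exact ⟨⟨interior_subset h3, h1⟩, h2⟩

theorem fourier_eq_on_sphere_implies_eq
    (n : ℕ) (hn : 2 ≤ n)
    (P₁ P₂ : Set (EuclideanSpace ℝ (Fin n)))
    (hP₁ : IsGenPolytope P₁) (hP₂ : IsGenPolytope P₂)
    (s₀ : EuclideanSpace ℝ (Fin n)) (r : ℝ) (hr : 0 < r)
    (heq : ∀ s : EuclideanSpace ℝ (Fin n), ‖s - s₀‖ = r →
      fourierTransformSet P₁ s = fourierTransformSet P₂ s) :
    P₁ = P₂ := by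
  by_contra hne
  have hk₁ := compact_gen hP₁
  have hk₂ := compact_gen hP₂
  have hi₁ := closint_gen hP₁
  have hi₂ := closint_gen hP₂
  have hm₁ : MeasurableSet P₁ := hk₁.measurableSet
  have hm₂ : MeasurableSet P₂ := hk₂.measurableSet
  set D := (P₁ \ P₂) ∪ (P₂ \ P₁) with hD
  have hDne : D.Nonempty := by
    by_contra hcon
    rw [Set.not_nonempty_iff_eq_empty, hD, Set.union_empty_iff, Set.diff_eq_empty, Set.diff_eq_empty] at hcon
    exact hne (hcon.1.antisymm hcon.2)
  have hDsub : closure D ⊆ P₁ ∪ P₂ := by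
    refine closure_minimal ?_ (hk₁.union hk₂).isClosed
    rintro x (hx | hx)
    · exact Or.inl hx.1
    · exact Or.inr hx.1
  have hDc : IsCompact (closure D) := (hk₁.union hk₂).of_isClosed_subset isClosed_closure hDsub
  obtain ⟨v, hvD, hvmax⟩ := hDc.exists_isMaxOn hDne.closure continuous_norm.continuousOn
  have hvm : ∀ x ∈ D, ‖x‖ ≤ ‖v‖ := fun x hx => hvmax (subset_closure hx)
  have hv0 : 0 < ‖v‖ := by
    by_contra hcon
    have hall : D ⊆ {0} := by
      intro x hx
      have := hvm x hx
      exact norm_le_zero_iff.1 (this.trans (not_lt.1 hcon))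
    have : Nonempty (Fin n) := ⟨⟨0, by omega⟩⟩
    have hvol : volume D = 0 := measure_mono_null hall (measure_singleton _)
    obtain ⟨x, hx | hx⟩ := hDne
    · exact vol_pos hi₁ hk₂.isClosed hx isOpen_univ (Set.mem_univ x)
        (measure_mono_null (fun y hy => Or.inl hy.1) hvol)
    · exact vol_pos hi₂ hk₁.isClosed hx isOpen_univ (Set.mem_univ x)
        (measure_mono_null (fun y hy => Or.inr hy.1) hvol)
  obtain ⟨δ₁, hδ₁, hcon₁⟩ := conic_gen hP₁ v
  obtain ⟨δ₂, hδ₂, hcon₂⟩ := conic_gen hP₂ v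
  set δ := min δ₁ δ₂ with hδdef
  have hδ : 0 < δ := lt_min hδ₁ hδ₂
  obtain ⟨C₁, hC₁, hCD₁⟩ := cone_exists (hm₁.diff hm₂) v hδ (by
    intro y hy t ht ht1
    rw [Set.mem_diff, Set.mem_diff, hcon₁ y (hy.trans_le (min_le_left _ _)) t ht ht1,
      hcon₂ y (hy.trans_le (min_le_right _ _)) t ht ht1])
  obtain ⟨C₂, hC₂, hCD₂⟩ := cone_exists (hm₂.diff hm₁) v hδ (by
    intro y hy t ht ht1
    rw [Set.mem_diff, Set.mem_diff, hcon₁ y (hy.trans_le (min_le_left _ _)) t ht ht1,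
      hcon₂ y (hy.trans_le (min_le_right _ _)) t ht ht1])
  -- small multiples
  have hsmall : ∀ y : EuclideanSpace ℝ (Fin n), ∃ l : ℝ, 0 < l ∧ ‖l • y‖ < δ := by
    intro y
    refine ⟨δ / (1 + ‖y‖), by positivity, ?_⟩
    rw [norm_smul, Real.norm_of_nonneg (by positivity), div_mul_eq_mul_div, div_lt_iff₀ (by positivity)]
    nlinarith
  have hscale : ∀ {C E : Set (EuclideanSpace ℝ (Fin n))},
      (∀ y, ∀ l : ℝ, 0 < l → ‖l • y‖ < δ → (y ∈ C ↔ v + l • y ∈ E)) →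
      ∀ m : ℝ, 0 < m → ∀ y, m • y ∈ C ↔ y ∈ C := by
    intro C E h m hm y
    obtain ⟨l, hl, hly⟩ := hsmall (m • y)
    rw [h (m • y) l hl hly, h y (l * m) (by positivity) (by rwa [mul_smul]), mul_smul]
  have hdisj : Disjoint C₁ C₂ := by
    rw [Set.disjoint_left]
    intro y h1 h2
    obtain ⟨l, hl, hly⟩ := hsmall y
    exact ((hCD₂ y l hl hly).1 h2).2 ((hCD₁ y l hl hly).1 h1).1
  have hloc : ∀ {C E : Set (EuclideanSpace ℝ (Fin n))},
      (∀ y, ∀ l : ℝ, 0 < l → ‖l • y‖ < δ → (y ∈ C ↔ v + l • y ∈ E)) →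
      ∀ y, ‖y‖ < δ → (y ∈ C ↔ v + y ∈ E) := by
    intro C E h y hy
    have := h y 1 one_pos (by rwa [one_smul])
    rwa [one_smul] at this
  set b₀ := ‖v‖⁻¹ • v with hb₀
  have hb₀n : ‖b₀‖ = 1 := by
    rw [hb₀, norm_smul, norm_inv, norm_norm]; field_simp
  have hDq : ∀ y, v + y ∈ D → ⟪b₀, y⟫ ≤ -(‖y‖ ^ 2 / (2 * ‖v‖)) := by
    intro y hy
    have h1 := hvm _ hy
    have h2 : ‖v + y‖ ^ 2 ≤ ‖v‖ ^ 2 := by gcongr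
    rw [norm_add_sq_real] at h2
    have h3 : ⟪v, y⟫ ≤ -(‖y‖ ^ 2 / 2) := by linarith
    rw [hb₀, inner_smul_left]
    calc _ ≤ ‖v‖⁻¹ * (-(‖y‖ ^ 2 / 2)) := by
          simp only [conj_trivial]; gcongr
      _ = _ := by field_simp
  set κ := min (δ / (4 * ‖v‖)) 1 with hκ
  have hκ0 : 0 < κ := by positivity
  have hκ1 : κ ≤ 1 := min_le_right _ _
  have hκ2 : κ ≤ δ / (4 * ‖v‖) := min_le_left _ _
  have hconeC : ∀ {C E : Set (EuclideanSpace ℝ (Fin n))}, E ⊆ D →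
      (∀ y, ∀ l : ℝ, 0 < l → ‖l • y‖ < δ → (y ∈ C ↔ v + l • y ∈ E)) →
      ∀ y ∈ C, ⟪b₀, y⟫ ≤ -κ * ‖y‖ := by
    intro C E hE h y hy
    rcases eq_or_ne y 0 with rfl | hy0
    · simp
    have hyp : 0 < ‖y‖ := norm_pos_iff.2 hy0
    set l := δ / (2 * ‖y‖) with hl
    have hl0 : 0 < l := by positivity
    have hly : ‖l • y‖ = δ / 2 := by
      rw [norm_smul, Real.norm_of_nonneg hl0.le, hl]; field_simp
    have h1 := hDq _ (hE ((h y l hl0 (by rw [hly]; linarith)).1 hy))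
    rw [hly, inner_smul_right] at h1
    have h2 : l * ⟪b₀, y⟫ ≤ l * (-(δ / (4 * ‖v‖)) * ‖y‖) := by
      refine h1.trans (le_of_eq ?_)
      rw [hl]; field_simp; ring
    have h3 := le_of_mul_le_mul_left h2 hl0
    nlinarith
  have hconeD : ∀ {C E : Set (EuclideanSpace ℝ (Fin n))}, E ⊆ D →
      (∀ y, ∀ l : ℝ, 0 < l → ‖l • y‖ < δ → (y ∈ C ↔ v + l • y ∈ E)) →
      ∀ y, v + y ∈ E → ⟪b₀, y⟫ ≤ -κ * ‖y‖ := by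
    intro C E hE h y hy
    rcases lt_or_ge ‖y‖ δ with hlt | hge
    · exact hconeC hE h y ((hloc h y hlt).2 hy)
    · have h1 := hDq y (hE hy)
      have h2 : κ * ‖y‖ ≤ ‖y‖ ^ 2 / (2 * ‖v‖) := by
        calc κ * ‖y‖ ≤ δ / (4 * ‖v‖) * ‖y‖ := by gcongr
          _ ≤ δ / (2 * ‖v‖) * ‖y‖ := by gcongr; norm_num
          _ ≤ ‖y‖ / (2 * ‖v‖) * ‖y‖ := by gcongr
          _ = _ := by ring
      linarith
  have hpert : ∀ b y : EuclideanSpace ℝ (Fin n), ‖b - b₀‖ < κ / 2 → ⟪b₀, y⟫ ≤ -κ * ‖y‖ →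
      ⟪b, y⟫ ≤ -(2 * (κ / 4)) * ‖y‖ := by
    intro b y hb hy
    have h1 : ⟪b - b₀, y⟫ ≤ κ / 2 * ‖y‖ := (real_inner_le_norm _ _).trans (by gcongr)
    rw [inner_sub_left] at h1
    linarith
  have hE₁ : P₁ \ P₂ ⊆ D := Set.subset_union_left
  have hE₂ : P₂ \ P₁ ⊆ D := Set.subset_union_right
  have hvol := laplace_unique hC₁ hC₂ hdisj (b₀ := b₀) (c := κ) (ε := κ / 2) hκ0 (by positivity)
    (hconeC hE₁ hCD₁) (hconeC hE₂ hCD₂) (by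
      intro b hb
      have hbne : b ≠ 0 := by
        rintro rfl
        rw [zero_sub, norm_neg, hb₀n] at hb
        linarith
      obtain ⟨a, p, q, hab, hnorm, hs⟩ := exists_frame hn b s₀ hbne
      exact core hk₁ hk₂ s₀ r hr heq hC₁ hC₂ (hscale hCD₁) (hscale hCD₂) v δ hδ (hloc hCD₁) (hloc hCD₂)
        a b (κ / 4) (by positivity)
        (fun y hy => hpert b y hb (hconeC hE₁ hCD₁ y hy))
        (fun y hy => hpert b y hb (hconeC hE₂ hCD₂ y hy))
        (fun y hy => hpert b y hb (hconeD hE₁ hCD₁ y hy))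
        (fun y hy => hpert b y hb (hconeD hE₂ hCD₂ y hy))
        hab hnorm hbne p q hs)
  have hfin : ∀ {C E : Set (EuclideanSpace ℝ (Fin n))},
      (∀ y, ∀ l : ℝ, 0 < l → ‖l • y‖ < δ → (y ∈ C ↔ v + l • y ∈ E)) →
      volume C = 0 → volume (E ∩ Metric.ball v δ) = 0 := by
    intro C E h hC
    rw [← measure_preimage_add volume v]
    refine measure_mono_null ?_ hC
    rintro y ⟨hy1, hy2⟩
    refine (hloc h y ?_).2 hy1
    simpa [dist_eq_norm] using hy2
  rw [hD, closure_union] at hvD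
  rcases hvD with hv | hv
  · obtain ⟨x, hx1, hx2⟩ := mem_closure_iff.1 hv _ Metric.isOpen_ball (Metric.mem_ball_self hδ)
    exact vol_pos hi₁ hk₂.isClosed hx2 Metric.isOpen_ball hx1 (hfin hCD₁ hvol.1)
  · obtain ⟨x, hx1, hx2⟩ := mem_closure_iff.1 hv _ Metric.isOpen_ball (Metric.mem_ball_self hδ)
    exact vol_pos hi₂ hk₁.isClosed hx2 Metric.isOpen_ball hx1 (hfin hCD₂ hvol.2)
end

section
/- Let 𝒫₁ and 𝒫₂ be generalized 2-dimensional polytopes in ℝ², let I be a nonempty open interval in ℝ with 1 ∉ I and −1 ∉ I, and let σ(t) = ((1 − t²)/(1 + t²), 2t/(1 + t²)) (a rational parameterization of the unit circle). If F_{𝒫₁}(σ(t)) = F_{𝒫₂}(σ(t)) for every t ∈ I, then 𝒫₁ = 𝒫₂. -/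
open scoped RealInnerProductSpace

namespace FoAux
open MeasureTheory Set Filter Topology


lemma fo_pieceA (k : ℝ → ℝ) (hk : Measurable k) (hb : ∀ x, |k x| ≤ 1)
    (hm : ∀ n : ℕ, ∫ x in (-(Real.pi/2))..(Real.pi/2), (k x : ℂ) * Complex.exp (2 * Complex.I * (n+1) * x) = 0)
    (d : ℝ) (hd : 0 < d) (hd' : d < Real.pi) (hz : ∀ x, Real.pi/2 - d < x → x ≤ Real.pi/2 → k x = 0) :
    ∀ᵐ x, x ∈ Ioc (-(Real.pi/2)) (Real.pi/2) → k x = 0 := by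
  have hab : -(Real.pi/2) < Real.pi/2 := by linarith [Real.pi_pos]
  have hba : Real.pi/2 - -(Real.pi/2) = Real.pi := by ring
  have hL : MemLp (fun x => (k x : ℂ)) 2 (volume.restrict (Ioc (-(Real.pi/2)) (Real.pi/2))) := by
    refine MemLp.of_bound (by fun_prop) 1 (ae_of_all _ fun x => ?_)
    simpa using hb x
  have hLi : IntervalIntegrable k volume (-(Real.pi/2)) (Real.pi/2) := by
    rw [intervalIntegrable_iff_integrableOn_Ioc_of_le hab.le]
    refine MeasureTheory.Measure.integrableOn_of_bounded (M := 1) (by simp) (by fun_prop) (ae_of_all _ fun x => ?_)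
    simpa using hb x
  have hLi2 : IntervalIntegrable (fun x => k x ^ 2) volume (-(Real.pi/2)) (Real.pi/2) := by
    rw [intervalIntegrable_iff_integrableOn_Ioc_of_le hab.le]
    refine MeasureTheory.Measure.integrableOn_of_bounded (M := 1) (by simp) (by fun_prop) (ae_of_all _ fun x => ?_)
    have := hb x
    simp only [norm_pow, Real.norm_eq_abs]
    exact pow_le_one₀ (abs_nonneg _) this
  have hs := hasSum_sq_fourierCoeffOn hab hL
  have hpos : ∀ n : ℤ, fourierCoeffOn hab (fun x => (k x : ℂ)) n = (Real.pi)⁻¹ • ∫ x in (-(Real.pi/2))..(Real.pi/2), (k x : ℂ) * Complex.exp (2 * Complex.I * (-n) * x) := by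
    intro n
    rw [fourierCoeffOn_eq_integral]
    rw [hba, one_div]
    congr 1
    apply intervalIntegral.integral_congr
    intro x _
    simp only [smul_eq_mul]
    rw [mul_comm]
    congr 1
    rw [fourier_coe_apply]
    congr 1
    have : (Real.pi : ℂ) ≠ 0 := by exact_mod_cast Real.pi_ne_zero
    field_simp
    push_cast; ring
  have hneg : ∀ n : ℕ, ∫ x in (-(Real.pi/2))..(Real.pi/2), (k x : ℂ) * Complex.exp (2 * Complex.I * (-(n+1)) * x) = 0 := by
    intro n
    have h := congrArg (starRingEnd ℂ) (hm n)
    rw [← intervalIntegral.intervalIntegral_conj, map_zero] at h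
    rw [← h]
    apply intervalIntegral.integral_congr
    intro x _
    simp only [map_mul, Complex.conj_ofReal, ← Complex.exp_conj]
    congr 2
    simp only [map_mul, map_add, map_natCast, map_one, Complex.conj_I, Complex.conj_ofReal, map_ofNat]
    ring
  have hzero : ∀ n : ℤ, n ≠ 0 → fourierCoeffOn hab (fun x => (k x : ℂ)) n = 0 := by
    intro n hn
    rw [hpos]
    obtain ⟨m, rfl | rfl⟩ : ∃ m : ℕ, n = (m+1 : ℤ) ∨ n = -(m+1 : ℤ) := ⟨n.natAbs - 1, by omega⟩
    · have := hneg m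
      push_cast
      rw [this, smul_zero]
    · have := hm m
      push_cast
      rw [neg_neg, this, smul_zero]
  have hs0 := hs.unique (hasSum_single 0 (fun n hn => by rw [hzero n hn]; simp))
  set c : ℝ := (Real.pi)⁻¹ * ∫ x in (-(Real.pi/2))..(Real.pi/2), k x with hc
  have hc0 : fourierCoeffOn hab (fun x => (k x : ℂ)) 0 = (c : ℂ) := by
    rw [hpos, hc]
    simp [intervalIntegral.integral_ofReal]
  rw [hc0, hba] at hs0
  simp only [Complex.norm_real, Real.norm_eq_abs, sq_abs, smul_eq_mul] at hs0
  have hpi := Real.pi_pos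
  have hk1 : ∫ x in (-(Real.pi/2))..(Real.pi/2), k x = Real.pi * c := by
    rw [hc]; field_simp
  have hk2 : ∫ x in (-(Real.pi/2))..(Real.pi/2), k x ^ 2 = Real.pi * c ^ 2 := by
    rw [← hs0]; field_simp
  have hvar : ∫ x in (-(Real.pi/2))..(Real.pi/2), (k x - c)^2 = 0 := by
    have : ∀ x, (k x - c)^2 = k x ^ 2 - (2 * c) * k x + c^2 := fun x => by ring
    simp only [this]
    rw [intervalIntegral.integral_add (hLi2.sub (hLi.const_mul _)) (by simp), intervalIntegral.integral_sub hLi2 (hLi.const_mul _), intervalIntegral.integral_const_mul, hk1, hk2]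
    simp
    ring
  rw [intervalIntegral.integral_of_le hab.le, integral_eq_zero_iff_of_nonneg (fun x => sq_nonneg _)] at hvar
  swap
  · refine MeasureTheory.Measure.integrableOn_of_bounded (M := (1 + |c|)^2) (by simp) ((hk.sub_const c).pow_const 2).aestronglyMeasurable (ae_of_all _ fun x => ?_)
    simp only [norm_pow, Real.norm_eq_abs]
    gcongr
    exact (abs_sub _ _).trans (by gcongr; exact hb x)
  have hae : ∀ᵐ x, x ∈ Ioc (-(Real.pi/2)) (Real.pi/2) → k x = c := by
    rw [← ae_restrict_iff' measurableSet_Ioc]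
    filter_upwards [hvar] with x hx
    simp at hx
    linarith
  have hcz : c = 0 := by
    by_contra hcne
    have : volume (Ioo (Real.pi/2 - d) (Real.pi/2)) = 0 := by
      refine measure_mono_null ?_ hae
      intro x hx
      simp only [mem_compl_iff, mem_ofPred_eq, not_forall]
      refine ⟨⟨by linarith [hx.1], hx.2.le⟩, ?_⟩
      rw [hz x hx.1 hx.2.le]
      exact Ne.symm hcne
    simp at this
    linarith
  simpa [hcz] using hae

noncomputable def foD (μ : ℝ) (x : ℝ) : ℂ := Complex.exp (-(x * Complex.I)) - μ * Complex.exp (x * Complex.I)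

lemma foD_norm (μ x : ℝ) (h0 : 0 ≤ μ) : 1 - μ ≤ ‖foD μ x‖ := by
  have h1 : ‖Complex.exp (-(x * Complex.I))‖ = 1 := by
    have := Complex.norm_exp_ofReal_mul_I (-x)
    simpa using this
  have h2 : ‖(μ : ℂ) * Complex.exp (x * Complex.I)‖ = μ := by
    rw [norm_mul, Complex.norm_exp_ofReal_mul_I]; simp [abs_of_nonneg h0]
  have := norm_sub_norm_le (Complex.exp (-(x * Complex.I))) (μ * Complex.exp (x * Complex.I))
  rw [h1, h2] at this
  exact this

lemma foD_cont (μ : ℝ) : Continuous (foD μ) := by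
  unfold foD; fun_prop

lemma fo_geom (z : ℂ) (hz : 1 - z ≠ 0) (N : ℕ) :
    1 / (1 - z)^2 = ∑ j ∈ Finset.range N, (j+1) * z^j + z^N * ((N+1) - N * z) / (1 - z)^2 := by
  induction N with
  | zero => simp
  | succ n ih =>
    rw [ih, Finset.sum_range_succ]
    field_simp
    push_cast
    ring

lemma foD_expand (μ x : ℝ) (h0 : 0 ≤ μ) (h1 : μ ≤ 1/4) (N : ℕ) :
    1 / foD μ x ^ 2 = ∑ j ∈ Finset.range N, ((j+1) * (μ:ℂ)^j) * Complex.exp (2 * Complex.I * (j+1) * x)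
      + (μ:ℂ)^N * (Complex.exp (Complex.I * x) ^ (2 * N) * ((N+1) - N * (μ * Complex.exp (Complex.I * x) ^ 2)) / foD μ x ^ 2) := by
  set u := Complex.exp (Complex.I * x) with hu
  have hu0 : u ≠ 0 := Complex.exp_ne_zero _
  have hD : foD μ x = u⁻¹ * (1 - μ * u^2) := by
    unfold foD
    rw [Complex.exp_neg, mul_comm (x : ℂ) Complex.I, ← hu]
    field_simp
  have hDne : foD μ x ≠ 0 := by
    intro h
    have := foD_norm μ x h0
    rw [h, norm_zero] at this
    linarith
  have hne : 1 - (μ:ℂ) * u^2 ≠ 0 := by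
    intro h; apply hDne; rw [hD, h, mul_zero]
  have hg := fo_geom (μ * u^2) hne N
  have e1 : ∀ j : ℕ, Complex.exp (2 * Complex.I * (j+1) * x) = u ^ 2 * (u^2)^j := by
    intro j
    rw [hu, ← pow_mul, ← pow_add, ← Complex.exp_nat_mul]
    congr 1
    push_cast; ring
  have e2 : 1 / foD μ x ^ 2 = u^2 * (1 / (1 - μ * u^2)^2) := by
    rw [hD]; field_simp
  have e3 : ∀ A : ℂ, A / foD μ x ^ 2 = A * (1 / foD μ x ^ 2) := fun A => by ring
  rw [e3 (u ^ (2*N) * _), e2]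
  simp only [e1]
  nth_rewrite 1 [hg]
  rw [mul_add, Finset.mul_sum]
  congr 1
  · apply Finset.sum_congr rfl
    intro j _
    rw [mul_pow]; ring
  · rw [mul_pow, pow_mul]; ring

lemma fo_pieceB (k : ℝ → ℝ) (hk : Measurable k) (hb : ∀ x, |k x| ≤ 1)
    (hG : ∀ N : ℕ, Tendsto (fun l : ℝ => l ^ N * ‖∫ x in (-(Real.pi/2))..(Real.pi/2), (k x : ℂ) * (1 / foD (1/(4*l^2)) x ^ 2)‖) atTop (𝓝 0)) :
    ∀ n : ℕ, ∫ x in (-(Real.pi/2))..(Real.pi/2), (k x : ℂ) * Complex.exp (2 * Complex.I * (n+1) * x) = 0 := by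
  have hab : -(Real.pi/2) ≤ Real.pi/2 := by linarith [Real.pi_pos]
  intro n
  induction n using Nat.strong_induction_on with
  | _ n ih =>
  set m : ℕ → ℂ := fun n => ∫ x in (-(Real.pi/2))..(Real.pi/2), (k x : ℂ) * Complex.exp (2 * Complex.I * (n+1) * x) with hm
  have hint : ∀ g : ℝ → ℂ, Continuous g → IntervalIntegrable (fun x => (k x : ℂ) * g x) volume (-(Real.pi/2)) (Real.pi/2) := by
    intro g hg
    have h1 : IntervalIntegrable g volume (-(Real.pi/2)) (Real.pi/2) := hg.intervalIntegrable _ _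
    rw [intervalIntegrable_iff_integrableOn_Ioc_of_le hab] at h1 ⊢
    refine h1.bdd_mul (c := 1) (by fun_prop) (ae_of_all _ fun x => ?_)
    simpa using hb x
  have key : ∀ l : ℝ, 1 ≤ l → ‖((n:ℂ)+1) * m n‖ ≤ 4^n * (l^(2*n) * ‖∫ x in (-(Real.pi/2))..(Real.pi/2), (k x : ℂ) * (1 / foD (1/(4*l^2)) x ^ 2)‖) + (2 * (2*n+3) * Real.pi) * (1 / (4*l^2)) := by
    intro l hl
    set μ : ℝ := 1/(4*l^2) with hμ
    have h0 : 0 < μ := by positivity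
    have h1 : μ ≤ 1/4 := by
      rw [hμ]; apply one_div_le_one_div_of_le (by norm_num); nlinarith
    have hDne : ∀ x, foD μ x ^ 2 ≠ 0 := by
      intro x h
      have := foD_norm μ x h0.le
      rw [pow_eq_zero_iff (by norm_num)] at h
      rw [h, norm_zero] at this
      linarith
    set R : ℝ → ℂ := fun x => (Complex.exp (Complex.I * x) ^ (2 * (n+1)) * (((n+1:ℕ)+1) - (n+1:ℕ) * (μ * Complex.exp (Complex.I * x) ^ 2)) / foD μ x ^ 2) with hR
    have hRc : Continuous R := by
      rw [hR]
      refine Continuous.div (by fun_prop) ((foD_cont μ).pow 2) hDne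
    have hRb : ∀ x, ‖R x‖ ≤ 2 * (2*n+3) := by
      intro x
      have hd := foD_norm μ x h0.le
      have hu : ‖Complex.exp (Complex.I * x)‖ = 1 := by
        rw [mul_comm]; exact Complex.norm_exp_ofReal_mul_I x
      rw [hR]
      simp only [norm_div, norm_mul, norm_pow, hu, one_pow, one_mul]
      rw [div_le_iff₀ (by have : 0 < ‖foD μ x‖ := by linarith
                          positivity)]
      have h3 : ‖(((n+1:ℕ):ℂ)+1) - (n+1:ℕ) * (μ * Complex.exp (Complex.I * x) ^ 2)‖ ≤ 2 * n + 3 := by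
        refine (norm_sub_le _ _).trans ?_
        have : ‖(((n+1:ℕ):ℂ)+1)‖ = n + 2 := by
          have : (((n+1:ℕ):ℂ)+1) = ((n+2:ℕ):ℂ) := by push_cast; ring
          rw [this, Complex.norm_natCast]; push_cast; ring
        rw [this]
        simp only [norm_mul, norm_pow, hu, one_pow, mul_one, Complex.norm_natCast, Complex.norm_real, Real.norm_eq_abs, abs_of_pos h0]
        push_cast
        nlinarith
      have h4 : (9/16 : ℝ) ≤ ‖foD μ x‖^2 := by nlinarith
      calc _ ≤ 2 * (n:ℝ) + 3 := h3
        _ ≤ 2 * (2*n+3) * (9/16) := by nlinarith [Nat.cast_nonneg (α := ℝ) n]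
        _ ≤ _ := by gcongr
    have hexp : ∫ x in (-(Real.pi/2))..(Real.pi/2), (k x : ℂ) * (1 / foD μ x ^ 2) = ((n+1) * (μ:ℂ)^n) * m n + (μ:ℂ)^(n+1) * ∫ x in (-(Real.pi/2))..(Real.pi/2), (k x : ℂ) * R x := by
      have e : ∀ x : ℝ, (k x : ℂ) * (1 / foD μ x ^ 2) = ∑ j ∈ Finset.range (n+1), ((j+1) * (μ:ℂ)^j) * ((k x : ℂ) * Complex.exp (2 * Complex.I * (j+1) * x)) + (μ:ℂ)^(n+1) * ((k x : ℂ) * R x) := by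
        intro x
        rw [foD_expand μ x h0.le h1 (n+1), mul_add, Finset.mul_sum]
        congr 1
        · apply Finset.sum_congr rfl; intro j _; ring
        · rw [hR]; ring
      simp only [e]
      have hi : ∀ j : ℕ, IntervalIntegrable (fun x : ℝ => (((j:ℂ)+1) * (μ:ℂ)^j) * ((k x : ℂ) * Complex.exp (2 * Complex.I * (j+1) * x))) volume (-(Real.pi/2)) (Real.pi/2) := by
        intro j
        exact (hint _ (by fun_prop)).const_mul _
      have hsum : IntervalIntegrable (fun x : ℝ => ∑ j ∈ Finset.range (n+1), (((j:ℂ)+1) * (μ:ℂ)^j) * ((k x : ℂ) * Complex.exp (2 * Complex.I * (j+1) * x))) volume (-(Real.pi/2)) (Real.pi/2) := by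
        have := IntervalIntegrable.sum (Finset.range (n+1)) (fun j _ => hi j)
        rwa [Finset.sum_fn] at this
      rw [intervalIntegral.integral_add hsum ((hint R hRc).const_mul _), intervalIntegral.integral_finsetSum fun j _ => hi j, intervalIntegral.integral_const_mul]
      congr 1
      simp only [intervalIntegral.integral_const_mul]
      rw [Finset.sum_range_succ, Finset.sum_eq_zero, zero_add]
      intro j hj
      rw [ih j (Finset.mem_range.mp hj), mul_zero]
    have hRi : ‖∫ x in (-(Real.pi/2))..(Real.pi/2), (k x : ℂ) * R x‖ ≤ (2 * (2*n+3)) * Real.pi := by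
      have := intervalIntegral.norm_integral_le_of_norm_le_const (a := -(Real.pi/2)) (b := Real.pi/2) (f := fun x => (k x : ℂ) * R x) (C := 2 * (2*n+3)) ?_
      · rw [show Real.pi/2 - -(Real.pi/2) = Real.pi by ring, abs_of_pos Real.pi_pos] at this
        exact this
      · intro x _
        rw [norm_mul]
        calc _ ≤ 1 * ‖R x‖ := by gcongr; simpa using hb x
          _ ≤ _ := by rw [one_mul]; exact hRb x
    rw [hexp]
    set J := ∫ x in (-(Real.pi/2))..(Real.pi/2), (k x : ℂ) * R x
    have hμl : 4 ^ n * l^(2*n) * μ^n = 1 := by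
      rw [hμ, pow_mul, ← mul_pow, ← mul_pow]
      have : 4 * l^2 * (1/(4*l^2)) = 1 := by field_simp
      rw [this, one_pow]
    have h5 : ((n:ℂ)+1) * m n = (4^n * l^(2*n) : ℝ) * (((n+1) * (μ:ℂ)^n) * m n + (μ:ℂ)^(n+1) * J) - μ * J := by
      have : ((4^n * l^(2*n) * μ^n : ℝ) : ℂ) = 1 := by rw [hμl]; simp
      push_cast at this ⊢
      linear_combination (-(((n:ℂ)+1) * m n) - μ * J) * this
    rw [h5]
    refine (norm_sub_le _ _).trans ?_
    apply add_le_add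
    · rw [norm_mul, Complex.norm_real, Real.norm_eq_abs, abs_of_nonneg (by positivity), mul_assoc]
    · rw [norm_mul, Complex.norm_real, Real.norm_eq_abs, abs_of_pos h0, mul_comm]
      gcongr
  have hlim : Tendsto (fun l : ℝ => 4^n * (l^(2*n) * ‖∫ x in (-(Real.pi/2))..(Real.pi/2), (k x : ℂ) * (1 / foD (1/(4*l^2)) x ^ 2)‖) + (2 * (2*n+3) * Real.pi) * (1 / (4*l^2))) atTop (𝓝 (4^n * 0 + (2 * (2*n+3) * Real.pi) * 0)) := by
    refine ((hG (2*n)).const_mul _).add (Tendsto.const_mul _ ?_)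
    refine Tendsto.div_atTop tendsto_const_nhds ?_
    exact (tendsto_pow_atTop (by norm_num)).const_mul_atTop (by norm_num)
  have := ge_of_tendsto hlim (eventually_atTop.2 ⟨1, key⟩)
  rw [mul_zero, mul_zero, add_zero] at this
  have h6 := norm_le_zero_iff.1 this
  rcases mul_eq_zero.1 h6 with h | h
  · exact absurd h (Nat.cast_add_one_ne_zero n)
  · exact h

lemma fo_inner (c : ℂ) (hc : c ≠ 0) (ε : ℝ) :
    ∫ r in (0:ℝ)..ε, (r:ℂ) * Complex.exp (-(c * r)) = 1/c^2 - Complex.exp (-(c*ε)) * (ε/c + 1/c^2) := by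
  have hd : ∀ r ∈ uIcc (0:ℝ) ε, HasDerivAt (fun r : ℝ => -(Complex.exp (-(c*r)) * (r/c + 1/c^2))) ((r:ℂ) * Complex.exp (-(c * r))) r := by
    intro r _
    have h1 : HasDerivAt (fun r : ℝ => (r : ℂ)) 1 r := Complex.ofRealCLM.hasDerivAt
    have h2 : HasDerivAt (fun r : ℝ => -(c * (r:ℂ))) (-(c * 1)) r := (h1.const_mul c).neg
    have h3 : HasDerivAt (fun r : ℝ => (r:ℂ)/c + 1/c^2) (1/c) r := (h1.div_const c).add_const _
    refine ((h2.cexp.mul h3).neg).congr_deriv ?_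
    field_simp
    ring
  rw [intervalIntegral.integral_eq_sub_of_hasDerivAt hd]
  · simp; ring
  · apply Continuous.intervalIntegrable; fun_prop

lemma foD_re (μ x : ℝ) : (foD μ x).re = (1 - μ) * Real.cos x := by
  unfold foD
  rw [← neg_mul, ← Complex.ofReal_neg, Complex.sub_re, Complex.re_ofReal_mul, Complex.exp_ofReal_mul_I_re, Complex.exp_ofReal_mul_I_re, Real.cos_neg]
  ring

noncomputable def foE (l : ℝ) (z : ℂ) : ℂ := Complex.exp (-(l * (starRingEnd ℂ) z) + z / (4 * l))

lemma foE_cont (l : ℝ) : Continuous (foE l) := by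
  unfold foE
  have := Complex.continuous_conj
  fun_prop

lemma foE_norm (l : ℝ) (z : ℂ) : ‖foE l z‖ = Real.exp (-((l - 1/(4*l)) * z.re)) := by
  unfold foE
  rw [Complex.norm_exp]
  congr 1
  have : z / (4 * (l:ℂ)) = ((1/(4*l) : ℝ) : ℂ) * z := by push_cast; ring
  rw [this]
  simp
  ring

lemma foE_polar (l : ℝ) (hl : l ≠ 0) (r x : ℝ) : foE l (r * Complex.exp (x * Complex.I)) = Complex.exp (-((l * foD (1/(4*l^2)) x) * r)) := by
  unfold foE foD
  congr 1
  have hl' : (l : ℂ) ≠ 0 := by exact_mod_cast hl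
  rw [map_mul, ← Complex.exp_conj, map_mul, Complex.conj_I, Complex.conj_ofReal, Complex.conj_ofReal]
  push_cast
  rw [mul_neg]
  field_simp
  ring

lemma fo_first (h : ℂ → ℝ) (hm : Measurable h) (hb : ∀ z, |h z| ≤ 1) (R ε : ℝ) (hR : 0 < R) (hε : 0 < ε)
    (hs : ∀ z, h z ≠ 0 → ‖z‖^2 ≤ 2 * R * z.re)
    (hc : ∀ z, ∀ t : ℝ, ‖z‖ < ε → 0 < t → ‖(t:ℂ) * z‖ < ε → h (t * z) = h z) (l : ℝ) (hl : 1 ≤ l) :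
    ∫ z in Metric.ball (0:ℂ) ε, (h z : ℂ) * foE l z = 
      ∫ x in (-(Real.pi/2))..(Real.pi/2), (h ((ε/2 : ℝ) * Complex.exp (x * Complex.I)) : ℂ) * ∫ r in (0:ℝ)..ε, (r:ℂ) * Complex.exp (-((l * foD (1/(4*l^2)) x) * r)) := by
  have hpi := Real.pi_pos
  have hab : -(Real.pi/2) ≤ Real.pi/2 := by linarith
  rw [← integral_indicator Metric.isOpen_ball.measurableSet, ← Complex.integral_comp_polarCoord_symm]
  have hpol : ∀ p : ℝ × ℝ, Complex.polarCoord.symm p = p.1 * Complex.exp (p.2 * Complex.I) := by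
    intro p
    rw [Complex.polarCoord_symm_apply, Complex.exp_mul_I]
    push_cast; rfl
  have hsub : Ioo 0 ε ×ˢ Ioo (-(Real.pi/2)) (Real.pi/2) ⊆ polarCoord.target := by
    intro p hp
    rw [polarCoord_target]
    exact ⟨hp.1.1, by linarith [hp.2.1], by linarith [hp.2.2]⟩
  rw [setIntegral_eq_of_subset_of_forall_sdiff_eq_zero (s := Ioo 0 ε ×ˢ Ioo (-(Real.pi/2)) (Real.pi/2)) polarCoord.open_target.measurableSet hsub]
  swap
  · rintro ⟨r, x⟩ ⟨hp, hp'⟩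
    rw [polarCoord_target] at hp
    simp only [mem_prod, mem_Ioi, mem_Ioo] at hp hp'
    rw [hpol]
    by_cases hr : r < ε
    · have hcos : Real.cos x ≤ 0 := by
        by_contra hcon
        push Not at hcon
        apply hp'
        refine ⟨⟨hp.1, hr⟩, ?_⟩
        by_contra hx
        have : Real.cos x ≤ 0 := by
          rw [← Real.cos_abs]
          apply Real.cos_nonpos_of_pi_div_two_le_of_le
          · by_contra hlt
            push Not at hlt
            rw [abs_lt] at hlt
            exact hx hlt
          · have : |x| ≤ Real.pi := abs_le.2 ⟨hp.2.1.le, hp.2.2.le⟩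
            linarith
        linarith
      have hz : h ((r:ℂ) * Complex.exp (x * Complex.I)) = 0 := by
        by_contra hne
        have := hs _ hne
        rw [norm_mul, Complex.norm_exp_ofReal_mul_I, Complex.re_ofReal_mul, Complex.exp_ofReal_mul_I_re] at this
        simp only [Complex.norm_real, Real.norm_eq_abs, mul_one, sq_abs] at this
        have h1 : 0 < r^2 := by have := hp.1; positivity
        have h2 : 2 * R * (r * Real.cos x) ≤ 0 := by
          have : r * Real.cos x ≤ 0 := mul_nonpos_of_nonneg_of_nonpos hp.1.le hcos
          nlinarith
        linarith
      have : (Metric.ball (0:ℂ) ε).indicator (fun z => (h z : ℂ) * foE l z) ((r:ℂ) * Complex.exp (x * Complex.I)) = 0 := by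
        apply indicator_apply_eq_zero.2
        intro _
        rw [hz]; simp
      rw [this, smul_zero]
    · rw [indicator_of_notMem, smul_zero]
      rw [mem_ball_zero_iff, norm_mul, Complex.norm_exp_ofReal_mul_I]
      simp only [Complex.norm_real, Real.norm_eq_abs, mul_one, abs_of_pos hp.1]
      exact hr
  set k : ℝ → ℝ := fun x => h ((ε/2 : ℝ) * Complex.exp (x * Complex.I)) with hk
  have hkm : Measurable k := hm.comp (by fun_prop)
  have step : ∫ p in Ioo 0 ε ×ˢ Ioo (-(Real.pi/2)) (Real.pi/2), p.1 • (Metric.ball (0:ℂ) ε).indicator (fun z => (h z : ℂ) * foE l z) (Complex.polarCoord.symm p)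
      = ∫ p in Ioo 0 ε ×ˢ Ioo (-(Real.pi/2)) (Real.pi/2), (k p.2 : ℂ) * ((p.1:ℂ) * Complex.exp (-((l * foD (1/(4*l^2)) p.2) * p.1))) := by
    apply setIntegral_congr_fun (measurableSet_Ioo.prod measurableSet_Ioo)
    rintro ⟨r, x⟩ ⟨hr, hx⟩
    simp only at hr hx ⊢
    have hr0 := hr.1
    have hn : ‖(r:ℂ) * Complex.exp (x * Complex.I)‖ = r := by
      rw [norm_mul, Complex.norm_exp_ofReal_mul_I]
      simp [abs_of_pos hr0]
    rw [hpol, indicator_of_mem (by rw [mem_ball_zero_iff, hn]; exact hr.2), foE_polar l (by linarith)]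
    have : k x = h ((r:ℂ) * Complex.exp (x * Complex.I)) := by
      have e : ((ε/2 : ℝ):ℂ) * Complex.exp (x * Complex.I) = ((ε/2/r : ℝ):ℂ) * ((r:ℂ) * Complex.exp (x * Complex.I)) := by
        have : (r:ℂ) ≠ 0 := by exact_mod_cast hr0.ne'
        push_cast; field_simp
      rw [hk]
      simp only
      rw [e]
      apply hc _ _ (by rw [hn]; exact hr.2) (by positivity)
      rw [← e, norm_mul, Complex.norm_exp_ofReal_mul_I]
      simp [abs_of_pos hε]; linarith
    rw [this, Complex.real_smul]
    ring
  rw [step, Measure.volume_eq_prod, ← Measure.prod_restrict, integral_prod_symm]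
  · rw [intervalIntegral.integral_of_le hab, integral_Ioc_eq_integral_Ioo]
    apply integral_congr_ae
    refine ae_of_all _ fun x => ?_
    simp only
    rw [integral_const_mul, intervalIntegral.integral_of_le hε.le, integral_Ioc_eq_integral_Ioo]
  · rw [Measure.prod_restrict, ← Measure.volume_eq_prod]
    have hcont : Continuous (fun p : ℝ × ℝ => (p.1:ℂ) * Complex.exp (-((l * foD (1/(4*l^2)) p.2) * p.1))) := by
      have := foD_cont (1/(4*l^2))
      fun_prop
    have hi : IntegrableOn (fun p : ℝ × ℝ => (p.1:ℂ) * Complex.exp (-((l * foD (1/(4*l^2)) p.2) * p.1))) (Ioo 0 ε ×ˢ Ioo (-(Real.pi/2)) (Real.pi/2)) := by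
      refine (hcont.continuousOn.integrableOn_compact (isCompact_Icc.prod isCompact_Icc)).mono_set (prod_mono Ioo_subset_Icc_self Ioo_subset_Icc_self)
    refine Integrable.bdd_mul (c := 1) hi ?_ (ae_of_all _ fun x => ?_)
    · have : Measurable (fun p : ℝ × ℝ => (k p.2 : ℂ)) := by fun_prop
      exact this.aestronglyMeasurable
    · simpa using hb _

lemma fo_pieceC (h : ℂ → ℝ) (hm : Measurable h) (hb : ∀ z, |h z| ≤ 1) (R ε : ℝ) (hR : 0 < R) (hε : 0 < ε)
    (hs : ∀ z, h z ≠ 0 → ‖z‖^2 ≤ 2 * R * z.re)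
    (hc : ∀ z, ∀ t : ℝ, ‖z‖ < ε → 0 < t → ‖(t:ℂ) * z‖ < ε → h (t * z) = h z)
    (hI : ∀ l : ℝ, 1 ≤ l → ∫ z, (h z : ℂ) * foE l z = 0) :
    ∃ C c : ℝ, 0 < c ∧ ∀ l : ℝ, 1 ≤ l → ‖∫ x in (-(Real.pi/2))..(Real.pi/2), (h ((ε/2 : ℝ) * Complex.exp (x * Complex.I)) : ℂ) * (1 / foD (1/(4*l^2)) x ^ 2)‖ ≤ C * (l^2 * Real.exp (-(c * l))) := by
  have hpi := Real.pi_pos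
  have hab : -(Real.pi/2) ≤ Real.pi/2 := by linarith
  have hsupp : ∀ z, h z ≠ 0 → ‖z‖ ≤ 2 * R := by
    intro z hz
    have h1 := hs z hz
    have h2 := Complex.re_le_norm z
    by_contra hcon
    push Not at hcon
    nlinarith
  set k : ℝ → ℝ := fun x => h ((ε/2 : ℝ) * Complex.exp (x * Complex.I)) with hk
  have hkm : Measurable k := hm.comp (by fun_prop)
  have hks : ∀ x, k x ≠ 0 → ε / (4*R) ≤ Real.cos x := by
    intro x hx
    have := hs _ hx
    rw [norm_mul, Complex.norm_exp_ofReal_mul_I, Complex.re_ofReal_mul, Complex.exp_ofReal_mul_I_re] at this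
    simp only [Complex.norm_real, Real.norm_eq_abs, mul_one, sq_abs] at this
    rw [div_le_iff₀ (by positivity)]
    by_contra hcon
    push Not at hcon
    nlinarith
  set c : ℝ := 3/4 * (ε^2 / (4*R)) with hcdef
  refine ⟨Real.pi * (2 * ε + 4) + (volume (Metric.closedBall (0:ℂ) (2*R))).toReal, c, by positivity, ?_⟩
  intro l hl
  have hl0 : 0 < l := by linarith
  set μ : ℝ := 1/(4*l^2) with hμ
  have h0 : 0 < μ := by positivity
  have h1 : μ ≤ 1/4 := by
    rw [hμ]; apply one_div_le_one_div_of_le (by norm_num); nlinarith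
  have hDn : ∀ x, 3/4 ≤ ‖foD μ x‖ := fun x => by linarith [foD_norm μ x h0.le]
  have hDne : ∀ x, foD μ x ≠ 0 := by
    intro x h
    have := hDn x
    rw [h, norm_zero] at this
    linarith
  have hlc : (l:ℂ) ≠ 0 := by exact_mod_cast hl0.ne'
  -- second part
  have hlm : 3/4 * l ≤ l - 1/(4*l) := by
    have : 1/(4*l) ≤ 1/4 * l := by
      rw [div_le_iff₀ (by positivity)]; nlinarith
    linarith
  have hmeas : Measurable (fun z => (h z : ℂ) * foE l z) := by
    have := (foE_cont l).measurable
    fun_prop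
  have hint : Integrable (fun z => (h z : ℂ) * foE l z) := by
    have : (fun z => (h z : ℂ) * foE l z) = (Metric.closedBall (0:ℂ) (2*R)).indicator (fun z => (h z : ℂ) * foE l z) := by
      ext z
      by_cases hz : z ∈ Metric.closedBall (0:ℂ) (2*R)
      · rw [indicator_of_mem hz]
      · rw [indicator_of_notMem hz]
        have : h z = 0 := by
          by_contra hne
          exact hz (mem_closedBall_zero_iff.2 (hsupp z hne))
        rw [this]; simp
    rw [this, integrable_indicator_iff Metric.isClosed_closedBall.measurableSet]
    have hi : IntegrableOn (foE l) (Metric.closedBall (0:ℂ) (2*R)) :=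
      (foE_cont l).continuousOn.integrableOn_compact (isCompact_closedBall _ _)
    refine Integrable.bdd_mul (c := 1) hi (by fun_prop) (ae_of_all _ fun x => ?_)
    simpa using hb _
  have hsec : ‖∫ z in (Metric.ball (0:ℂ) ε)ᶜ, (h z : ℂ) * foE l z‖ ≤ (volume (Metric.closedBall (0:ℂ) (2*R))).toReal * Real.exp (-(c*l)) := by
    have e : ∫ z in (Metric.ball (0:ℂ) ε)ᶜ, (h z : ℂ) * foE l z = ∫ z in (Metric.ball (0:ℂ) ε)ᶜ ∩ Metric.closedBall (0:ℂ) (2*R), (h z : ℂ) * foE l z := by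
      apply setIntegral_eq_of_subset_of_forall_sdiff_eq_zero Metric.isOpen_ball.measurableSet.compl inter_subset_left
      rintro z ⟨hz1, hz2⟩
      have : h z = 0 := by
        by_contra hne
        exact hz2 ⟨hz1, mem_closedBall_zero_iff.2 (hsupp z hne)⟩
      rw [this]; simp
    rw [e]
    have hfin : volume (Metric.closedBall (0:ℂ) (2*R)) < ⊤ := measure_closedBall_lt_top
    have hfin' : volume ((Metric.ball (0:ℂ) ε)ᶜ ∩ Metric.closedBall (0:ℂ) (2*R)) < ⊤ := (measure_mono inter_subset_right).trans_lt hfin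
    refine (norm_setIntegral_le_of_norm_le_const (C := Real.exp (-(c*l))) hfin' ?_).trans ?_
    · rintro z ⟨hz1, hz2⟩
      by_cases hz : h z = 0
      · rw [hz]; simp; positivity
      · have h3 := hs z hz
        simp only [mem_compl_iff, mem_ball_zero_iff, not_lt] at hz1
        rw [norm_mul, foE_norm]
        have h4 : ‖(h z : ℂ)‖ ≤ 1 := by simpa using hb z
        have h5 : ε^2/(2*R) ≤ z.re := by
          rw [div_le_iff₀ (by positivity)]
          nlinarith
        calc _ ≤ 1 * Real.exp (-(c*l)) := by
              refine mul_le_mul h4 (Real.exp_le_exp.2 (neg_le_neg ?_)) (Real.exp_pos _).le zero_le_one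
              calc c * l = (3/4 * l) * (ε^2/(4*R)) := by rw [hcdef]; ring
                _ ≤ (l - 1/(4*l)) * z.re := by
                  apply mul_le_mul hlm _ (by positivity) (by linarith)
                  refine le_trans ?_ h5
                  gcongr; norm_num
          _ = _ := one_mul _
    · rw [mul_comm, Measure.real]
      gcongr
      · exact hfin.ne
      · exact inter_subset_right
  have hsplit := integral_add_compl (Metric.isOpen_ball (x := (0:ℂ)) (ε := ε)).measurableSet hint
  rw [hI l hl, fo_first h hm hb R ε hR hε hs hc l hl] at hsplit
  have hin : ∀ x : ℝ, (k x : ℂ) * ∫ r in (0:ℝ)..ε, (r:ℂ) * Complex.exp (-((l * foD μ x) * r)) = (1/(l:ℂ)^2) * ((k x : ℂ) * (1 / foD μ x^2)) - (k x : ℂ) * (Complex.exp (-((l * foD μ x)*ε)) * (ε/(l * foD μ x) + 1/(l * foD μ x)^2)) := by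
    intro x
    rw [fo_inner _ (mul_ne_zero hlc (hDne x))]
    have := hDne x
    field_simp
  have hcint : ∀ g : ℝ → ℂ, Continuous g → IntervalIntegrable (fun x => (k x : ℂ) * g x) volume (-(Real.pi/2)) (Real.pi/2) := by
    intro g hg
    have h1 : IntervalIntegrable g volume (-(Real.pi/2)) (Real.pi/2) := hg.intervalIntegrable _ _
    rw [intervalIntegrable_iff_integrableOn_Ioc_of_le hab] at h1 ⊢
    refine h1.bdd_mul (c := 1) (by fun_prop) (ae_of_all _ fun x => ?_)
    simpa using hb _
  have hDc := foD_cont μ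
  have e1 : ∫ x in (-(Real.pi/2))..(Real.pi/2), (k x : ℂ) * ∫ r in (0:ℝ)..ε, (r:ℂ) * Complex.exp (-((l * foD μ x) * r)) = (1/(l:ℂ)^2) * (∫ x in (-(Real.pi/2))..(Real.pi/2), (k x : ℂ) * (1 / foD μ x^2)) - ∫ x in (-(Real.pi/2))..(Real.pi/2), (k x : ℂ) * (Complex.exp (-((l * foD μ x)*ε)) * (ε/(l * foD μ x) + 1/(l * foD μ x)^2)) := by
    simp only [hin]
    rw [intervalIntegral.integral_sub, intervalIntegral.integral_const_mul]
    · apply IntervalIntegrable.const_mul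
      apply hcint
      exact continuous_const.div (hDc.pow 2) (fun x => pow_ne_zero _ (hDne x))
    · apply hcint
      have hne : ∀ x, (l:ℂ) * foD μ x ≠ 0 := fun x => mul_ne_zero hlc (hDne x)
      refine Continuous.mul (by fun_prop) (Continuous.add ?_ ?_)
      · exact continuous_const.div (by fun_prop) hne
      · exact continuous_const.div (by fun_prop) (fun x => pow_ne_zero _ (hne x))
  have hrem : ‖∫ x in (-(Real.pi/2))..(Real.pi/2), (k x : ℂ) * (Complex.exp (-((l * foD μ x)*ε)) * (ε/(l * foD μ x) + 1/(l * foD μ x)^2))‖ ≤ Real.exp (-(c*l)) * (2*ε+4) * Real.pi := by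
    refine (intervalIntegral.norm_integral_le_of_norm_le_const (C := Real.exp (-(c*l)) * (2*ε+4)) ?_).trans ?_
    · intro x _
      by_cases hx : k x = 0
      · rw [hx]; simp; positivity
      · have h3 := hks x hx
        have h4 : ‖(k x : ℂ)‖ ≤ 1 := by simpa using hb _
        have h5 : ‖Complex.exp (-((l * foD μ x)*ε))‖ ≤ Real.exp (-(c*l)) := by
          rw [Complex.norm_exp]
          apply Real.exp_le_exp.2
          rw [Complex.neg_re, Complex.re_mul_ofReal, Complex.re_ofReal_mul, foD_re]
          apply neg_le_neg
          calc c * l = l * (3/4 * (ε/(4*R))) * ε := by rw [hcdef]; ring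
            _ ≤ _ := by gcongr; all_goals linarith
        have hn : 1/2 ≤ ‖(l:ℂ) * foD μ x‖ := by
          rw [norm_mul, Complex.norm_real, Real.norm_eq_abs, abs_of_pos hl0]
          nlinarith [hDn x]
        have h6 : ‖ε/(l * foD μ x) + 1/(l * foD μ x)^2‖ ≤ 2*ε+4 := by
          refine (norm_add_le _ _).trans ?_
          rw [norm_div, norm_div, norm_pow, norm_one, Complex.norm_real, Real.norm_eq_abs, abs_of_pos hε]
          apply add_le_add
          · rw [div_le_iff₀ (by linarith)]; nlinarith
          · rw [div_le_iff₀ (by nlinarith)]; nlinarith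
        rw [norm_mul, norm_mul]
        calc _ ≤ 1 * (Real.exp (-(c*l)) * (2*ε+4)) := by gcongr
          _ = _ := one_mul _
    · rw [show Real.pi/2 - -(Real.pi/2) = Real.pi by ring, abs_of_pos hpi]
  have e2 : ∫ x in (-(Real.pi/2))..(Real.pi/2), (k x : ℂ) * (1 / foD μ x^2) = (l:ℂ)^2 * ((∫ x in (-(Real.pi/2))..(Real.pi/2), (k x : ℂ) * (Complex.exp (-((l * foD μ x)*ε)) * (ε/(l * foD μ x) + 1/(l * foD μ x)^2))) - ∫ z in (Metric.ball (0:ℂ) ε)ᶜ, (h z : ℂ) * foE l z) := by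
    rw [e1] at hsplit
    have h7 : (l:ℂ)^2 * (1/(l:ℂ)^2) = 1 := by field_simp
    linear_combination (l:ℂ)^2 * hsplit - (∫ x in (-(Real.pi/2))..(Real.pi/2), (k x : ℂ) * (1 / foD μ x^2)) * h7
  rw [e2, norm_mul, norm_pow, Complex.norm_real, Real.norm_eq_abs, abs_of_pos hl0]
  calc _ ≤ l^2 * (Real.exp (-(c*l)) * (2*ε+4) * Real.pi + (volume (Metric.closedBall (0:ℂ) (2*R))).toReal * Real.exp (-(c*l))) := by
        gcongr
        exact (norm_sub_le _ _).trans (add_le_add hrem hsec)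
    _ = _ := by ring

lemma fo_core (h : ℂ → ℝ) (hm : Measurable h) (hb : ∀ z, |h z| ≤ 1) (R ε : ℝ) (hR : 0 < R) (hε : 0 < ε)
    (hs : ∀ z, h z ≠ 0 → ‖z‖^2 ≤ 2 * R * z.re)
    (hc : ∀ z, ∀ t : ℝ, ‖z‖ < ε → 0 < t → ‖(t:ℂ) * z‖ < ε → h (t * z) = h z)
    (hI : ∀ l : ℝ, 1 ≤ l → ∫ z, (h z : ℂ) * foE l z = 0)
    (ho : IsOpen {z | h z ≠ 0}) :
    ∀ z, z ≠ 0 → ‖z‖ < ε → h z = 0 := by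
  have hpi := Real.pi_pos
  obtain ⟨C, c, hc0, hbd⟩ := fo_pieceC h hm hb R ε hR hε hs hc hI
  set k : ℝ → ℝ := fun x => h ((ε/2 : ℝ) * Complex.exp (x * Complex.I)) with hk
  have hcm : Continuous (fun x : ℝ => ((ε/2 : ℝ) : ℂ) * Complex.exp (x * Complex.I)) := by fun_prop
  have hkm : Measurable k := hm.comp hcm.measurable
  have hks : ∀ x, k x ≠ 0 → ε / (4*R) ≤ Real.cos x := by
    intro x hx
    have := hs _ hx
    rw [norm_mul, Complex.norm_exp_ofReal_mul_I, Complex.re_ofReal_mul, Complex.exp_ofReal_mul_I_re] at this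
    simp only [Complex.norm_real, Real.norm_eq_abs, mul_one, sq_abs] at this
    rw [div_le_iff₀ (by positivity)]
    by_contra hcon
    push Not at hcon
    nlinarith
  have hmom := fo_pieceB k hkm (fun x => hb _) (by
    intro N
    have ht : Tendsto (fun l : ℝ => C * (l^(N+2) * Real.exp (-(c*l)))) atTop (𝓝 (C * 0)) := by
      apply Tendsto.const_mul
      have h1 := (Real.tendsto_pow_mul_exp_neg_atTop_nhds_zero (N+2)).comp (tendsto_id.const_mul_atTop hc0)
      have h2 := h1.const_mul ((c^(N+2))⁻¹)
      rw [mul_zero] at h2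
      refine h2.congr fun l => ?_
      simp only [Function.comp_apply, id, mul_pow]
      field_simp
    rw [mul_zero] at ht
    refine squeeze_zero' ?_ ?_ ht
    · filter_upwards [eventually_ge_atTop 0] with l hl
      positivity
    · filter_upwards [eventually_ge_atTop 1] with l hl
      calc _ ≤ l^N * (C * (l^2 * Real.exp (-(c * l)))) := by
            gcongr
            exact hbd l hl
        _ = _ := by ring)
  have hA := fo_pieceA k hkm (fun x => hb _) hmom (min (ε/(4*R)) 1) (by positivity)
    (lt_of_le_of_lt (min_le_right _ _) (by linarith [Real.pi_gt_three])) (by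
      intro x hx1 hx2
      by_contra hne
      have h1 := hks x hne
      have h2 : Real.cos x ≤ Real.pi/2 - x := by
        rw [← Real.sin_pi_div_two_sub]
        exact Real.sin_le (by linarith)
      have := min_le_left (ε/(4*R)) 1
      linarith)
  intro z hz hzε
  by_contra hne
  have hre : 0 < z.re := by
    have h1 := hs z hne
    have h2 : 0 < ‖z‖^2 := by have := norm_pos_iff.2 hz; positivity
    by_contra hcon
    push Not at hcon
    nlinarith
  have harg : |z.arg| < Real.pi/2 := Complex.abs_arg_lt_pi_div_two_iff.2 (Or.inl hre)
  have hn := norm_pos_iff.2 hz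
  have hkz : k z.arg ≠ 0 := by
    have e : ((ε/2 : ℝ) : ℂ) * Complex.exp (z.arg * Complex.I) = ((ε/2/‖z‖ : ℝ) : ℂ) * z := by
      conv_rhs => rw [← Complex.norm_mul_exp_arg_mul_I z]
      have : ((‖z‖:ℝ):ℂ) ≠ 0 := by exact_mod_cast hn.ne'
      simp only [norm_mul, Complex.norm_real, Complex.norm_exp_ofReal_mul_I, norm_norm, mul_one]
      push_cast
      field_simp
    rw [hk]
    simp only
    rw [e, hc z _ hzε (by positivity)]
    · exact hne
    · rw [← e, norm_mul, Complex.norm_exp_ofReal_mul_I]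
      simp [abs_of_pos hε]; linarith
  have hop : IsOpen ({x | k x ≠ 0} ∩ Ioo (-(Real.pi/2)) (Real.pi/2)) := (ho.preimage hcm).inter isOpen_Ioo
  have hpos := hop.measure_pos volume ⟨z.arg, hkz, abs_lt.1 harg⟩
  have : volume ({x | k x ≠ 0} ∩ Ioo (-(Real.pi/2)) (Real.pi/2)) = 0 := by
    refine measure_mono_null ?_ hA
    rintro x ⟨hx1, hx2⟩
    simp only [mem_compl_iff, mem_ofPred_eq, not_forall]
    exact ⟨⟨hx2.1, hx2.2.le⟩, hx1⟩
  exact hpos.ne' this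

lemma fo_main (f : ℂ → ℝ) (hm : Measurable f) (hb : ∀ z, |f z| ≤ 1) (B : ℝ) (hB : ∀ z, f z ≠ 0 → ‖z‖ ≤ B)
    (ho : IsOpen {z | f z ≠ 0})
    (hc : ∀ v : ℂ, ∃ ε > 0, ∀ y : ℂ, ∀ t : ℝ, ‖y‖ < ε → 0 < t → ‖(t:ℂ) * y‖ < ε → f (v + t * y) = f (v + y))
    (hI : ∀ w : ℂ, w ≠ 0 → ∫ z, (f z : ℂ) * Complex.exp (-Complex.I * (w * (starRingEnd ℂ) z + z / w) / 2) = 0) :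
    ∀ z, f z = 0 := by
  by_contra hcon
  push Not at hcon
  obtain ⟨z0, hz0⟩ := hcon
  set S : Set ℂ := {z | f z ≠ 0} with hS
  have hSB : S ⊆ Metric.closedBall 0 B := fun z hz => mem_closedBall_zero_iff.2 (hB z hz)
  have hcomp : IsCompact (closure S) := (isCompact_closedBall (0:ℂ) B).of_isClosed_subset isClosed_closure
    (closure_minimal hSB Metric.isClosed_closedBall)
  obtain ⟨v, hv, hvmax⟩ := hcomp.exists_isMaxOn ⟨z0, subset_closure hz0⟩ continuous_norm.continuousOn
  set R := ‖v‖ with hRdef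
  have hmax : ∀ z, f z ≠ 0 → ‖z‖ ≤ R := fun z hz => hvmax (subset_closure (show z ∈ S from hz))
  have hR : 0 < R := by
    rcases (norm_nonneg v).lt_or_eq with h | h
    · exact h
    · exfalso
      have hsub : S ⊆ {0} := by
        intro z hz
        have := hmax z hz
        rw [hRdef, ← h] at this
        simpa using this
      have h1 := interior_maximal hsub ho
      rw [interior_singleton] at h1
      exact h1 hz0
  have hRc : (R:ℂ) ≠ 0 := by exact_mod_cast hR.ne'
  set e : ℂ := v / R with he
  have hen : ‖e‖ = 1 := by
    rw [he, norm_div, Complex.norm_real, norm_norm, div_self hR.ne']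
  have hve : v = e * R := by rw [he]; field_simp
  have hee : e * (starRingEnd ℂ) e = 1 := by
    rw [Complex.mul_conj, Complex.normSq_eq_norm_sq, hen]; simp
  have he0 : e ≠ 0 := by intro h; rw [h] at hen; simp at hen
  obtain ⟨ε, hε, hcone⟩ := hc v
  set h : ℂ → ℝ := fun z => f (v - e * z) with hh
  have hcts : Continuous (fun z : ℂ => v - e * z) := by fun_prop
  have hzero := fo_core h (hm.comp hcts.measurable) (fun z => hb _) R ε hR hε ?_ ?_ ?_ (ho.preimage hcts)
  · -- contradiction
    obtain ⟨y, hy1, hy2⟩ := Metric.mem_closure_iff.1 hv ε hε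
    have hop : IsOpen (S ∩ Metric.ball v ε) := ho.inter Metric.isOpen_ball
    have hnz : ∃ x ∈ S ∩ Metric.ball v ε, x ≠ v := by
      by_contra hcon
      push Not at hcon
      have h1 := interior_maximal (show S ∩ Metric.ball v ε ⊆ {v} from hcon) hop
      rw [interior_singleton] at h1
      exact h1 ⟨hy1, by rwa [Metric.mem_ball, dist_comm]⟩
    obtain ⟨x, ⟨hx1, hx2⟩, hx3⟩ := hnz
    have h2 := hzero ((v - x)/e) (div_ne_zero (sub_ne_zero.2 hx3.symm) he0) (by
      rw [norm_div, hen, div_one, ← dist_eq_norm, dist_comm]; exact hx2)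
    simp only [hh] at h2
    rw [mul_div_cancel₀ _ he0, sub_sub_cancel] at h2
    exact hx1 h2
  · intro z hz
    have h1 := hmax _ hz
    rw [hve, ← mul_sub, norm_mul, hen, one_mul] at h1
    have h2 : ‖(R:ℂ) - z‖^2 ≤ R^2 := by gcongr
    rw [← Complex.normSq_eq_norm_sq, Complex.normSq_apply] at h2
    rw [← Complex.normSq_eq_norm_sq, Complex.normSq_apply]
    simp at h2
    nlinarith
  · intro z t hz ht htz
    have := hcone (-(e*z)) t (by rw [norm_neg, norm_mul, hen, one_mul]; exact hz) ht (by
      rw [mul_neg, norm_neg, mul_left_comm, norm_mul, hen, one_mul]; exact htz)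
    simp only [hh]
    rw [sub_eq_add_neg, sub_eq_add_neg, ← this]
    congr 1; ring
  · intro l hl
    have hl0 : (l:ℂ) ≠ 0 := by
      have : l ≠ 0 := by linarith
      exact_mod_cast this
    set w : ℂ := 2 * Complex.I * l * e with hw
    have hw0 : w ≠ 0 := by
      rw [hw]; simp [hl0, he0]
    set g : ℂ → ℂ := fun z => (f z : ℂ) * Complex.exp (-Complex.I * (w * (starRingEnd ℂ) z + z / w) / 2) with hg
    have e1 : ∀ z, (h z : ℂ) * foE l z = Complex.exp (-(l*R) + R/(4*l)) * g (v - e * z) := by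
      intro z
      simp only [hh, hg, foE]
      rw [mul_left_comm, ← Complex.exp_add]
      congr 2
      have a1 : w * (starRingEnd ℂ) (v - e * z) = 2 * Complex.I * l * (R - (starRingEnd ℂ) z) := by
        rw [hw, hve, map_sub, map_mul, map_mul, Complex.conj_ofReal]
        linear_combination (2 * Complex.I * l * (R - (starRingEnd ℂ) z)) * hee
      have a2 : (v - e * z) / w = -Complex.I * (R - z) / (2 * l) := by
        rw [hw, hve]
        field_simp
        rw [Complex.I_sq]; ring
      rw [a1, a2]
      field_simp
      ring_nf
      simp only [Complex.I_sq]
      ring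
    simp only [e1]
    rw [integral_const_mul]
    have e2 : ∫ z, g (v - e * z) = ∫ z, g z := by
      have hmp := (rotation (⟨e, by simp [Submonoid.unitSphere, hen]⟩ : Circle)).measurePreserving
      have h3 : ∫ z, g (v - e * z) = ∫ z, g (v - z) := hmp.integral_comp (rotation (⟨e, by simp [Submonoid.unitSphere, hen]⟩ : Circle)).toHomeomorph.measurableEmbedding (fun z => g (v - z))
      rw [integral_sub_left_eq_self g volume v] at h3
      exact h3
    rw [e2, hI w hw0, mul_zero]

lemma fo_cont (f : ℂ → ℝ) (hm : Measurable f) (hb : ∀ z, |f z| ≤ 1) (B : ℝ) (hB : ∀ z, f z ≠ 0 → ‖z‖ ≤ B)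
    (a b : ℝ) (hab : a < b)
    (h : ∀ t ∈ Ioo a b, ∫ z : ℂ, (f z : ℂ) * Complex.exp (-Complex.I * (((1 - t^2)/(1+t^2) * z.re + 2*t/(1+t^2) * z.im : ℝ) : ℂ)) = 0) :
    ∀ w : ℂ, w ≠ 0 → ∫ z, (f z : ℂ) * Complex.exp (-Complex.I * (w * (starRingEnd ℂ) z + z / w) / 2) = 0 := by
  set E : ℂ → ℂ → ℂ := fun x z => Complex.exp (-Complex.I * (z.re * Complex.cos x + z.im * Complex.sin x)) with hE
  set E' : ℂ → ℂ → ℂ := fun x z => Complex.exp (-Complex.I * (z.re * Complex.cos x + z.im * Complex.sin x)) * (-Complex.I * (z.re * (-Complex.sin x) + z.im * Complex.cos x)) with hE'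
  set Ψ : ℂ → ℂ := fun x => ∫ z, (f z : ℂ) * E x z with hΨ
  have hint : ∀ g : ℂ → ℂ, Continuous g → Integrable (fun z => (f z : ℂ) * g z) := by
    intro g hg
    have : (fun z => (f z : ℂ) * g z) = (Metric.closedBall (0:ℂ) B).indicator (fun z => (f z : ℂ) * g z) := by
      ext z
      by_cases hz : z ∈ Metric.closedBall (0:ℂ) B
      · rw [indicator_of_mem hz]
      · rw [indicator_of_notMem hz]
        have : f z = 0 := by
          by_contra hne
          exact hz (mem_closedBall_zero_iff.2 (hB z hne))
        rw [this]; simp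
    rw [this, integrable_indicator_iff Metric.isClosed_closedBall.measurableSet]
    have hi : IntegrableOn g (Metric.closedBall (0:ℂ) B) :=
      hg.continuousOn.integrableOn_compact (isCompact_closedBall _ _)
    refine Integrable.bdd_mul (c := 1) hi (by fun_prop) (ae_of_all _ fun x => ?_)
    simpa using hb _
  have hEc : ∀ x, Continuous (E x) := by
    intro x; rw [hE]; fun_prop
  have hE'c : Continuous (fun p : ℂ × ℂ => E' p.1 p.2) := by
    rw [hE']; fun_prop
  have hdiff : Differentiable ℂ Ψ := by
    intro x0
    obtain ⟨M, hM⟩ := ((isCompact_closedBall x0 1).prod (isCompact_closedBall (0:ℂ) B)).exists_bound_of_continuousOn hE'c.continuousOn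
    have := hasDerivAt_integral_of_dominated_loc_of_deriv_le (μ := (volume : Measure ℂ)) (F := fun x z => (f z : ℂ) * E x z) (F' := fun x z => (f z : ℂ) * E' x z) (x₀ := x0) (s := Metric.closedBall x0 1) (bound := (Metric.closedBall (0:ℂ) B).indicator (fun _ => M))
      (Metric.closedBall_mem_nhds _ one_pos) (Eventually.of_forall fun x => (hint _ (hEc x)).aestronglyMeasurable) (hint _ (hEc x0))
      (hint _ (hE'c.comp (by fun_prop : Continuous fun z : ℂ => (x0, z)))).aestronglyMeasurable ?_ ?_ ?_
    · exact this.2.differentiableAt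
    · refine ae_of_all _ fun z x hx => ?_
      by_cases hz : z ∈ Metric.closedBall (0:ℂ) B
      · rw [indicator_of_mem hz, norm_mul]
        calc _ ≤ 1 * ‖E' x z‖ := by gcongr; simpa using hb z
          _ ≤ M := by rw [one_mul]; exact hM (x, z) ⟨hx, hz⟩
      · rw [indicator_of_notMem hz]
        have : f z = 0 := by
          by_contra hne
          exact hz (mem_closedBall_zero_iff.2 (hB z hne))
        rw [this]; simp
    · rw [integrable_indicator_iff Metric.isClosed_closedBall.measurableSet]
      exact integrableOn_const measure_closedBall_lt_top.ne
    · refine ae_of_all _ fun z x _ => ?_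
      apply HasDerivAt.const_mul
      have h1 := (((Complex.hasDerivAt_cos x).const_mul (z.re : ℂ)).add ((Complex.hasDerivAt_sin x).const_mul (z.im : ℂ))).const_mul (-Complex.I)
      exact h1.cexp
  have hreal : ∀ t0 ∈ Ioo a b, ∀ᶠ θ : ℝ in 𝓝 (2 * Real.arctan t0), Ψ θ = 0 := by
    intro t0 ht0
    have hcos : Real.cos ((2 * Real.arctan t0)/2) ≠ 0 := by
      rw [mul_div_cancel_left₀ _ two_ne_zero]; exact (Real.cos_arctan_pos t0).ne'
    have hct : ContinuousAt (fun θ : ℝ => Real.tan (θ/2)) (2 * Real.arctan t0) := by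
      have : ContinuousAt Real.tan ((2 * Real.arctan t0)/2) := Real.continuousAt_tan.2 hcos
      exact ContinuousAt.comp (f := fun θ : ℝ => θ/2) this (by fun_prop)
    have hcc : ContinuousAt (fun θ : ℝ => Real.cos (θ/2)) (2 * Real.arctan t0) := by fun_prop
    have e1 : ∀ᶠ θ : ℝ in 𝓝 (2 * Real.arctan t0), Real.tan (θ/2) ∈ Ioo a b := by
      apply hct.eventually_mem
      rw [mul_div_cancel_left₀ _ two_ne_zero, Real.tan_arctan]
      exact Ioo_mem_nhds ht0.1 ht0.2
    have e2 := hcc.eventually_ne hcos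
    filter_upwards [e1, e2] with θ h1 h2
    rw [← h _ h1]
    simp only [hΨ, hE]
    congr 1
    ext z
    congr 3
    have hs : Real.sin (θ/2) ^ 2 + Real.cos (θ/2)^2 = 1 := Real.sin_sq_add_cos_sq _
    have c2 : Real.cos θ = Real.cos (θ/2)^2 - Real.sin (θ/2)^2 := by
      have := Real.cos_two_mul' (θ/2)
      rwa [mul_div_cancel₀ _ two_ne_zero] at this
    have s2 : Real.sin θ = 2 * Real.sin (θ/2) * Real.cos (θ/2) := by
      have := Real.sin_two_mul (θ/2)
      rwa [mul_div_cancel₀ _ two_ne_zero] at this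
    have ht : 1 + Real.tan (θ/2)^2 = 1 / Real.cos (θ/2)^2 := by
      rw [Real.tan_eq_sin_div_cos]; field_simp; linarith
    have c3 : (1 - Real.tan (θ/2)^2)/(1 + Real.tan (θ/2)^2) = Real.cos θ := by
      rw [ht, c2, Real.tan_eq_sin_div_cos]; field_simp
    have s3 : 2 * Real.tan (θ/2)/(1 + Real.tan (θ/2)^2) = Real.sin θ := by
      rw [ht, s2, Real.tan_eq_sin_div_cos]; field_simp
    rw [c3, s3]
    push_cast; ring
  have hzero : ∀ x, Ψ x = 0 := by
    have hA : AnalyticOnNhd ℂ Ψ univ := fun x _ => hdiff.analyticAt x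
    have ht0 : (a+b)/2 ∈ Ioo a b := ⟨by linarith, by linarith⟩
    set θ0 : ℝ := 2 * Real.arctan ((a+b)/2) with hθ0
    have hfreq : ∃ᶠ z in 𝓝[≠] (θ0 : ℂ), Ψ z = 0 := by
      have htend : Tendsto (fun θ : ℝ => (θ:ℂ)) (𝓝[≠] θ0) (𝓝[≠] (θ0:ℂ)) := by
        apply tendsto_nhdsWithin_of_tendsto_nhds_of_eventually_within
        · exact (Complex.continuous_ofReal.tendsto θ0).mono_left nhdsWithin_le_nhds
        · filter_upwards [self_mem_nhdsWithin] with θ hθ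
          simpa using hθ
      apply htend.frequently
      exact ((hreal _ ht0).filter_mono nhdsWithin_le_nhds).frequently
    intro x
    exact hA.eqOn_zero_of_preconnected_of_frequently_eq_zero isPreconnected_univ (mem_univ (θ0:ℂ)) hfreq (mem_univ x)
  intro w hw
  rw [← hzero (-Complex.I * Complex.log w)]
  simp only [hΨ, hE]
  congr 1
  ext z
  congr 2
  have hx1 : Complex.exp ((-Complex.I * Complex.log w) * Complex.I) = w := by
    rw [show (-Complex.I * Complex.log w) * Complex.I = Complex.log w by linear_combination (-Complex.log w) * Complex.I_mul_I]
    exact Complex.exp_log hw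
  have hx2 : Complex.exp (-(-Complex.I * Complex.log w) * Complex.I) = w⁻¹ := by
    rw [neg_mul, Complex.exp_neg, hx1]
  rw [Complex.cos, Complex.sin, hx1, hx2]
  have hzz : z = z.re + z.im * Complex.I := (Complex.re_add_im z).symm
  have hzc : (starRingEnd ℂ) z = z.re - z.im * Complex.I := by
    apply Complex.ext <;> simp
  rw [hzc, show z / w = ((z.re:ℂ) + z.im * Complex.I) / w by rw [← hzz]]
  field_simp
  ring_nf
  try simp only [Complex.I_sq]
  try ring

theorem fo_geo1 {V : Set ℂ} {x : ℂ} (hx : x ∈ convexHull ℝ V)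
    (hxi : x ∉ interior (convexHull ℝ V)) : ∃ p ∈ V, ∃ q ∈ V, x ∈ affineSpan ℝ {p, q} := by
  obtain ⟨ι, _, z, w, hz, hai, hw, hw1, hwx⟩ := eq_pos_convex_span_of_mem_convexHull hx
  have hcomb : Finset.univ.affineCombination ℝ z w = x := by
    rw [Finset.affineCombination_eq_linear_combination _ _ _ hw1, hwx]
  have hxs : x ∈ affineSpan ℝ (range z) := by
    rw [← hcomb]; exact affineCombination_mem_affineSpan hw1 z
  have hcard : Fintype.card ι ≤ 2 := by
    by_contra hc
    have h3 : Fintype.card ι = Module.finrank ℝ ℂ + 1 := by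
      have h1 := hai.card_le_finrank_succ
      have h2 := Submodule.finrank_le (vectorSpan ℝ (range z))
      rw [Complex.finrank_real_complex] at *
      omega
    have htop := hai.affineSpan_eq_top_iff_card_eq_finrank_add_one.2 h3
    let b : AffineBasis ι ℝ ℂ := ⟨z, hai, htop⟩
    apply hxi
    apply interior_mono (convexHull_mono hz)
    have hb := b.interior_convexHull
    change interior (convexHull ℝ (range z)) = _ at hb
    rw [hb]
    intro i
    have := b.coord_apply_combination_of_mem (Finset.mem_univ i) hw1
    change b.coord i (Finset.univ.affineCombination ℝ z w) = w i at this
    rw [hcomb] at this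
    rw [this]; exact hw i
  have hne : Nonempty ι := by
    by_contra h
    rw [not_nonempty_iff] at h
    simp at hw1
  obtain ⟨i0⟩ := hne
  have : ∃ i j : ι, ∀ k, k = i ∨ k = j := by
    by_contra h
    push Not at h
    obtain ⟨j, hj, -⟩ := h i0 i0
    obtain ⟨k, hk, hk'⟩ := h i0 j
    have : 2 < Fintype.card ι := Fintype.two_lt_card_iff.2 ⟨i0, j, k, hj.symm, hk.symm, hk'.symm⟩
    omega
  obtain ⟨i, j, hij⟩ := this
  refine ⟨z i, hz ⟨i, rfl⟩, z j, hz ⟨j, rfl⟩, affineSpan_mono ℝ ?_ hxs⟩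
  rintro _ ⟨k, rfl⟩
  rcases hij k with rfl | rfl <;> simp

theorem fo_line_ne_top (p q : ℂ) : affineSpan ℝ {p, q} ≠ ⊤ := by
  intro h
  have h1 := (collinear_pair ℝ p q).finrank_le_one
  rw [← direction_affineSpan, h, AffineSubspace.direction_top, finrank_top,
    Complex.finrank_real_complex] at h1
  omega

def foG (P : Set ℂ) : Prop :=
  IsCompact P ∧ P ⊆ closure (interior P) ∧ ∃ L : Set (AffineSubspace ℝ ℂ), L.Finite ∧
    (∀ l ∈ L, l ≠ ⊤) ∧ ∀ x ∈ frontier P, ∃ l ∈ L, x ∈ l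

theorem foG_hull {V : Set ℂ} (hV : V.Finite) (hi : (interior (convexHull ℝ V)).Nonempty) :
    foG (convexHull ℝ V) := by
  have hc := hV.isCompact_convexHull ℝ
  refine ⟨hc, ?_, Set.image2 (fun p q => affineSpan ℝ {p, q}) V V, hV.image2 _ hV, ?_, ?_⟩
  · rw [(convex_convexHull ℝ V).closure_interior_eq_closure_of_nonempty_interior hi]
    exact subset_closure
  · rintro _ ⟨p, _, q, _, rfl⟩
    exact fo_line_ne_top p q
  · intro x hx
    rw [hc.isClosed.frontier_eq] at hx
    obtain ⟨p, hp, q, hq, h⟩ := fo_geo1 hx.1 hx.2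
    exact ⟨_, ⟨p, hp, q, hq, rfl⟩, h⟩

theorem foG_union {m : ℕ} {Q : Fin m → Set ℂ} (h : ∀ i, foG (Q i)) : foG (⋃ i, Q i) := by
  choose hc hi L hL hLt hLf using h
  have hcc : IsCompact (⋃ i, Q i) := isCompact_iUnion hc
  refine ⟨hcc, ?_, ⋃ i, L i, Set.finite_iUnion hL, ?_, ?_⟩
  · exact iUnion_subset fun i => (hi i).trans
      (closure_mono (interior_mono (subset_iUnion Q i)))
  · intro l hl
    obtain ⟨i, hl⟩ := mem_iUnion.1 hl
    exact hLt i l hl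
  · intro x hx
    rw [hcc.isClosed.frontier_eq] at hx
    obtain ⟨i, hxi⟩ := mem_iUnion.1 hx.1
    obtain ⟨l, hl, hxl⟩ := hLf i x (by
      rw [(hc i).isClosed.frontier_eq]
      exact ⟨hxi, fun h => hx.2 (interior_mono (subset_iUnion Q i) h)⟩)
    exact ⟨l, mem_iUnion.2 ⟨i, hl⟩, hxl⟩

theorem fo_precon {s t : Set ℂ} (hs : IsPreconnected s) (ht : IsClosed t)
    (hd : ∀ x ∈ s, x ∉ frontier t) {x y : ℂ} (hx : x ∈ s) (hy : y ∈ s) (hxt : x ∈ t) : y ∈ t := by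
  have := IsPreconnected.subset_or_subset (s := s) (u := interior t) (v := tᶜ) isOpen_interior
    ht.isOpen_compl (disjoint_compl_right.mono_left interior_subset) (by
      intro z hz
      by_cases hzt : z ∈ t
      · left
        by_contra h
        exact hd z hz (by rw [ht.frontier_eq]; exact ⟨hzt, h⟩)
      · right; exact hzt) hs
  rcases this with h | h
  · exact interior_subset (h hy)
  · exact absurd hxt (h hx)

theorem fo_ball (L : Set (AffineSubspace ℝ ℂ)) (hL : L.Finite) (v : ℂ) :
    ∃ ε > 0, ∀ l ∈ L, ∀ x, ‖x - v‖ < ε → x ∈ l → v ∈ l := by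
  have hcl : IsClosed (⋃ l ∈ {l ∈ L | v ∉ l}, (l : Set ℂ)) :=
    (hL.subset (Set.sep_subset _ _)).isClosed_biUnion
      fun l _ => AffineSubspace.closed_of_finiteDimensional l
  have hv : v ∉ ⋃ l ∈ {l ∈ L | v ∉ l}, (l : Set ℂ) := by
    intro h
    simp only [mem_iUnion] at h
    obtain ⟨l, hl, hvl⟩ := h
    exact hl.2 hvl
  obtain ⟨ε, hε, hb⟩ := Metric.isOpen_iff.1 hcl.isOpen_compl v hv
  refine ⟨ε, hε, fun l hl x hx hxl => ?_⟩
  by_contra hvl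
  apply hb (show x ∈ Metric.ball v ε by rwa [mem_ball_iff_norm])
  simp only [mem_iUnion]
  exact ⟨l, ⟨hl, hvl⟩, hxl⟩

theorem fo_cone (L : Set (AffineSubspace ℝ ℂ)) (hL : L.Finite) (v : ℂ) :
    ∃ ε > 0, ∀ y : ℂ, ∀ t : ℝ, ‖y‖ < ε → 0 < t → ‖(t:ℂ) * y‖ < ε →
      ((∃ l ∈ L, v + t * y ∈ l) ↔ (∃ l ∈ L, v + y ∈ l)) ∧
      (∀ P : Set ℂ, IsClosed P → (∀ x ∈ frontier P, ∃ l ∈ L, x ∈ l) → (¬ ∃ l ∈ L, v + y ∈ l) →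
        (v + t * y ∈ P ↔ v + y ∈ P)) := by
  obtain ⟨ε, hε, hb⟩ := fo_ball L hL v
  have key : ∀ y : ℂ, ∀ t : ℝ, ‖y‖ < ε → (∃ l ∈ L, v + y ∈ l) → (∃ l ∈ L, v + t * y ∈ l) := by
    rintro y t hy ⟨l, hl, hyl⟩
    have hv := hb l hl _ (by simpa using hy) hyl
    have := AffineMap.lineMap_mem t hv hyl
    rw [AffineMap.lineMap_apply_module'] at this
    refine ⟨l, hl, ?_⟩
    convert this using 1
    simp [add_comm]
  have key2 : ∀ y : ℂ, ∀ t : ℝ, 0 < t → ‖(t:ℂ) * y‖ < ε → (∃ l ∈ L, v + t * y ∈ l) →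
      (∃ l ∈ L, v + y ∈ l) := by
    intro y t ht hy h
    have := key _ t⁻¹ hy h
    have ht' : (t:ℂ) ≠ 0 := by exact_mod_cast ht.ne'
    have h2 : ((t⁻¹ : ℝ) : ℂ) * (t * y) = y := by push_cast; field_simp
    rwa [h2] at this
  refine ⟨ε, hε, fun y t hy ht hty => ⟨⟨key2 y t ht hty, key y t hy⟩, ?_⟩⟩
  intro P hP hPf hn
  have hpre : IsPreconnected ((fun s : ℝ => v + (s:ℂ) * y) '' uIcc 1 t) :=
    (isPreconnected_uIcc).image _ (by fun_prop)
  have hd : ∀ x ∈ (fun s : ℝ => v + (s:ℂ) * y) '' uIcc 1 t, x ∉ frontier P := by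
    rintro _ ⟨s, hs, rfl⟩ hfr
    apply hn
    have hs0 : 0 < s := lt_of_lt_of_le (lt_min one_pos ht) hs.1
    refine key2 y s hs0 ?_ (hPf _ hfr)
    rw [norm_mul, Complex.norm_real, Real.norm_eq_abs] at *
    rw [abs_of_pos ht] at hty
    rw [abs_of_pos hs0]
    have h2 : s ≤ max 1 t := hs.2
    rcases le_max_iff.1 h2 with h3 | h3
    · nlinarith [norm_nonneg y]
    · nlinarith [norm_nonneg y]
  have m1 : v + y ∈ (fun s : ℝ => v + (s:ℂ) * y) '' uIcc 1 t := ⟨1, left_mem_uIcc, by simp⟩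
  have m2 : v + t * y ∈ (fun s : ℝ => v + (s:ℂ) * y) '' uIcc 1 t := ⟨t, right_mem_uIcc, by simp⟩
  exact ⟨fo_precon hpre hP hd m2 m1, fo_precon hpre hP hd m1 m2⟩

open Classical in
theorem fo_fin (P Q : Set ℂ) (h1 : foG P) (h2 : foG Q) (a b : ℝ) (hab : a < b)
    (heq : ∀ t ∈ Ioo a b,
      ∫ z in P, Complex.exp (-Complex.I * (((1 - t^2)/(1+t^2) * z.re + 2*t/(1+t^2) * z.im : ℝ) : ℂ))
      = ∫ z in Q, Complex.exp (-Complex.I * (((1 - t^2)/(1+t^2) * z.re + 2*t/(1+t^2) * z.im : ℝ) : ℂ))) :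
    P = Q := by
  obtain ⟨hPc, hPi, L1, hL1, hL1t, hL1f⟩ := h1
  obtain ⟨hQc, hQi, L2, hL2, hL2t, hL2f⟩ := h2
  set L := L1 ∪ L2 with hLdef
  have hL : L.Finite := hL1.union hL2
  have hLt : ∀ l ∈ L, l ≠ ⊤ := by
    rintro l (h | h)
    exacts [hL1t l h, hL2t l h]
  have hPf : ∀ x ∈ frontier P, ∃ l ∈ L, x ∈ l := fun x hx =>
    let ⟨l, hl, h⟩ := hL1f x hx; ⟨l, Or.inl hl, h⟩
  have hQf : ∀ x ∈ frontier Q, ∃ l ∈ L, x ∈ l := fun x hx =>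
    let ⟨l, hl, h⟩ := hL2f x hx; ⟨l, Or.inr hl, h⟩
  set Z : Set ℂ := ⋃ l ∈ L, (l : Set ℂ) with hZ
  have memZ : ∀ x, x ∈ Z ↔ ∃ l ∈ L, x ∈ l := by intro x; simp [hZ]
  have hZc : IsClosed Z := hL.isClosed_biUnion
      fun l _ => AffineSubspace.closed_of_finiteDimensional l
  have hZ0 : volume Z = 0 := by
    rw [hZ, measure_biUnion_null_iff hL.countable]
    exact fun l hl => Measure.addHaar_affineSubspace _ _ (hLt l hl)
  set f : ℂ → ℝ := fun z => if z ∈ Z then 0 else P.indicator 1 z - Q.indicator 1 z with hf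
  have hm : Measurable f := by
    apply Measurable.ite hZc.measurableSet measurable_const
    exact (measurable_one.indicator hPc.isClosed.measurableSet).sub
      (measurable_one.indicator hQc.isClosed.measurableSet)
  have hb : ∀ z, |f z| ≤ 1 := by
    intro z
    simp only [hf, indicator_apply, Pi.one_apply]
    split_ifs <;> simp
  obtain ⟨B, hB⟩ := (hPc.union hQc).isBounded.exists_norm_le
  have hB' : ∀ z, f z ≠ 0 → ‖z‖ ≤ B := by
    intro z hz
    apply hB
    by_contra hn
    rw [mem_union, not_or] at hn
    apply hz
    simp [hf, indicator_apply, hn.1, hn.2]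
  have hloc : ∀ S : Set ℂ, IsClosed S → (∀ x ∈ frontier S, ∃ l ∈ L, x ∈ l) → ∀ z ∉ Z,
      ∀ᶠ y in 𝓝 z, (y ∈ S ↔ z ∈ S) := by
    intro S hS hSf z hz
    by_cases hzS : z ∈ S
    · have : z ∈ interior S := by
        by_contra h
        exact hz ((memZ z).2 (hSf z (by rw [hS.frontier_eq]; exact ⟨hzS, h⟩)))
      filter_upwards [mem_interior_iff_mem_nhds.1 this] with y hy
      simp [hy, hzS]
    · filter_upwards [hS.isOpen_compl.mem_nhds hzS] with y hy
      simp only [mem_compl_iff] at hy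
      simp [hy, hzS]
  have ho : IsOpen {z | f z ≠ 0} := by
    rw [isOpen_iff_mem_nhds]
    intro z hz
    have hzZ : z ∉ Z := by
      intro h; apply hz; simp [hf, h]
    filter_upwards [hloc P hPc.isClosed hPf z hzZ, hloc Q hQc.isClosed hQf z hzZ,
      hZc.isOpen_compl.mem_nhds hzZ] with y h1 h2 h3
    have : f y = f z := by
      simp only [mem_compl_iff] at h3
      simp [hf, h3, hzZ, indicator_apply, h1, h2]
    change f y ≠ 0
    rw [this]; exact hz
  have hc : ∀ v : ℂ, ∃ ε > 0, ∀ y : ℂ, ∀ t : ℝ, ‖y‖ < ε → 0 < t → ‖(t:ℂ) * y‖ < ε →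
      f (v + t * y) = f (v + y) := by
    intro v
    obtain ⟨ε, hε, h⟩ := fo_cone L hL v
    refine ⟨ε, hε, fun y t hy ht hty => ?_⟩
    obtain ⟨ha, hb⟩ := h y t hy ht hty
    by_cases hz : v + y ∈ Z
    · have hz2 : v + t * y ∈ Z := (memZ _).2 (ha.2 ((memZ _).1 hz))
      simp only [hf]
      rw [if_pos hz, if_pos hz2]
    · have hz2 : v + t * y ∉ Z := fun h => hz ((memZ _).2 (ha.1 ((memZ _).1 h)))
      have hn : ¬ ∃ l ∈ L, v + y ∈ l := fun h => hz ((memZ _).2 h)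
      have e1 := hb P hPc.isClosed hPf hn
      have e2 := hb Q hQc.isClosed hQf hn
      simp only [hf]
      rw [if_neg hz, if_neg hz2]
      simp only [indicator_apply, e1, e2, Pi.one_apply]
  have hint : ∀ t ∈ Ioo a b, ∫ z : ℂ, (f z : ℂ) * Complex.exp (-Complex.I *
      (((1 - t^2)/(1+t^2) * z.re + 2*t/(1+t^2) * z.im : ℝ) : ℂ)) = 0 := by
    intro t ht
    have hE := heq t ht
    set g : ℂ → ℂ := fun z => Complex.exp (-Complex.I *
      (((1 - t^2)/(1+t^2) * z.re + 2*t/(1+t^2) * z.im : ℝ) : ℂ)) with hg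
    have hgc : Continuous g := by fun_prop
    have i1 : Integrable (P.indicator g) :=
      (hgc.continuousOn.integrableOn_compact hPc).integrable_indicator hPc.isClosed.measurableSet
    have i2 : Integrable (Q.indicator g) :=
      (hgc.continuousOn.integrableOn_compact hQc).integrable_indicator hQc.isClosed.measurableSet
    rw [← integral_indicator hPc.isClosed.measurableSet,
      ← integral_indicator hQc.isClosed.measurableSet, ← sub_eq_zero, ← integral_sub i1 i2] at hE
    rw [← hE]
    apply integral_congr_ae
    have : ∀ᵐ z : ℂ, z ∉ Z := measure_eq_zero_iff_ae_notMem.1 hZ0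
    filter_upwards [this] with z hz
    simp only [hf, if_neg hz, indicator_apply]
    by_cases p1 : z ∈ P <;> by_cases p2 : z ∈ Q <;> simp [p1, p2, hg]
  have hzero := fo_main f hm hb B hB' ho hc (fo_cont f hm hb B hB' a b hab hint)
  have hiff : ∀ z ∉ Z, (z ∈ P ↔ z ∈ Q) := by
    intro z hz
    have := hzero z
    simp only [hf, if_neg hz, indicator_apply] at this
    by_cases p1 : z ∈ P <;> by_cases p2 : z ∈ Q <;> simp [p1, p2] at this ⊢
  have hsub : ∀ S T : Set ℂ, S ⊆ closure (interior S) → IsClosed T →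
      (∀ z ∉ Z, z ∈ S → z ∈ T) → S ⊆ T := by
    intro S T hS hT hST
    refine hS.trans (closure_minimal ?_ hT)
    intro x hx
    by_contra hxT
    have hopen : IsOpen (interior S ∩ Tᶜ) := isOpen_interior.inter hT.isOpen_compl
    have hsubZ : interior S ∩ Tᶜ ⊆ Z := by
      rintro y ⟨hy, hyT⟩
      by_contra hyZ
      exact hyT (hST y hyZ (interior_subset hy))
    have := hopen.measure_pos volume ⟨x, hx, hxT⟩
    exact this.ne' (measure_mono_null hsubZ hZ0)
  exact Subset.antisymm (hsub P Q hPi hQc.isClosed fun z hz => (hiff z hz).1)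
    (hsub Q P hQi hPc.isClosed fun z hz => (hiff z hz).2)

theorem fo_transfer {P : Set (EuclideanSpace ℝ (Fin 2))} (hP : IsGenPolytope P) :
    foG (Complex.orthonormalBasisOneI.repr ⁻¹' P) := by
  obtain ⟨m, Q, hQ, rfl⟩ := hP
  rw [preimage_iUnion]
  apply foG_union
  intro i
  obtain ⟨V, hV, hi⟩ := hQ i
  set e := Complex.orthonormalBasisOneI.repr with he
  have h1 : e ⁻¹' (Q i) = convexHull ℝ (e.symm '' (V : Set (EuclideanSpace ℝ (Fin 2)))) := by
    have h2 := LinearMap.image_convexHull (e.symm.toLinearEquiv : EuclideanSpace ℝ (Fin 2) →ₗ[ℝ] ℂ)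
      (V : Set (EuclideanSpace ℝ (Fin 2)))
    rw [← hV] at h2
    change e.symm '' (Q i) = convexHull ℝ (e.symm '' (V : Set (EuclideanSpace ℝ (Fin 2)))) at h2
    rw [← h2]
    ext z
    constructor
    · intro hz; exact ⟨e z, hz, by simp⟩
    · rintro ⟨x, hx, rfl⟩
      simpa using hx
  rw [h1]
  apply foG_hull (V.finite_toSet.image _)
  rw [← h1]
  have h3 := e.toHomeomorph.preimage_interior (Q i)
  change e ⁻¹' (interior (Q i)) = interior (e ⁻¹' (Q i)) at h3
  rw [← h3]
  obtain ⟨x, hx⟩ := hi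
  exact ⟨e.symm x, by simpa using hx⟩

theorem fo_ft (P : Set (EuclideanSpace ℝ (Fin 2))) (c s : ℝ) :
    fourierTransformSet P ((WithLp.equiv 2 (Fin 2 → ℝ)).symm ![c, s]) =
    ∫ z in Complex.orthonormalBasisOneI.repr ⁻¹' P,
      Complex.exp (-Complex.I * ((c * z.re + s * z.im : ℝ) : ℂ)) := by
  have hmp := Complex.orthonormalBasisOneI.measurePreserving_repr
  have := hmp.setIntegral_preimage_emb
    (Complex.orthonormalBasisOneI.repr.toHomeomorph.measurableEmbedding)
    (fun x => Complex.exp (-Complex.I * ((inner ℝ ((WithLp.equiv 2 (Fin 2 → ℝ)).symm ![c, s]) x : ℝ) : ℂ))) P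
  unfold fourierTransformSet
  rw [← this]
  congr 1
  ext z
  congr 4
  simp [PiLp.inner_apply, Fin.sum_univ_two, Complex.orthonormalBasisOneI]
  try ring

end FoAux

/-- Two generalized `2`-dimensional polytopes whose Fourier transforms
agree on the arc `σ(I)` of the unit circle, `σ(t) = ((1 - t²)/(1 + t²), 2t/(1 + t²))`,
for a nonempty open interval `I` avoiding `±1`, coincide. -/
theorem fourier_eq_on_circle_arc_implies_eq
    (P₁ P₂ : Set (EuclideanSpace ℝ (Fin 2)))
    (hP₁ : IsGenPolytope P₁) (hP₂ : IsGenPolytope P₂)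
    (I : Set ℝ) (a b : ℝ) (hab : a < b) (hI : I = Set.Ioo a b)
    (h1 : (1 : ℝ) ∉ I) (hm1 : (-1 : ℝ) ∉ I)
    (σ : ℝ → EuclideanSpace ℝ (Fin 2))
    (hσ : ∀ t : ℝ, σ t = (WithLp.equiv 2 (Fin 2 → ℝ)).symm
      ![(1 - t ^ 2) / (1 + t ^ 2), 2 * t / (1 + t ^ 2)])
    (heq : ∀ t ∈ I, fourierTransformSet P₁ (σ t) = fourierTransformSet P₂ (σ t)) :
    P₁ = P₂ := by
  have hmain := FoAux.fo_fin _ _ (FoAux.fo_transfer hP₁) (FoAux.fo_transfer hP₂) a b hab (by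
    intro t ht
    have := heq t (hI ▸ ht)
    rw [hσ, FoAux.fo_ft, FoAux.fo_ft] at this
    exact this)
  exact Complex.orthonormalBasisOneI.repr.surjective.preimage_injective hmain
end
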